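/- (Uniform polynomial Szemerédi theorem.) Let ℓ, m ∈ ℕ and let q_{i,j} : ℤ → ℤ be polynomials with q_{i,j}(0) = 0 for i = 1, …, ℓ and j = 1, …, m. Then for every α > 0 there exists a constant c > 0, depending only on α and the polynomials q_{i,j} (and in particular not on the probability space or the transformations), such that for every probability space (X, 𝒳, μ), all commuting invertible measure preserving transformations T₁, …, T_ℓ : X → X, and every A ∈ 𝒳 with μ(A) ≥ α, one has liminf_{N→∞} (1/N) Σ_{n=1}^N μ(A ∩ (∏_{i=1}^ℓ T_i^{q_{i,1}(n)})A ∩ … ∩ (∏_{i=1}^ℓ T_i^{q_{i,m}(n)})A) ≥ c. -/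

import Mathlib

set_option linter.all false
set_option linter.unusedVariables false
set_option linter.unusedSectionVars false

open MeasureTheory

/-- `prodPow T n` is the composition `T₁^{n₁} ∘ T₂^{n₂} ∘ ⋯ ∘ T_ℓ^{n_ℓ}` of the integer
powers of the invertible transformations `T i`. -/
def prodPow {X : Type*} {ℓ : ℕ} (T : Fin ℓ → Equiv.Perm X) (n : Fin ℓ → ℤ) : Equiv.Perm X :=
  (List.ofFn fun i => T i ^ n i).prod

open ProbabilityTheory Filter

open Classical in
/-- zero-based polynomial maps of degree at most `d`. -/
def PolyD (Q : Type) [AddCommGroup Q] : ℕ → AddSubgroup (ℤ → Q)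
  | 0 => ⊥
  | d + 1 =>
    { carrier := {w | ∀ h : ℤ, (fun n => w (n + h) - w n - w h) ∈ PolyD Q d}
      zero_mem' := by
        intro h
        have : (fun n : ℤ => (0 : ℤ → Q) (n + h) - (0 : ℤ → Q) n - (0 : ℤ → Q) h) = 0 := by
          ext n; simp
        rw [this]; exact zero_mem _
      add_mem' := by
        intro a b ha hb h
        have : (fun n : ℤ => (a + b) (n + h) - (a + b) n - (a + b) h) =
          (fun n => a (n + h) - a n - a h) + (fun n => b (n + h) - b n - b h) := by
          ext n; simp only [Pi.add_apply]; abel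
        rw [this]; exact add_mem (ha h) (hb h)
      neg_mem' := by
        intro a ha h
        have : (fun n : ℤ => (-a) (n + h) - (-a) n - (-a) h) =
          -(fun n => a (n + h) - a n - a h) := by
          ext n; simp only [Pi.neg_apply]; abel
        rw [this]; exact neg_mem (ha h) }

section PET
variable {Q : Type} [AddCommGroup Q]

def sh (h : ℤ) (w : ℤ → Q) : ℤ → Q := fun n => w (n + h) - w h

lemma mem_PolyD_succ {d : ℕ} {w : ℤ → Q} : w ∈ PolyD Q (d + 1) ↔ ∀ h, sh h w - w ∈ PolyD Q d := by
  refine forall_congr' fun h => ?_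
  have : (fun n => w (n + h) - w n - w h) = sh h w - w := by
    ext n; simp only [sh, Pi.sub_apply]; abel
  rw [← this]

lemma PolyD_zero_val {d : ℕ} {w : ℤ → Q} (hw : w ∈ PolyD Q d) : w 0 = 0 := by
  cases d with
  | zero => have : w = 0 := hw
            simp [this]
  | succ d =>
    have h0 := mem_PolyD_succ.1 hw 0
    induction d generalizing w with
    | zero => have := congrFun (show sh 0 w - w = 0 from h0) 0
              simpa [sh] using this
    | succ d ih =>
      have h1 := ih h0 (mem_PolyD_succ.1 h0 0)
      simpa [sh] using h1

lemma PolyD_mono {d e : ℕ} (h : d ≤ e) : PolyD Q d ≤ PolyD Q e := by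
  refine monotone_nat_of_le_succ (f := PolyD Q) (fun d => ?_) h
  induction d with
  | zero => intro w hw
            have : w = 0 := hw
            rw [this]; exact zero_mem _
  | succ d ih => intro w hw
                 exact mem_PolyD_succ.2 fun h => ih (mem_PolyD_succ.1 hw h)

lemma sh_mem {d : ℕ} {w : ℤ → Q} (h : ℤ) (hw : w ∈ PolyD Q d) : sh h w ∈ PolyD Q d := by
  cases d with
  | zero => have : w = 0 := hw
            have h2 : sh h w = 0 := by ext n; simp [sh, this]
            rw [h2]; exact zero_mem _
  | succ d =>
    have := add_mem (PolyD_mono (Nat.le_succ d) (mem_PolyD_succ.1 hw h)) hw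
    simpa using this

lemma sh_sh (h k : ℤ) (w : ℤ → Q) : sh h (sh k w) = sh (h + k) w := by
  ext n; simp [sh, add_assoc]

lemma sh_zero {w : ℤ → Q} (hw : w 0 = 0) : sh 0 w = w := by ext n; simp [sh, hw]

lemma sh_mem_iff {d : ℕ} {w : ℤ → Q} (h : ℤ) (h0 : w 0 = 0) : sh h w ∈ PolyD Q d ↔ w ∈ PolyD Q d := by
  refine ⟨fun hw => ?_, sh_mem h⟩
  have := sh_mem (-h) hw
  rwa [sh_sh, neg_add_cancel, sh_zero h0] at this

open Classical in
noncomputable def cnt (e : ℕ) (W : Finset (ℤ → Q)) (d : Fin e) : ℕ :=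
  ((W.filter fun w => w ∈ PolyD Q (d + 1) ∧ w ∉ PolyD Q d).image
    (QuotientAddGroup.mk (s := PolyD Q d))).card

def cntLT (e : ℕ) : Finset (ℤ → Q) → Finset (ℤ → Q) → Prop :=
  InvImage (Pi.Lex (fun i j : Fin e => i > j) (fun {_} (a b : ℕ) => a < b)) (cnt e)

lemma cntLT_wf (e : ℕ) : WellFounded (cntLT (Q := Q) e) :=
  InvImage.wf _ (Pi.Lex.wellFounded (fun i j : Fin e => i > j) (fun _ => wellFounded_lt))

lemma lex_of_le {e : ℕ} {x y : Fin e → ℕ} (i : Fin e) (h1 : ∀ j, i < j → x j ≤ y j) (h2 : x i < y i) :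
    Pi.Lex (fun i j : Fin e => i > j) (fun {_} (a b : ℕ) => a < b) x y := by
  classical
  let s := Finset.univ.filter fun j : Fin e => x j < y j
  have hs : s.Nonempty := ⟨i, by simp [s, h2]⟩
  refine ⟨s.max' hs, fun j hj => ?_, (Finset.mem_filter.1 (s.max'_mem hs)).2⟩
  have hij : i < j := lt_of_le_of_lt (s.le_max' i (by simp [s, h2])) hj
  by_contra hne
  have : j ∈ s := by simp [s, lt_of_le_of_ne (h1 j hij) hne]
  exact absurd (s.le_max' j this) (not_le.2 hj)

lemma exists_deg {w : ℤ → Q} {e : ℕ} (hw : w ∈ PolyD Q e) (h0 : w ≠ 0) :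
    ∃ d < e, w ∈ PolyD Q (d + 1) ∧ w ∉ PolyD Q d := by
  induction e with
  | zero => exact absurd hw h0
  | succ e ih =>
    by_cases h : w ∈ PolyD Q e
    · obtain ⟨d, h1, h2⟩ := ih h
      exact ⟨d, by omega, h2⟩
    · exact ⟨e, by omega, hw, h⟩

/-- PET descent. -/
lemma pet_descent {e : ℕ} (W : Finset (ℤ → Q)) (hW : ∀ w ∈ W, w ∈ PolyD Q e) (hne : ∃ w ∈ W, w ≠ 0) :
    ∃ w₀ ∈ W, w₀ ≠ 0 ∧ ∀ W' : Finset (ℤ → Q),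
      (∀ w' ∈ W', ∃ w ∈ W, w ≠ 0 ∧ ∃ h, w' = sh h w - w₀) →
        (∀ w' ∈ W', w' ∈ PolyD Q e) ∧ cntLT e W' W := by
  classical
  have hex : ∃ d, ∃ w ∈ W, d < e ∧ w ∈ PolyD Q (d + 1) ∧ w ∉ PolyD Q d := by
    obtain ⟨w, hw, hw0⟩ := hne
    obtain ⟨d, hd⟩ := exists_deg (hW w hw) hw0
    exact ⟨d, w, hw, hd⟩
  obtain ⟨w₀, hw₀, hde, hd1, hd2⟩ := Nat.find_spec hex
  set d := Nat.find hex with hd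
  have hmin : ∀ w ∈ W, w ≠ 0 → w ∉ PolyD Q d := by
    intro w hw h0 hwd
    obtain ⟨d', h1, h2⟩ := exists_deg hwd h0
    exact Nat.find_min hex h1 ⟨w, hw, by omega, h2⟩
  refine ⟨w₀, hw₀, fun h => hd2 (h ▸ zero_mem _), fun W' hW' => ⟨?_, ?_⟩⟩
  · intro w' hw'
    obtain ⟨w, hw, _, h, rfl⟩ := hW' w' hw'
    exact sub_mem (sh_mem h (hW w hw)) (hW _ hw₀)
  · refine lex_of_le ⟨d, hde⟩ (fun j hj => ?_) ?_
    · refine Finset.card_le_card ?_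
      intro c hc
      obtain ⟨w', hw', rfl⟩ := Finset.mem_image.1 hc
      obtain ⟨hw', h1, h2⟩ := Finset.mem_filter.1 hw'
      obtain ⟨w, hw, _, h, rfl⟩ := hW' w' hw'
      have hj' : d + 1 ≤ j := hj
      have h0 : w₀ ∈ PolyD Q j := PolyD_mono hj' hd1
      have hwz := PolyD_zero_val (hW w hw)
      have ha : w ∈ PolyD Q (j + 1) := by
        rw [← sh_mem_iff h hwz]
        have := add_mem h1 (PolyD_mono (Nat.le_succ _) h0)
        simpa using this
      have hb : w ∉ PolyD Q j := fun hb => h2 (sub_mem (sh_mem h hb) h0)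
      refine Finset.mem_image.2 ⟨w, Finset.mem_filter.2 ⟨hw, ha, hb⟩, ?_⟩
      rw [QuotientAddGroup.eq]
      have := sub_mem (mem_PolyD_succ.1 ha h) h0
      convert this using 1; abel
    · have hw₀m : w₀ ∈ W.filter fun w => w ∈ PolyD Q (d + 1) ∧ w ∉ PolyD Q d :=
        Finset.mem_filter.2 ⟨hw₀, hd1, hd2⟩
      refine lt_of_le_of_lt (Finset.card_le_card_of_injOn (t := ((W.filter fun w => w ∈ PolyD Q (d + 1) ∧ w ∉ PolyD Q d).image
        (QuotientAddGroup.mk (s := PolyD Q d))).erase (QuotientAddGroup.mk w₀))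
        (fun c => c + QuotientAddGroup.mk w₀) ?_ (fun a _ b _ hab => add_right_cancel hab)) (Finset.card_erase_lt_of_mem
          (Finset.mem_image_of_mem _ hw₀m))
      intro c hc
      obtain ⟨w', hw', rfl⟩ := Finset.mem_image.1 hc
      obtain ⟨hw', h1, h2⟩ := Finset.mem_filter.1 hw'
      obtain ⟨w, hw, hwn, h, rfl⟩ := hW' w' hw'
      have hwz := PolyD_zero_val (hW w hw)
      have ha : w ∈ PolyD Q (d + 1) := by
        rw [← sh_mem_iff h hwz]
        have := add_mem h1 hd1
        simpa using this
      refine Finset.mem_coe.2 (Finset.mem_erase.2 ⟨?_, Finset.mem_image.2 ⟨w, Finset.mem_filter.2 ⟨hw, ha, hmin w hw hwn⟩, ?_⟩⟩)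
      · intro h3
        have h4 : (QuotientAddGroup.mk (sh h w - w₀) : (ℤ → Q) ⧸ PolyD Q d) = 0 := by
          simpa [sub_eq_zero] using h3
        exact h2 ((QuotientAddGroup.eq_zero_iff _).1 h4)
      · change (QuotientAddGroup.mk w : (ℤ → Q) ⧸ PolyD Q d) = QuotientAddGroup.mk (sh h w - w₀) + QuotientAddGroup.mk w₀
        rw [← QuotientAddGroup.mk_add, QuotientAddGroup.eq]
        have := mem_PolyD_succ.1 ha h
        convert this using 1; abel

lemma PolyD_one_mul {w : ℤ → Q} (hw : w ∈ PolyD Q 1) (n : ℤ) : w n = n • w 1 := by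
  have hadd : ∀ a b, w (a + b) = w a + w b := by
    intro a b
    have := congrFun (show sh b w - w = 0 from mem_PolyD_succ.1 hw b) a
    simp only [sh, Pi.sub_apply, Pi.zero_apply] at this
    have h2 : w (a + b) = (w (a + b) - w b - w a) + w a + w b := by abel
    rw [h2, this]; abel
  let f : ℤ →+ Q := AddMonoidHom.mk' w hadd
  have := map_zsmul f n 1
  simpa [f] using this

lemma sh_fix {e : ℕ} (htf : ∀ (k : ℤ) (x : Q), k ≠ 0 → k • x = 0 → x = 0) {k : ℤ} (hk : k ≠ 0) :
    ∀ {w : ℤ → Q}, w ∈ PolyD Q e → sh k w = w → w ∈ PolyD Q 1 := by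
  induction e with
  | zero => intro w hw _; exact PolyD_mono (Nat.zero_le _) hw
  | succ e ih =>
    intro w hw hfix
    refine mem_PolyD_succ.2 fun j => ?_
    have h1 : sh j w - w ∈ PolyD Q 1 := by
      refine ih (mem_PolyD_succ.1 hw j) ?_
      have : sh k (sh j w - w) = sh j (sh k w) - sh k w := by
        rw [sh_sh]; ext n
        simp only [sh, Pi.sub_apply, add_comm, add_left_comm]; abel
      rw [this, hfix]
    have h2 := PolyD_one_mul h1
    have h3 : (sh j w - w) k = 0 := by
      have := congrFun hfix j
      simp only [sh, Pi.sub_apply] at this ⊢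
      rw [add_comm k j, ← this]; abel
    have h4 := htf k _ hk ((h2 k).symm.trans h3)
    change sh j w - w = 0
    ext n; rw [h2 n, h4]; simp

lemma PolyD_mul_id {d : ℕ} : ∀ {w : ℤ → Q}, w ∈ PolyD Q d → (fun n => n • w n) ∈ PolyD Q (d + 1) := by
  induction d with
  | zero => intro w hw
            have : w = 0 := hw
            have h2 : (fun n : ℤ => n • w n) = 0 := by ext n; simp [this]
            rw [h2]; exact zero_mem _
  | succ d ih =>
    intro w hw
    refine mem_PolyD_succ.2 fun h => ?_
    have h1 := ih (mem_PolyD_succ.1 hw h)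
    have h2 : (fun n : ℤ => n • w h) ∈ PolyD Q (d + 1) := by
      refine PolyD_mono (show 1 ≤ d + 1 by omega) (mem_PolyD_succ.2 fun k => ?_)
      change _ = _
      ext n; simp [sh, add_smul]
    have h3 := zsmul_mem (sh_mem h hw) h
    have := add_mem (add_mem h1 h2) h3
    convert this using 1
    ext n; simp only [sh, Pi.add_apply, Pi.sub_apply, Pi.smul_apply, add_smul, smul_sub]; abel

lemma PolyD_pow (x : Q) (k : ℕ) : (fun n : ℤ => n ^ (k + 1) • x) ∈ PolyD Q (k + 1) := by
  induction k with
  | zero => refine mem_PolyD_succ.2 fun k => ?_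
            change _ = _
            ext n; simp [sh, add_smul]
  | succ k ih =>
    convert PolyD_mul_id ih using 1
    ext n; rw [smul_smul]; congr 1; ring

open scoped Pointwise in
/-- polynomial van der Waerden -/
theorem poly_vdw {e : ℕ} : ∀ W : Finset (ℤ → Q), (∀ w ∈ W, w ∈ PolyD Q e) → ∀ (κ : Type) [Finite κ],
    ∃ (F : Finset Q) (N : ℕ), ∀ c : Q → κ, ∃ a ∈ F, ∃ d : ℕ, 1 ≤ d ∧ d ≤ N ∧
      ∀ w ∈ W, a + w d ∈ F ∧ c (a + w d) = c a := by
  classical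
  intro W
  induction W using (cntLT_wf (Q := Q) e).induction with
  | _ W IH =>
  intro hW κ _
  by_cases hne : ∃ w ∈ W, w ≠ 0
  swap
  · refine ⟨{0}, 1, fun c => ⟨0, by simp, 1, le_rfl, le_rfl, fun w hw => ?_⟩⟩
    have : w = 0 := by by_contra h; exact hne ⟨w, hw, h⟩
    simp [this]
  obtain ⟨w₀, hw₀, hw₀n, hdesc⟩ := pet_descent W hW hne
  have : Fintype κ := Fintype.ofFinite κ
  have key : ∀ r : ℕ, ∃ (F : Finset Q) (N : ℕ), ∀ c : Q → κ,
      (∃ a ∈ F, ∃ d : ℕ, 1 ≤ d ∧ d ≤ N ∧ ∀ w ∈ W, a + w d ∈ F ∧ c (a + w d) = c a) ∨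
      (∃ a ∈ F, ∃ S : Finset κ, S.card = r ∧ ∀ s ∈ S, ∃ d : ℕ, 1 ≤ d ∧ d ≤ N ∧
        ∀ w ∈ W, w ≠ 0 → a + w d ∈ F ∧ c (a + w d) = s) := by
    intro r
    induction r with
    | zero => exact ⟨{0}, 0, fun c => Or.inr ⟨0, by simp, ∅, by simp⟩⟩
    | succ r ih =>
      obtain ⟨F, N, hF⟩ := ih
      let W' : Finset (ℤ → Q) := ((Finset.range (N + 1)) ×ˢ (W.filter (· ≠ 0))).image
        fun p => sh (p.1 : ℤ) p.2 - w₀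
      have hW' := hdesc W' (by
        intro w' hw'
        obtain ⟨p, hp, rfl⟩ := Finset.mem_image.1 hw'
        have := Finset.mem_filter.1 (Finset.mem_product.1 hp).2
        exact ⟨p.2, this.1, this.2, _, rfl⟩)
      obtain ⟨F', N', hF'⟩ := IH W' hW'.2 hW'.1 (F → κ)
      refine ⟨(F' + F) ∪ ((F' ×ˢ F ×ˢ (Finset.range (N' + 1))).image fun p => p.1 + p.2.1 - w₀ p.2.2),
        N' + N, fun c => ?_⟩
      obtain ⟨z, hz, d, hd1, hd2, hd⟩ := hF' (fun z (x : F) => c (z + x))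
      have hmem : ∀ u ∈ F', ∀ x ∈ F, u + x ∈ (F' + F) ∪ ((F' ×ˢ F ×ˢ (Finset.range (N' + 1))).image
          fun p => p.1 + p.2.1 - w₀ p.2.2) := fun u hu x hx =>
        Finset.mem_union_left _ (Finset.add_mem_add hu hx)
      have hc : ∀ w ∈ W, w ≠ 0 → ∀ t ≤ N, ∀ x ∈ F, z + (sh (t : ℤ) w - w₀) d ∈ F' ∧
          c (z + (sh (t : ℤ) w - w₀) d + x) = c (z + x) := by
        intro w hw hwn t ht x hx
        have := hd (sh (t : ℤ) w - w₀) (Finset.mem_image.2 ⟨(t, w), by simp [hw, hwn]; omega, rfl⟩)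
        exact ⟨this.1, congrFun this.2 ⟨x, hx⟩⟩
      rcases hF (fun x => c (z + x)) with ⟨a, ha, t, ht1, ht2, ht⟩ | ⟨a, ha, S, hS, hf⟩
      · refine Or.inl ⟨z + a, hmem _ hz _ ha, t, ht1, by omega, fun w hw => ?_⟩
        rw [add_assoc]
        exact ⟨hmem _ hz _ (ht w hw).1, (ht w hw).2⟩
      · by_cases hcS : c (z + a) ∈ S
        · obtain ⟨t, ht1, ht2, ht⟩ := hf _ hcS
          refine Or.inl ⟨z + a, hmem _ hz _ ha, t, ht1, by omega, fun w hw => ?_⟩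
          by_cases hwn : w = 0
          · simpa [hwn] using hmem _ hz _ ha
          rw [add_assoc]
          exact ⟨hmem _ hz _ (ht w hw hwn).1, (ht w hw hwn).2⟩
        · refine Or.inr ⟨z + a - w₀ d, Finset.mem_union_right _ (Finset.mem_image.2 ⟨(z, a, d), by
            simp [hz, ha]; omega, rfl⟩), insert (c (z + a)) S, by rw [Finset.card_insert_of_notMem hcS, hS], ?_⟩
          intro s hs
          rcases Finset.mem_insert.1 hs with rfl | hs
          · refine ⟨d, hd1, by omega, fun w hw hwn => ?_⟩
            have h1 := hc w hw hwn 0 (Nat.zero_le _) a ha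
            have h2 : z + a - w₀ d + w d = z + (sh ((0 : ℕ) : ℤ) w - w₀) d + a := by
              simp only [Nat.cast_zero, sh_zero (PolyD_zero_val (hW w hw)), Pi.sub_apply]; abel
            rw [h2]
            exact ⟨hmem _ h1.1 _ ha, h1.2⟩
          · obtain ⟨t, ht1, ht2, ht⟩ := hf _ hs
            refine ⟨d + t, by omega, by omega, fun w hw hwn => ?_⟩
            have h1 := hc w hw hwn t ht2 _ (ht w hw hwn).1
            have h2 : z + a - w₀ d + w ((d + t : ℕ) : ℤ) = z + (sh (t : ℤ) w - w₀) d + (a + w t) := by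
              simp only [sh, Nat.cast_add, Pi.sub_apply]; abel
            rw [h2]
            exact ⟨hmem _ h1.1 _ (ht w hw hwn).1, h1.2.trans (ht w hw hwn).2⟩
  obtain ⟨F, N, hF⟩ := key (Fintype.card κ + 1)
  refine ⟨F, N, fun c => (hF c).resolve_right ?_⟩
  rintro ⟨a, _, S, hS, _⟩
  have := S.card_le_univ
  omega

end PET
def BM {Z : Type} [m : MeasurableSpace Z] (f : Z → ℝ) : Prop := Measurable f ∧ ∃ C, ∀ x, |f x| ≤ C

namespace BM
variable {Z : Type} {m : MeasurableSpace Z} {f g : Z → ℝ}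

lemma bd (hf : BM f) : ∃ C, 0 < C ∧ ∀ x, |f x| ≤ C := by
  obtain ⟨C, hC⟩ := hf.2
  exact ⟨max C 1, by positivity, fun x => (hC x).trans (le_max_left _ _)⟩
lemma const (c : ℝ) : BM (fun _ : Z => c) := ⟨measurable_const, |c|, fun _ => le_rfl⟩
lemma zero : BM (0 : Z → ℝ) := const 0
lemma one : BM (1 : Z → ℝ) := const 1
lemma add (hf : BM f) (hg : BM g) : BM (f + g) := by
  obtain ⟨C, hC⟩ := hf.2; obtain ⟨D, hD⟩ := hg.2
  exact ⟨hf.1.add hg.1, C + D, fun x => (abs_add_le _ _).trans (add_le_add (hC x) (hD x))⟩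
lemma mul (hf : BM f) (hg : BM g) : BM (f * g) := by
  obtain ⟨C, hC0, hC⟩ := hf.bd; obtain ⟨D, hD0, hD⟩ := hg.bd
  refine ⟨hf.1.mul hg.1, C * D, fun x => ?_⟩
  rw [Pi.mul_apply, abs_mul]
  exact mul_le_mul (hC x) (hD x) (abs_nonneg _) hC0.le
lemma neg (hf : BM f) : BM (-f) := by
  obtain ⟨C, hC⟩ := hf.2
  exact ⟨hf.1.neg, C, fun x => by simpa using hC x⟩
lemma sub (hf : BM f) (hg : BM g) : BM (f - g) := by
  rw [sub_eq_add_neg]; exact hf.add hg.neg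
lemma smul (hf : BM f) (c : ℝ) : BM (c • f) := (const c).mul hf
lemma abs (hf : BM f) : BM |f| := by
  obtain ⟨C, hC⟩ := hf.2
  refine ⟨?_, C, fun x => by simpa using hC x⟩
  have : |f| = fun x => |f x| := rfl
  rw [this]; simpa [Real.norm_eq_abs] using hf.1.norm
lemma sum {ι : Type*} {t : Finset ι} {F : ι → Z → ℝ} (h : ∀ i ∈ t, BM (F i)) : BM (∑ i ∈ t, F i) :=
  Finset.sum_induction _ BM (fun _ _ => add) zero h
lemma prod {ι : Type*} {t : Finset ι} {F : ι → Z → ℝ} (h : ∀ i ∈ t, BM (F i)) : BM (∏ i ∈ t, F i) :=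
  Finset.prod_induction _ BM (fun _ _ => mul) one h
lemma ind {A : Set Z} (hA : MeasurableSet A) : BM (A.indicator (1 : Z → ℝ)) := by
  refine ⟨measurable_one.indicator hA, 1, fun x => ?_⟩
  by_cases h : x ∈ A <;> simp [h]
lemma comp {Z' : Type} {m' : MeasurableSpace Z'} (hf : BM f) {φ : Z' → Z} (hφ : Measurable φ) : BM (f ∘ φ) :=
  ⟨hf.1.comp hφ, hf.2.imp fun _ h x => h _⟩
lemma int (hf : BM f) (μ : Measure Z) [IsFiniteMeasure μ] : Integrable f μ := by
  obtain ⟨C, hC⟩ := hf.2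
  exact Integrable.of_bound hf.1.aestronglyMeasurable C (ae_of_all _ hC)
lemma of_le {m' : MeasurableSpace Z} (h : m ≤ m') (hf : @BM Z m f) : @BM Z m' f := ⟨hf.1.mono h le_rfl, hf.2⟩
end BM

structure Sys (G X : Type) [AddCommGroup G] [mX : MeasurableSpace X] where
  T : G → X → X
  zero : ∀ x, T 0 x = x
  add : ∀ a b x, T (a + b) x = T a (T b x)
  μ : Measure X
  prob : IsProbabilityMeasure μ
  mp : ∀ g, MeasurePreserving (T g) μ μ
  Y : MeasurableSpace X
  le : Y ≤ mX
  inv : ∀ g, Measurable[Y, Y] (T g)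

attribute [instance] Sys.prob

namespace Sys
variable {G X : Type} [AddCommGroup G] [mX : MeasurableSpace X] [StandardBorelSpace X] (s : Sys G X)

noncomputable def κ : Kernel X X := (condExpKernel s.μ s.Y).comap id (measurable_id'' s.le)
instance : IsMarkovKernel s.κ := by unfold κ; infer_instance
def BY (f : X → ℝ) : Prop := @BM X s.Y f
def tr (g : G) (f : X → ℝ) : X → ℝ := fun x => f (s.T g x)
noncomputable def E (f : X → ℝ) : X → ℝ := fun x => ∫ z, f z ∂(s.κ x)
noncomputable def I (f : X → ℝ) : ℝ := ∫ x, f x ∂s.μ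
noncomputable def N (f : X → ℝ) : ℝ := s.I |f|

variable {s} {f g : X → ℝ}

lemma BY.bm (h : s.BY f) : BM f := BM.of_le s.le h

lemma I_add (hf : BM f) (hg : BM g) : s.I (f + g) = s.I f + s.I g := integral_add (hf.int _) (hg.int _)
lemma I_sub (hf : BM f) (hg : BM g) : s.I (f - g) = s.I f - s.I g := integral_sub (hf.int _) (hg.int _)
lemma I_smul (c : ℝ) (f : X → ℝ) : s.I (c • f) = c * s.I f := integral_const_mul c f
lemma I_sum {ι : Type*} {t : Finset ι} {F : ι → X → ℝ} (h : ∀ i ∈ t, BM (F i)) :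
    s.I (∑ i ∈ t, F i) = ∑ i ∈ t, s.I (F i) := by
  simp only [I, Finset.sum_apply]
  exact integral_finsetSum t fun i hi => (h i hi).int _
lemma I_mono (hf : BM f) (hg : BM g) (h : ∀ x, f x ≤ g x) : s.I f ≤ s.I g :=
  integral_mono (hf.int _) (hg.int _) h
lemma I_congr (h : f =ᵐ[s.μ] g) : s.I f = s.I g := integral_congr_ae h
lemma I_nonneg (h : ∀ x, 0 ≤ f x) : 0 ≤ s.I f := integral_nonneg h
lemma I_const (c : ℝ) : s.I (fun _ => c) = c := by simp [I]
lemma abs_I_le : |s.I f| ≤ s.N f := abs_integral_le_integral_abs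
lemma N_nonneg : 0 ≤ s.N f := I_nonneg fun _ => abs_nonneg _
lemma N_add (hf : BM f) (hg : BM g) : s.N (f + g) ≤ s.N f + s.N g := by
  rw [N, N, N, ← I_add hf.abs hg.abs]
  exact I_mono (hf.add hg).abs (hf.abs.add hg.abs) fun x => abs_add_le _ _
lemma N_neg : s.N (-f) = s.N f := by simp [N]
lemma N_sub_comm : s.N (f - g) = s.N (g - f) := by rw [← N_neg, neg_sub]
lemma N_sub (hf : BM f) (hg : BM g) : s.N (f - g) ≤ s.N f + s.N g := by
  rw [sub_eq_add_neg, ← N_neg (f := g)]; exact N_add hf hg.neg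
lemma N_tri {h : X → ℝ} (hf : BM f) (hg : BM g) (hh : BM h) : s.N (f - h) ≤ s.N (f - g) + s.N (g - h) := by
  have := N_add (s := s) (hf.sub hg) (hg.sub hh)
  simpa using this
lemma N_smul (c : ℝ) : s.N (c • f) = |c| * s.N f := by
  rw [N, N, ← I_smul]; congr 1; ext x; simp [abs_mul]
lemma N_sum {ι : Type*} {t : Finset ι} {F : ι → X → ℝ} (h : ∀ i ∈ t, BM (F i)) :
    s.N (∑ i ∈ t, F i) ≤ ∑ i ∈ t, s.N (F i) := by
  have : ∑ i ∈ t, s.N (F i) = s.I (∑ i ∈ t, |F i|) := (I_sum fun i hi => (h i hi).abs).symm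
  rw [this]
  exact I_mono (BM.sum h).abs (BM.sum fun i hi => (h i hi).abs) fun x => by
    simpa using Finset.abs_sum_le_sum_abs _ _
lemma N_mul {C : ℝ} (hf : BM f) (hg : BM g) (hC : ∀ x, |f x| ≤ C) : s.N (f * g) ≤ C * s.N g := by
  rw [N, N, ← I_smul]
  refine I_mono (hf.mul hg).abs (hg.abs.smul C) fun x => ?_
  simp only [Pi.abs_apply, Pi.mul_apply, abs_mul, Pi.smul_apply, smul_eq_mul]
  exact mul_le_mul_of_nonneg_right (hC x) (abs_nonneg _)
lemma N_le {C : ℝ} (hf : BM f) (hC : ∀ x, |f x| ≤ C) : s.N f ≤ C := by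
  rw [← I_const (s := s) C]; exact I_mono hf.abs (BM.const C) hC
lemma N_eq_zero (hf : BM f) : s.N f = 0 ↔ f =ᵐ[s.μ] 0 := by
  refine (integral_eq_zero_iff_of_nonneg (f := |f|) (fun _ => abs_nonneg _) (hf.abs.int _)).trans ?_
  exact ⟨fun h => h.mono fun x hx => by simpa using hx, fun h => h.mono fun x hx => by simpa using hx⟩
lemma N_congr (h : f =ᵐ[s.μ] g) : s.N f = s.N g := I_congr (h.mono fun x hx => by simp [hx])

lemma tr_apply (a : G) (x : X) : s.tr a f x = f (s.T a x) := rfl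
lemma tr_tr (a b : G) : s.tr a (s.tr b f) = s.tr (a + b) f := by
  ext x; rw [tr_apply, tr_apply, tr_apply, add_comm, s.add]
lemma tr_zero : s.tr 0 f = f := by ext x; rw [tr_apply, s.zero]
lemma tr_mul (a : G) : s.tr a (f * g) = s.tr a f * s.tr a g := rfl
lemma tr_add (a : G) : s.tr a (f + g) = s.tr a f + s.tr a g := rfl
lemma tr_sub (a : G) : s.tr a (f - g) = s.tr a f - s.tr a g := rfl
lemma tr_smul (a : G) (c : ℝ) : s.tr a (c • f) = c • s.tr a f := rfl
lemma tr_abs (a : G) : s.tr a |f| = |s.tr a f| := rfl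
lemma tr_sum {ι : Type*} {t : Finset ι} {F : ι → X → ℝ} (a : G) :
    s.tr a (∑ i ∈ t, F i) = ∑ i ∈ t, s.tr a (F i) := by ext x; simp [tr]
lemma tr_prod {ι : Type*} {t : Finset ι} {F : ι → X → ℝ} (a : G) :
    s.tr a (∏ i ∈ t, F i) = ∏ i ∈ t, s.tr a (F i) := by ext x; simp [tr]
lemma tr_bm (a : G) (hf : BM f) : BM (s.tr a f) := hf.comp (s.mp a).measurable
lemma tr_by (a : G) (hf : s.BY f) : s.BY (s.tr a f) := BM.comp (m := s.Y) (m' := s.Y) hf (s.inv a)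
lemma I_tr (a : G) (hf : BM f) : s.I (s.tr a f) = s.I f := by
  unfold I tr
  rw [← integral_map (s.mp a).measurable.aemeasurable (hf.1.aestronglyMeasurable), (s.mp a).map_eq]
lemma N_tr (a : G) (hf : BM f) : s.N (s.tr a f) = s.N f := I_tr a hf.abs
lemma tr_ae (a : G) (h : f =ᵐ[s.μ] g) : s.tr a f =ᵐ[s.μ] s.tr a g :=
  (s.mp a).quasiMeasurePreserving.ae_eq_comp h

lemma E_add (hf : BM f) (hg : BM g) : s.E (f + g) = s.E f + s.E g := by
  ext x; exact integral_add (hf.int _) (hg.int _)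
lemma E_sub (hf : BM f) (hg : BM g) : s.E (f - g) = s.E f - s.E g := by
  ext x; exact integral_sub (hf.int _) (hg.int _)
lemma E_smul (c : ℝ) (f : X → ℝ) : s.E (c • f) = c • s.E f := by
  ext x; exact integral_const_mul c f
lemma E_sum {ι : Type*} {t : Finset ι} {F : ι → X → ℝ} (h : ∀ i ∈ t, BM (F i)) :
    s.E (∑ i ∈ t, F i) = ∑ i ∈ t, s.E (F i) := by
  ext x
  simp only [E, Finset.sum_apply]
  exact integral_finsetSum t fun i hi => (h i hi).int _
lemma E_mono (hf : BM f) (hg : BM g) (h : ∀ x, f x ≤ g x) (x : X) : s.E f x ≤ s.E g x :=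
  integral_mono (hf.int _) (hg.int _) h
lemma E_nonneg (h : ∀ x, 0 ≤ f x) (x : X) : 0 ≤ s.E f x := integral_nonneg h
lemma E_const (c : ℝ) : s.E (fun _ => c) = fun _ => c := by ext x; simp [E]
lemma E_abs (x : X) : |s.E f x| ≤ s.E |f| x := abs_integral_le_integral_abs
lemma E_bd {C : ℝ} (hf : BM f) (hC : ∀ x, |f x| ≤ C) (x : X) : |s.E f x| ≤ C := by
  refine E_abs x |>.trans ?_
  have := E_mono (s := s) hf.abs (BM.const C) hC x
  rwa [E_const] at this
lemma E_by (hf : BM f) : s.BY (s.E f) := by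
  obtain ⟨C, hC⟩ := hf.2
  refine ⟨?_, C, E_bd hf hC⟩
  exact (StronglyMeasurable.integral_condExpKernel' (m := s.Y) (μ := s.μ) hf.1.stronglyMeasurable).measurable.mono inf_le_left le_rfl
lemma E_bm (hf : BM f) : BM (s.E f) := (E_by hf).bm
lemma E_condExp (hf : BM f) : s.E f =ᵐ[s.μ] s.μ[f|s.Y] :=
  (condExp_ae_eq_integral_condExpKernel s.le (hf.int _)).symm
lemma I_E (hf : BM f) : s.I (s.E f) = s.I f := by
  rw [I_congr (E_condExp hf)]; exact integral_condExp s.le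
lemma N_E (hf : BM f) : s.N (s.E f) ≤ s.N f := by
  rw [N, N, ← I_E hf.abs]
  exact I_mono (E_bm hf).abs (E_bm hf.abs) fun x => E_abs x
lemma E_congr (hf : BM f) (hg : BM g) (h : f =ᵐ[s.μ] g) : s.E f =ᵐ[s.μ] s.E g :=
  (E_condExp hf).trans ((condExp_congr_ae h).trans (E_condExp hg).symm)
lemma E_pull {c : X → ℝ} (hc : s.BY c) (hf : BM f) : s.E (c * f) =ᵐ[s.μ] c * s.E f := by
  refine (E_condExp (hc.bm.mul hf)).trans ((condExp_mul_of_stronglyMeasurable_left ?_ ((hc.bm.mul hf).int _)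
    (hf.int _)).trans ((E_condExp hf).symm.mono fun x hx => by simp [hx]))
  exact Measurable.stronglyMeasurable hc.1
lemma E_of_by {c : X → ℝ} (hc : s.BY c) : s.E c =ᵐ[s.μ] c := by
  have := E_pull hc (BM.const 1)
  rw [E_const] at this
  have h2 : c * (fun _ => (1 : ℝ)) = c := by ext; simp
  rwa [h2] at this
lemma I_mul_E {c : X → ℝ} (hc : s.BY c) (hf : BM f) : s.I (c * s.E f) = s.I (c * f) := by
  rw [← I_congr (E_pull hc hf), I_E (hc.bm.mul hf)]
lemma ae_zero_of_sq (hf : BM f) (h : s.I (f * f) = 0) : f =ᵐ[s.μ] 0 := by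
  have := (integral_eq_zero_iff_of_nonneg (fun x => mul_self_nonneg _) ((hf.mul hf).int _)).1 h
  exact this.mono fun x hx => mul_self_eq_zero.1 hx
lemma by_unique {a b : X → ℝ} (ha : s.BY a) (hb : s.BY b) (h : ∀ c, s.BY c → s.I (c * a) = s.I (c * b)) :
    a =ᵐ[s.μ] b := by
  have hd : s.BY (a - b) := BM.sub ha hb
  have h1 := h _ hd
  have h2 : s.I ((a - b) * (a - b)) = 0 := by
    rw [mul_sub, I_sub (hd.bm.mul ha.bm) (hd.bm.mul hb.bm), h1, sub_self]
  exact (ae_zero_of_sq hd.bm h2).mono fun x hx => sub_eq_zero.1 hx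
lemma E_tr (a : G) (hf : BM f) : s.E (s.tr a f) =ᵐ[s.μ] s.tr a (s.E f) := by
  refine by_unique (E_by (tr_bm a hf)) (tr_by a (E_by hf)) fun c hc => ?_
  have key : ∀ h : X → ℝ, BM h → s.I (c * s.tr a h) = s.I (s.tr (-a) c * h) := by
    intro h hh
    rw [← I_tr (s := s) a ((tr_bm (-a) hc.bm).mul hh), tr_mul, tr_tr, add_neg_cancel, tr_zero]
  rw [I_mul_E hc (tr_bm a hf), key _ hf, key _ (E_bm hf), I_mul_E (tr_by (-a) hc) hf]
/-- a `Y`-measurable function is constant on a.e. fibre -/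
lemma by_const {c : X → ℝ} (hc : s.BY c) : ∀ᵐ y ∂s.μ, ∀ᵐ x ∂(s.κ y), c x = c y := by
  filter_upwards [E_of_by hc, E_of_by (s := s) (BM.mul hc hc)] with y h1 h2
  have h3 : ∫ x, (c x - c y) * (c x - c y) ∂(s.κ y) = 0 := by
    have : s.E (c * c - (2 * c y) • c + fun _ => c y * c y) y = 0 := by
      rw [E_add ((hc.bm.mul hc.bm).sub (hc.bm.smul _)) (BM.const _), E_sub (hc.bm.mul hc.bm) (hc.bm.smul _), E_smul, E_const]
      simp only [Pi.add_apply, Pi.sub_apply, Pi.smul_apply, h1, h2, Pi.mul_apply, smul_eq_mul]; ring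
    rw [← this]; simp only [E]; congr 1; ext x; simp; ring
  have hb : BM (c - fun _ => c y) := hc.bm.sub (BM.const _)
  have := (integral_eq_zero_iff_of_nonneg (fun x => mul_self_nonneg _) ((hb.mul hb).int (s.κ y))).1 h3
  exact this.mono fun x hx => sub_eq_zero.1 (mul_self_eq_zero.1 hx)
end Sys
lemma hilb {H ι : Type*} [NormedAddCommGroup H] [InnerProductSpace ℝ H] [CompleteSpace H]
    (U : ι → H →ₗᵢ[ℝ] H) (x : H) (i₀ : ι) (hU : ∀ i j, ∃ k, ∀ y, U i (U j y) = U k y) (h0 : ∀ y, U i₀ y = y) :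
    ∃ P ∈ closure (convexHull ℝ (Set.range fun i => U i x)), (∀ i, U i P = P) ∧ inner ℝ P P = inner ℝ P x := by
  set O := Set.range fun i => U i x
  set K := closure (convexHull ℝ O)
  have hxK : ∀ o ∈ O, o ∈ K := fun o ho => subset_closure (subset_convexHull _ _ ho)
  have hKc : Convex ℝ K := (convex_convexHull ℝ O).closure
  have hUK : ∀ i, ∀ y ∈ K, U i y ∈ K := by
    intro i y hy
    have h1 : Set.MapsTo (U i) (convexHull ℝ O) (convexHull ℝ O) := by
      intro z hz
      have := Set.mem_image_of_mem (U i).toLinearMap hz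
      rw [LinearMap.image_convexHull] at this
      refine convexHull_mono ?_ this
      rintro _ ⟨_, ⟨j, rfl⟩, rfl⟩
      obtain ⟨k, hk⟩ := hU i j
      exact ⟨k, (hk x).symm⟩
    exact h1.closure (U i).continuous hy
  obtain ⟨P, hPK, hP⟩ := exists_norm_eq_iInf_of_complete_convex (K := K) ⟨_, hxK _ ⟨i₀, rfl⟩⟩
    isClosed_closure.isComplete hKc 0
  rw [norm_eq_iInf_iff_real_inner_le_zero hKc hPK] at hP
  have hinv : ∀ i, U i P = P := by
    intro i
    have h1 := hP _ (hUK i P hPK)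
    simp only [zero_sub, inner_neg_left, inner_sub_right, real_inner_self_eq_norm_sq] at h1
    have h2 : ‖U i P - P‖ ^ 2 ≤ 0 := by
      rw [@norm_sub_sq_real, LinearIsometry.norm_map, real_inner_comm]; linarith
    exact sub_eq_zero.1 (norm_eq_zero.1 (by nlinarith [norm_nonneg (U i P - P)]))
  refine ⟨P, hPK, hinv, ?_⟩
  have hcl : IsClosed {z : H | inner ℝ P z = inner ℝ P x} :=
    isClosed_eq (continuous_const.inner continuous_id) continuous_const
  have hcv : Convex ℝ {z : H | inner ℝ P z = inner ℝ P x} := by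
    intro a ha b hb t r ht hr htr
    simp only [Set.mem_setOf_eq, inner_add_right, inner_smul_right] at *
    rw [ha, hb, ← add_mul, htr, one_mul]
  have hO : O ⊆ {z : H | inner ℝ P z = inner ℝ P x} := by
    rintro _ ⟨i, rfl⟩
    have := (U i).inner_map_map P x
    rwa [hinv i] at this
  exact (closure_minimal (convexHull_min hO hcv) hcl) hPK

namespace Sys
variable {G X : Type} [AddCommGroup G] [mX : MeasurableSpace X] [StandardBorelSpace X] {s : Sys G X}
  {f g : X → ℝ}

variable (s) in
noncomputable def ν : Measure (X × X) := s.μ ⊗ₘ s.κ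
instance : IsProbabilityMeasure s.ν := by unfold ν; infer_instance
def tens (φ ψ : X → ℝ) : X × X → ℝ := fun p => φ p.1 * ψ p.2
lemma tens_bm (hf : BM f) (hg : BM g) : BM (tens f g) :=
  BM.mul (hf.comp measurable_fst) (hg.comp measurable_snd)
lemma nu_int {F : X × X → ℝ} (hF : BM F) : ∫ p, F p ∂s.ν = s.I (fun x => ∫ z, F (x, z) ∂(s.κ x)) :=
  Measure.integral_compProd (hF.int _)
lemma nu_tens (hf : BM f) (hg : BM g) : ∫ p, tens f g p ∂s.ν = s.I (f * s.E g) := by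
  rw [nu_int (tens_bm hf hg)]; congr 1; ext x
  exact integral_const_mul (f x) g
lemma sec_bm {F : X × X → ℝ} (hF : BM F) : BM (fun x => ∫ z, F (x, z) ∂(s.κ x)) := by
  obtain ⟨C, hC⟩ := hF.2
  refine ⟨(StronglyMeasurable.integral_kernel_prod_right' hF.1.stronglyMeasurable).measurable, C, fun x => ?_⟩
  have := norm_integral_le_of_norm_le_const (μ := s.κ x) (f := fun z => F (x, z)) (C := C) (ae_of_all _ fun z => hC _)
  simpa using this

variable (s) in
def T2 (a : G) : X × X → X × X := Prod.map (s.T a) (s.T a)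
lemma mp2 (a : G) : MeasurePreserving (s.T2 a) s.ν s.ν := by
  have hm : Measurable (s.T2 a) := (s.mp a).measurable.prodMap (s.mp a).measurable
  refine ⟨hm, ?_⟩
  have : IsProbabilityMeasure (s.ν.map (s.T2 a)) := Measure.isProbabilityMeasure_map hm.aemeasurable
  refine Measure.ext_prod fun {A B} hA hB => ?_
  rw [Measure.map_apply hm (hA.prod hB)]
  have key : ∀ {A B : Set X}, MeasurableSet A → MeasurableSet B → s.ν.real (A ×ˢ B) =
      s.I (A.indicator 1 * s.E (B.indicator 1)) := by
    intro A B hA hB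
    rw [← nu_tens (BM.ind hA) (BM.ind hB), ← integral_indicator_one (hA.prod hB)]
    congr 1; ext p
    by_cases h1 : p.1 ∈ A <;> by_cases h2 : p.2 ∈ B <;> simp [tens, h1, h2, Set.indicator]
  have h2 : s.T2 a ⁻¹' (A ×ˢ B) = (s.T a ⁻¹' A) ×ˢ (s.T a ⁻¹' B) := rfl
  rw [h2, ← ENNReal.toReal_eq_toReal_iff' (measure_ne_top _ _) (measure_ne_top _ _)]
  refine (key ((s.mp a).measurable hA) ((s.mp a).measurable hB)).trans (Eq.trans ?_ (key hA hB).symm)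
  rw [← I_tr a ((BM.ind hA).mul (E_bm (BM.ind hB)))]
  refine I_congr ?_
  have := E_tr (s := s) a (BM.ind hB)
  filter_upwards [this] with x hx
  simp only [Pi.mul_apply, tr_mul]
  rw [← hx]; rfl

lemma kernel (S : Submodule ℤ G) (hf : BM f) : ∃ H : X × X → ℝ, BM H ∧
    (∀ a ∈ S, H ∘ s.T2 a =ᵐ[s.ν] H) ∧
    (∀ ε > 0, ∃ (ι : Type) (_ : Fintype ι) (w : ι → ℝ) (a : ι → G), (∀ i, a i ∈ S) ∧ (∀ i, 0 ≤ w i) ∧ ∑ i, w i = 1 ∧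
      ∫ p, |H p - ∑ i, w i * tens f f (s.T2 (a i) p)| ∂s.ν ≤ ε) ∧
    (∫ p, H p * tens f f p ∂s.ν = 0 → H =ᵐ[s.ν] 0) := by
  have hff := tens_bm hf hf
  obtain ⟨C, hC0, hC⟩ := hff.bd
  have hL : MemLp (tens f f) 2 s.ν := MemLp.of_bound hff.1.aestronglyMeasurable C (ae_of_all _ hC)
  let U : S → Lp ℝ 2 s.ν →ₗᵢ[ℝ] Lp ℝ 2 s.ν := fun a => Lp.compMeasurePreservingₗᵢ ℝ (s.T2 a) (mp2 (a : G))
  have hT2 : ∀ a b p, s.T2 a (s.T2 b p) = s.T2 (a + b) p := fun a b p => by simp [T2, s.add, Prod.map]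
  have hUap : ∀ (a : S) y, U a y =ᵐ[s.ν] y ∘ s.T2 a := fun a y => Lp.coeFn_compMeasurePreserving y (mp2 _)
  obtain ⟨P, hPK, hinv, hin⟩ := hilb U (hL.toLp _) 0 (by
    intro a b
    refine ⟨a + b, fun y => ?_⟩
    refine Lp.ext ?_
    have h1 := hUap a (U b y)
    have h2 := (mp2 (s := s) (a : G)).quasiMeasurePreserving.ae_eq_comp (hUap b y)
    filter_upwards [h1, h2, hUap (a + b) y] with p hp1 hp2 hp3
    rw [hp1, hp2, hp3]; simp [hT2, add_comm]) (by
    intro y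
    refine Lp.ext ?_
    filter_upwards [hUap 0 y] with p hp
    rw [hp]; simp [T2, s.zero, Prod.map])
  have hPm : Measurable P := (Lp.stronglyMeasurable P).measurable
  let H : X × X → ℝ := fun p => max (-C) (min C (P p))
  have hHb : ∀ p, |H p| ≤ C := fun p => abs_le.2 ⟨le_max_left _ _, max_le (by linarith) (min_le_left _ _)⟩
  have hHm : BM H := ⟨measurable_const.max (measurable_const.min hPm), C, hHb⟩
  have hcl : ∀ a b : ℝ, |b| ≤ C → |max (-C) (min C a) - b| ≤ |a - b| := by
    intro a b hb
    have hb' := abs_le.1 hb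
    have : b = max (-C) (min C b) := by rw [min_eq_right hb'.2, max_eq_right hb'.1]
    conv_lhs => rw [this]
    exact (abs_max_sub_max_le_max _ _ _ _).trans (by
      rw [sub_self, abs_zero, max_eq_right (abs_nonneg _)]
      exact (abs_min_sub_min_le_max _ _ _ _).trans (by rw [sub_self, abs_zero, max_eq_right (abs_nonneg _)]))
  have happ : ∀ ε > 0, ∃ (ι : Type) (_ : Fintype ι) (w : ι → ℝ) (a : ι → G), (∀ i, a i ∈ S) ∧ (∀ i, 0 ≤ w i) ∧ ∑ i, w i = 1 ∧
      (∫ p, |H p - ∑ i, w i * tens f f (s.T2 (a i) p)| ∂s.ν ≤ ε) ∧ ∫ p, |P p - ∑ i, w i * tens f f (s.T2 (a i) p)| ∂s.ν ≤ ε := by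
    intro ε hε
    obtain ⟨k, hk, hkd⟩ := Metric.mem_closure_iff.1 hPK ε hε
    rw [mem_convexHull_iff_exists_fintype] at hk
    obtain ⟨ι, _, w, z, hw0, hw1, hz, rfl⟩ := hk
    choose a ha using hz
    have hb : BM (fun p => ∑ i, w i * tens f f (s.T2 (a i) p)) := by
      have : BM (∑ i, w i • (tens f f ∘ s.T2 (a i))) := BM.sum fun i _ => (hff.comp (mp2 _).measurable).smul _
      convert this using 1; ext p; simp
    have hae : (∑ i, w i • z i : Lp ℝ 2 s.ν) =ᵐ[s.ν] fun p => ∑ i, w i * tens f f (s.T2 (a i) p) := by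
      have h1 : ∀ i, (w i • z i : Lp ℝ 2 s.ν) =ᵐ[s.ν] fun p => w i * tens f f (s.T2 (a i) p) := by
        intro i
        rw [← ha i]
        have h2 := (mp2 (s := s) (a i : G)).quasiMeasurePreserving.ae_eq_comp hL.coeFn_toLp
        filter_upwards [Lp.coeFn_smul (w i) (U (a i) (hL.toLp _)), hUap (a i) (hL.toLp _), h2] with p h3 h4 h5
        rw [h3, Pi.smul_apply, h4, h5]; rfl
      have h3 := Lp.coeFn_finsetSum (Finset.univ : Finset ι) (fun i => (w i • z i : Lp ℝ 2 s.ν))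
      filter_upwards [h3, ae_all_iff.2 h1] with p h4 h5
      rw [h4, Finset.sum_apply]; exact Finset.sum_congr rfl fun i _ => h5 i
    have hPint : Integrable (fun p => |P p - ∑ i, w i * tens f f (s.T2 (a i) p)|) s.ν :=
      (((Lp.memLp P).integrable (by norm_num)).sub (hb.int _)).abs
    have hle : ∫ p, |P p - ∑ i, w i * tens f f (s.T2 (a i) p)| ∂s.ν ≤ ε := by
      have h1 : ‖P - ∑ i, w i • z i‖ ≤ ε := by rw [← dist_eq_norm]; exact hkd.le
      have h2 : ∫ p, |P p - ∑ i, w i * tens f f (s.T2 (a i) p)| ∂s.ν = (eLpNorm (P - ∑ i, w i • z i : Lp ℝ 2 s.ν) 1 s.ν).toReal := by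
        rw [eLpNorm_one_eq_lintegral_enorm, ← integral_norm_eq_lintegral_enorm (Lp.aestronglyMeasurable _)]
        refine integral_congr_ae ?_
        filter_upwards [Lp.coeFn_sub P (∑ i, w i • z i), hae] with p h3 h4
        rw [h3, Pi.sub_apply, h4, Real.norm_eq_abs]
      rw [h2]
      refine le_trans ?_ h1
      rw [Lp.norm_def]
      refine ENNReal.toReal_mono (Lp.eLpNorm_ne_top _) (eLpNorm_le_eLpNorm_of_exponent_le (by norm_num) (Lp.aestronglyMeasurable _))
    refine ⟨ι, ‹_›, w, fun i => a i, fun i => (a i).2, hw0, hw1, le_trans (integral_mono ?_ hPint fun p => ?_) hle, hle⟩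
    · exact ((hHm.sub hb).abs).int _
    · refine hcl _ _ ?_
      calc _ ≤ ∑ i, |w i * tens f f (s.T2 (a i) p)| := Finset.abs_sum_le_sum_abs _ _
        _ ≤ ∑ i, w i * C := Finset.sum_le_sum fun i _ => by
            rw [abs_mul, abs_of_nonneg (hw0 i)]; exact mul_le_mul_of_nonneg_left (hC _) (hw0 i)
        _ = C := by rw [← Finset.sum_mul, hw1, one_mul]
  have hPH : P =ᵐ[s.ν] H := by
    have hi : Integrable (fun p => |P p - H p|) s.ν := (((Lp.memLp P).integrable (by norm_num)).sub (hHm.int _)).abs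
    have : ∫ p, |P p - H p| ∂s.ν = 0 := by
      refine le_antisymm (le_of_forall_pos_le_add fun ε hε => ?_) (integral_nonneg fun _ => abs_nonneg _)
      obtain ⟨ι, _, w, a, _, _, _, h1, h2⟩ := happ (ε / 2) (by positivity)
      have hb : BM (fun p => ∑ i, w i * tens f f (s.T2 (a i) p)) := by
        have : BM (∑ i, w i • (tens f f ∘ s.T2 (a i))) := BM.sum fun i _ => (hff.comp (mp2 _).measurable).smul _
        convert this using 1; ext p; simp
      have i1 := (((Lp.memLp P).integrable (by norm_num)).sub (hb.int s.ν)).abs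
      have i2 := ((hHm.sub hb).abs).int s.ν
      have := integral_mono hi (i1.add i2) fun p => by
        simpa using (abs_sub_le (P p) (∑ i, w i * tens f f (s.T2 (a i) p)) (H p)).trans_eq (by rw [abs_sub_comm (H p)])
      refine this.trans ?_
      have h3 := integral_add i1 i2
      refine h3.le.trans ?_
      have h1' : ∫ p, |H - fun p => ∑ i, w i * tens f f (s.T2 (a i) p)| p ∂s.ν ≤ ε / 2 := h1
      have h2' : ∫ p, |P p - (fun p => ∑ i, w i * tens f f (s.T2 (a i) p)) p| ∂s.ν ≤ ε / 2 := h2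
      simp only [Pi.sub_apply] at *
      linarith
    rw [integral_eq_zero_iff_of_nonneg (fun _ => abs_nonneg _) hi] at this
    exact this.mono fun p hp => sub_eq_zero.1 (abs_eq_zero.1 hp)
  refine ⟨H, hHm, fun a ha => ?_, fun ε hε => ?_, fun h => ?_⟩
  · have h1 := hUap ⟨a, ha⟩ P
    rw [hinv] at h1
    exact ((mp2 (s := s) a).quasiMeasurePreserving.ae_eq_comp hPH.symm).trans (h1.symm.trans hPH)
  · obtain ⟨ι, i, w, a, h1, h2, h3, h4, _⟩ := happ ε hε
    exact ⟨ι, i, w, a, h1, h2, h3, h4⟩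
  · have h1 : inner ℝ P (hL.toLp _) = ∫ p, H p * tens f f p ∂s.ν := by
      rw [L2.inner_def]
      refine integral_congr_ae ?_
      filter_upwards [hPH, hL.coeFn_toLp] with p h1 h2
      rw [h1, h2]; simp [mul_comm]
    rw [h1, h] at hin
    have hP0 : P = 0 := inner_self_eq_zero.1 hin
    refine hPH.symm.trans ?_
    rw [hP0]; exact Lp.coeFn_zero _ _ _
end Sys
namespace Sys
variable {G X : Type} [AddCommGroup G] [mX : MeasurableSpace X] [StandardBorelSpace X] {s : Sys G X}
  {f g : X → ℝ}

variable (s) in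
def WM (S : Submodule ℤ G) (f : X → ℝ) : Prop :=
  ∀ (ι : Type) [Fintype ι] (φ : ι → X → ℝ), (∀ k, BM (φ k)) → ∀ ε > 0, ∃ a ∈ S, ∀ k,
    s.N (s.E (φ k * s.tr a f)) < ε

variable (s) in
noncomputable def A (H : X × X → ℝ) (φ : X → ℝ) : X → ℝ := fun x => ∫ z, H (x, z) * φ z ∂(s.κ x)

lemma snd_bm (hf : BM f) : BM (fun p : X × X => f p.2) := hf.comp measurable_snd
lemma A_bm {H : X × X → ℝ} (hH : BM H) (hf : BM f) : BM (s.A H f) := sec_bm (hH.mul (snd_bm hf))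

lemma I_A {H : X × X → ℝ} (hH : BM H) (hf : BM f) (hg : BM g) :
    s.I (g * s.A H f) = ∫ p, H p * tens g f p ∂s.ν := by
  refine Eq.trans ?_ (nu_int (hH.mul (tens_bm hg hf))).symm
  congr 1; ext x
  simp only [A, Pi.mul_apply, tens]
  rw [← integral_const_mul]; congr 1; ext z; ring

lemma N_sq (hf : BM f) : s.N f ^ 2 ≤ s.I (f * f) := by
  have h1 : 0 ≤ s.I ((|f| - fun _ => s.N f) * (|f| - fun _ => s.N f)) := I_nonneg fun x => mul_self_nonneg _
  have h2 : (|f| - fun _ => s.N f) * (|f| - fun _ => s.N f) = f * f - (2 * s.N f) • |f| + fun _ => s.N f ^ 2 := by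
    ext x; simp only [Pi.mul_apply, Pi.sub_apply, Pi.add_apply, Pi.smul_apply, Pi.abs_apply, smul_eq_mul]
    have := abs_mul_abs_self (f x)
    linear_combination this
  rw [h2, I_add ((hf.mul hf).sub (hf.abs.smul _)) (BM.const _), I_sub (hf.mul hf) (hf.abs.smul _), I_smul, I_const] at h1
  change 0 ≤ _ - 2 * s.N f * s.N f + _ at h1
  nlinarith

lemma A_tr {H : X × X → ℝ} (hH : BM H) (hf : BM f) {a : G} (ha : H ∘ s.T2 a =ᵐ[s.ν] H) :
    s.tr a (s.A H f) =ᵐ[s.μ] s.A H (s.tr a f) := by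
  have b1 := tr_bm (s := s) a (A_bm (s := s) hH hf)
  have b2 := A_bm (s := s) hH (tr_bm (s := s) a hf)
  have key : ∀ ψ : X → ℝ, BM ψ → s.I (ψ * s.tr a (s.A H f)) = s.I (ψ * s.A H (s.tr a f)) := by
    intro ψ hψ
    have h1 : ψ * s.tr a (s.A H f) = s.tr a (s.tr (-a) ψ * s.A H f) := by
      rw [tr_mul, tr_tr, add_neg_cancel, tr_zero]
    rw [h1, I_tr a ((tr_bm _ hψ).mul (A_bm hH hf)), I_A hH hf (tr_bm _ hψ), I_A hH (tr_bm _ hf) hψ]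
    have hm := mp2 (s := s) a
    have h4 := integral_map (μ := s.ν) hm.measurable.aemeasurable
      (hH.mul (tens_bm (tr_bm (s := s) (-a) hψ) hf)).1.aestronglyMeasurable
    rw [hm.map_eq] at h4
    refine h4.trans (integral_congr_ae ?_)
    filter_upwards [ha] with p hp
    simp only [Function.comp, Pi.mul_apply] at hp ⊢
    rw [hp]
    have h2 : s.tr (-a) ψ (s.T a p.1) = ψ p.1 := by
      rw [tr_apply, ← s.add, neg_add_cancel, s.zero]
    simp only [tens, T2, Prod.map]
    rw [h2]; rfl
  have h3 := ae_zero_of_sq (s := s) (b1.sub b2) (by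
    rw [mul_sub, I_sub ((b1.sub b2).mul b1) ((b1.sub b2).mul b2), key _ (b1.sub b2), sub_self])
  exact h3.mono fun x hx => sub_eq_zero.1 hx

/-- The approximation of `tr b u`. -/
noncomputable def appr (s : Sys G X) {ι : Type} [Fintype ι] (w : ι → ℝ) (a : ι → G) (f : X → ℝ) (b : G) : X → ℝ :=
  ∑ i, w i • (s.tr (a i) f * s.E (s.tr (a i) f * s.tr b f))

lemma appr_bm {ι : Type} [Fintype ι] (w : ι → ℝ) (a : ι → G) (hf : BM f) (b : G) : BM (s.appr w a f b) :=
  BM.sum fun i _ => ((tr_bm _ hf).mul (E_bm ((tr_bm _ hf).mul (tr_bm _ hf)))).smul _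

/-- non weakly mixing functions produce compact functions -/
lemma compact_of_not_wm (S : Submodule ℤ G) (hf : BM f) (h0 : s.E f =ᵐ[s.μ] 0) (hn : ¬ s.WM S f) :
    ∃ u : X → ℝ, BM u ∧ s.E u =ᵐ[s.μ] 0 ∧ ¬ (u =ᵐ[s.μ] 0) ∧
      ∀ ε > 0, ∃ (ι : Type) (_ : Fintype ι) (w : ι → ℝ) (a : ι → G) (D : X → ℝ), (∀ i, a i ∈ S) ∧ (∀ i, |w i| ≤ 1) ∧ BM D ∧ s.I D ≤ ε ∧
        (∀ x, 0 ≤ D x) ∧ ∀ b ∈ S, s.E |s.tr b u - s.appr w a f b| ≤ᵐ[s.μ] D := by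
  obtain ⟨H, hH, hinv, happ, hzero⟩ := kernel (s := s) S hf
  have hff := tens_bm hf hf
  obtain ⟨C, hC0, hC⟩ := hf.bd
  have hb : ∀ {ι : Type} [Fintype ι] (w : ι → ℝ) (a : ι → G), BM (fun p => ∑ i, w i * tens f f (s.T2 (a i) p)) := by
    intro ι _ w a
    have : BM (∑ i, w i • (tens f f ∘ s.T2 (a i))) := BM.sum fun i _ => (hff.comp (mp2 _).measurable).smul _
    convert this using 1; ext p; simp
  have hA : ∀ {ι : Type} [Fintype ι] (w : ι → ℝ) (a : ι → G) (b : G),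
      s.A (fun p => ∑ i, w i * tens f f (s.T2 (a i) p)) (s.tr b f) = s.appr w a f b := by
    intro ι _ w a b
    ext x
    simp only [A, appr, Finset.sum_apply, Pi.smul_apply, Pi.mul_apply, smul_eq_mul, Finset.sum_mul]
    rw [integral_finsetSum]
    · refine Finset.sum_congr rfl fun i _ => ?_
      have : s.E (s.tr (a i) f * s.tr b f) x = ∫ z, (s.tr (a i) f * s.tr b f) z ∂(s.κ x) := rfl
      rw [this, ← integral_const_mul, ← integral_const_mul]
      congr 1; ext z
      simp only [tens, T2, Prod.map, tr_apply, Pi.mul_apply]; ring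
    · intro i _
      have : BM ((w i * f (s.T (a i) x)) • (s.tr (a i) f * s.tr b f)) := ((tr_bm _ hf).mul (tr_bm _ hf)).smul _
      convert this.int (s.κ x) using 1
      ext z; simp only [tens, T2, Prod.map, Pi.smul_apply, smul_eq_mul, Pi.mul_apply, tr_apply]; ring
  have hu := A_bm (s := s) hH hf
  have hmain : ∀ ε > 0, ∃ (ι : Type) (_ : Fintype ι) (w : ι → ℝ) (a : ι → G) (D : X → ℝ), (∀ i, a i ∈ S) ∧ (∀ i, |w i| ≤ 1) ∧ BM D ∧ s.I D ≤ ε ∧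
        (∀ x, 0 ≤ D x) ∧ ∀ b ∈ S, s.E |s.tr b (s.A H f) - s.appr w a f b| ≤ᵐ[s.μ] D := by
    intro ε hε
    obtain ⟨ι, _, w, a, ha, hw0, hw1, hI⟩ := happ (ε / C) (by positivity)
    have hd : BM (fun p => |H p - ∑ i, w i * tens f f (s.T2 (a i) p)|) := (hH.sub (hb w a)).abs
    have hR := sec_bm (s := s) hd
    refine ⟨ι, ‹_›, w, a, s.E (C • fun x => ∫ z, |H (x, z) - ∑ i, w i * tens f f (s.T2 (a i) (x, z))| ∂(s.κ x)), ha,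
      fun i => ?_, E_bm (hR.smul C), ?_, fun x => ?_, fun b hb' => ?_⟩
    · rw [abs_of_nonneg (hw0 i), ← hw1]
      exact Finset.single_le_sum (fun j _ => hw0 j) (Finset.mem_univ i)
    · rw [I_E (hR.smul C), I_smul, ← nu_int hd, mul_comm]
      exact (le_div_iff₀ hC0).1 hI
    · exact E_nonneg (fun x => mul_nonneg hC0.le (integral_nonneg fun _ => abs_nonneg _)) x
    · have h1 := A_tr (s := s) hH hf (hinv b hb')
      have hap := appr_bm (s := s) w a hf b
      have h2 := E_congr (s := s) (((tr_bm (s := s) b hu).sub hap).abs) ((A_bm (s := s) hH (tr_bm (s := s) b hf)).sub hap).abs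
        (h1.mono fun x hx => by simp [hx])
      filter_upwards [h2] with y hy
      rw [hy]
      refine E_mono ((A_bm hH (tr_bm b hf)).sub hap).abs (hR.smul C) (fun x => ?_) y
      rw [← hA w a b]
      simp only [Pi.abs_apply, Pi.sub_apply, A, Pi.smul_apply, smul_eq_mul]
      have i1 : BM (fun z => H (x, z) * s.tr b f z) := BM.mul (hH.comp measurable_prodMk_left) (tr_bm b hf)
      have i2 : BM (fun z => (∑ i, w i * tens f f (s.T2 (a i) (x, z))) * s.tr b f z) :=
        BM.mul ((hb w a).comp measurable_prodMk_left) (tr_bm b hf)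
      rw [← integral_sub (i1.int _) (i2.int _), ← integral_const_mul]
      refine abs_integral_le_integral_abs.trans (integral_mono ((i1.sub i2).abs.int _) ?_ fun z => ?_)
      · exact ((hd.comp measurable_prodMk_left).smul C).int _
      · change |_ * _ - _ * _| ≤ C * _
        rw [← sub_mul, abs_mul, mul_comm]
        exact mul_le_mul_of_nonneg_right (hC _) (abs_nonneg _)
  refine ⟨s.A H f, hu, ?_, ?_, hmain⟩
  · refine by_unique (E_by hu) BM.zero fun c hc => ?_
    rw [I_mul_E hc hu, mul_zero, show s.I 0 = 0 from I_const 0]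
    obtain ⟨B, hB0, hB⟩ := BM.bd hc.bm
    refine abs_eq_zero.1 (le_antisymm (le_of_forall_pos_le_add fun ε hε => ?_) (abs_nonneg _))
    obtain ⟨ι, _, w, a, D, ha, hw, hD, hDI, _, hDb⟩ := hmain (ε / B) (by positivity)
    have h1 := hDb 0 (zero_mem _)
    rw [tr_zero] at h1
    have hap := appr_bm (s := s) w a hf 0
    have h2 : s.N (s.A H f - s.appr w a f 0) ≤ ε / B := by
      rw [N, ← I_E (hu.sub hap).abs]
      exact (integral_mono_ae ((E_bm (hu.sub hap).abs).int _) (hD.int _) h1).trans hDI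
    have h3 : s.I (c * s.appr w a f 0) = 0 := by
      have : c * s.appr w a f 0 = ∑ i, w i • ((c * s.E (s.tr (a i) f * s.tr 0 f)) * s.tr (a i) f) := by
        rw [appr, Finset.mul_sum]; refine Finset.sum_congr rfl fun i _ => ?_
        ext x; simp; ring
      have hby : ∀ i, s.BY (c * s.E (s.tr (a i) f * s.tr 0 f)) := fun i =>
        BM.mul hc (E_by ((tr_bm _ hf).mul (tr_bm _ hf)))
      rw [this, I_sum fun i _ => ((hby i).bm.mul (tr_bm _ hf)).smul _]
      refine Finset.sum_eq_zero fun i _ => ?_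
      rw [I_smul, ← I_mul_E (hby i) (tr_bm _ hf)]
      have h4 : s.E (s.tr (a i) f) =ᵐ[s.μ] 0 := (E_tr _ hf).trans (tr_ae (a i) h0)
      have h5 : s.I ((c * s.E (s.tr (a i) f * s.tr 0 f)) * s.E (s.tr (a i) f)) = s.I 0 :=
        I_congr (h4.mono fun x hx => by simp [hx])
      rw [h5, show s.I 0 = 0 from I_const 0, mul_zero]
    have h6 : s.I (c * s.A H f) = s.I (c * (s.A H f - s.appr w a f 0)) := by
      rw [mul_sub, I_sub (hc.bm.mul hu) (hc.bm.mul hap), h3, sub_zero]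
    rw [h6, zero_add]
    refine abs_I_le.trans ((N_mul hc.bm (hu.sub hap) hB).trans ?_)
    rw [mul_comm]; exact (le_div_iff₀ hB0).1 h2
  · intro hu0
    apply hn
    have hH0 : H =ᵐ[s.ν] 0 := by
      refine hzero ?_
      rw [← I_A hH hf hf, I_congr (g := 0) (hu0.mono fun x hx => by simp [hx])]
      exact I_const 0
    intro ι _ φ hφ ε hε
    let Φ : X × X → ℝ := ∑ k, tens (φ k) (φ k)
    have hΦ : BM Φ := BM.sum fun k _ => tens_bm (hφ k) (hφ k)
    obtain ⟨B, hB0, hB⟩ := hΦ.bd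
    obtain ⟨κ, _, w, a, ha, hw0, hw1, hI⟩ := happ (ε ^ 2 / (2 * B)) (by positivity)
    have hI' : ∫ p, |∑ i, w i * tens f f (s.T2 (a i) p)| ∂s.ν ≤ ε ^ 2 / (2 * B) := by
      refine le_trans (integral_congr_ae ?_).le hI
      filter_upwards [hH0] with p hp
      rw [hp]; simp
    let J : κ → ℝ := fun i => ∑ k, s.I (s.E (φ k * s.tr (a i) f) * s.E (φ k * s.tr (a i) f))
    have hsum : ∑ i, w i * J i ≤ ε ^ 2 / 2 := by
      have e1 : ∑ i, w i * J i = ∫ p, (∑ i, w i * tens f f (s.T2 (a i) p)) * Φ p ∂s.ν := by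
        have e2 : (fun p => (∑ i, w i * tens f f (s.T2 (a i) p)) * Φ p) =
            fun p => ∑ i, ∑ k, w i * tens (φ k * s.tr (a i) f) (φ k * s.tr (a i) f) p := by
          ext p
          simp only [Φ, Finset.sum_mul, Finset.sum_apply, Finset.mul_sum]
          rw [Finset.sum_comm]
          refine Finset.sum_congr rfl fun i _ => Finset.sum_congr rfl fun k _ => ?_
          simp only [tens, T2, Prod.map, Pi.mul_apply, tr_apply]; ring
        have hbk : ∀ i k, BM (φ k * s.tr (a i) f) := fun i k => (hφ k).mul (tr_bm _ hf)
        have hbt : ∀ i k, BM (fun p => w i * tens (φ k * s.tr (a i) f) (φ k * s.tr (a i) f) p) := fun i k =>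
          (tens_bm (hbk i k) (hbk i k)).smul _
        rw [e2, integral_finsetSum]
        swap
        · intro i _; exact integrable_finsetSum _ fun k _ => (hbt i k).int _
        refine Finset.sum_congr rfl fun i _ => ?_
        rw [integral_finsetSum _ fun k _ => (hbt i k).int _, Finset.mul_sum]
        refine Finset.sum_congr rfl fun k _ => ?_
        rw [integral_const_mul, nu_tens (hbk i k) (hbk i k), I_mul_E (E_by (hbk i k)) (hbk i k), mul_comm (s.E _)]
      rw [e1]
      calc _ ≤ ∫ p, B * |∑ i, w i * tens f f (s.T2 (a i) p)| ∂s.ν := by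
            refine integral_mono (((hb w a).mul hΦ).int _) (((hb w a).abs.smul B).int _) fun p => ?_
            refine (le_abs_self _).trans ?_
            change |_ * _| ≤ _
            rw [abs_mul, mul_comm]
            exact mul_le_mul_of_nonneg_right (hB p) (abs_nonneg _)
        _ ≤ B * (ε ^ 2 / (2 * B)) := by
            rw [integral_const_mul]; exact mul_le_mul_of_nonneg_left hI' hB0.le
        _ = _ := by field_simp
    have hex : ∃ i, J i ≤ ε ^ 2 / 2 := by
      by_contra hcon
      push Not at hcon
      obtain ⟨i0⟩ : Nonempty κ := by
        by_contra hemp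
        rw [not_nonempty_iff] at hemp
        simp at hw1
      have : ∑ i, w i * (ε ^ 2 / 2) < ∑ i, w i * J i := by
        refine Finset.sum_lt_sum (fun i _ => mul_le_mul_of_nonneg_left (hcon i).le (hw0 i)) ?_
        by_contra hcon2
        push Not at hcon2
        have : ∀ i, w i = 0 := fun i => by
          by_contra hne
          exact absurd (hcon2 i (Finset.mem_univ i)) (not_le.2 (mul_lt_mul_of_pos_left (hcon i) (lt_of_le_of_ne (hw0 i) (Ne.symm hne))))
        simp [this] at hw1
      rw [← Finset.sum_mul, hw1, one_mul] at this
      linarith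
    obtain ⟨i, hi⟩ := hex
    refine ⟨a i, ha i, fun k => ?_⟩
    have hbk : BM (s.E (φ k * s.tr (a i) f)) := E_bm ((hφ k).mul (tr_bm _ hf))
    have h1 := N_sq (s := s) hbk
    have h2 : s.I (s.E (φ k * s.tr (a i) f) * s.E (φ k * s.tr (a i) f)) ≤ J i :=
      Finset.single_le_sum (f := fun k => s.I (s.E (φ k * s.tr (a i) f) * s.E (φ k * s.tr (a i) f)))
        (fun k _ => I_nonneg fun x => mul_self_nonneg _) (Finset.mem_univ k)
    refine lt_of_pow_lt_pow_left₀ 2 hε.le ?_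
    have : 0 < ε ^ 2 := by positivity
    linarith
end Sys
def TB {ι : Type} (p : ι → ι → ℝ) : Prop :=
  ∀ ε > 0, ∃ (κ : Type) (_ : Finite κ) (c : ι → κ), ∀ i j, c i = c j → p i j < ε

namespace TB
variable {ι : Type} {p q : ι → ι → ℝ}
lemma add (hp : TB p) (hq : TB q) : TB (fun i j => p i j + q i j) := by
  intro ε hε
  obtain ⟨κ, _, c, hc⟩ := hp (ε / 2) (by positivity)
  obtain ⟨κ', _, c', hc'⟩ := hq (ε / 2) (by positivity)
  refine ⟨κ × κ', inferInstance, fun i => (c i, c' i), fun i j hij => ?_⟩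
  have := Prod.mk.inj hij
  linarith [hc i j this.1, hc' i j this.2]
lemma zero : TB (fun _ _ : ι => (0 : ℝ)) := fun ε hε => ⟨Unit, inferInstance, fun _ => (), fun _ _ _ => hε⟩
lemma sum {κ : Type} {t : Finset κ} {P : κ → ι → ι → ℝ} (h : ∀ k ∈ t, TB (P k)) : TB (fun i j => ∑ k ∈ t, P k i j) := by
  classical
  induction t using Finset.induction_on with
  | empty => simpa using zero
  | insert a t ha ih =>
    simp only [Finset.sum_insert ha]
    exact (h a (by simp)).add (ih fun k hk => h k (by simp [hk]))
lemma of_le (h : ∀ ε > 0, ∃ q : ι → ι → ℝ, TB q ∧ ∃ L > 0, ∀ i j, p i j ≤ ε + L * q i j) : TB p := by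
  intro ε hε
  obtain ⟨q, hq, L, hL, h⟩ := h (ε / 2) (by positivity)
  obtain ⟨κ, hκ, c, hc⟩ := hq (ε / (2 * L)) (by positivity)
  refine ⟨κ, hκ, c, fun i j hij => ?_⟩
  have h1 := mul_lt_mul_of_pos_left (hc i j hij) hL
  have h2 : L * (ε / (2 * L)) = ε / 2 := by field_simp
  linarith [h i j]
lemma bdd {a : ι → ℝ} {C : ℝ} (hC : ∀ i, |a i| ≤ C) : TB (fun i j => |a i - a j|) := by
  intro ε hε
  refine ⟨Set.Icc ⌊-C / ε⌋ ⌊C / ε⌋, inferInstance, fun i => ⟨⌊a i / ε⌋, ?_, ?_⟩, fun i j hij => ?_⟩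
  · exact Int.floor_le_floor (by gcongr; exact (abs_le.1 (hC i)).1)
  · exact Int.floor_le_floor (by gcongr; exact (abs_le.1 (hC i)).2)
  · have h1 : ⌊a i / ε⌋ = ⌊a j / ε⌋ := congrArg Subtype.val hij
    have := Int.abs_sub_lt_one_of_floor_eq_floor h1
    rw [← sub_div, abs_div, abs_of_pos hε, div_lt_one hε] at this
    exact this
lemma net (hp : TB p) {ε : ℝ} (hε : 0 < ε) : ∃ F : Finset ι, ∀ i, ∃ j ∈ F, p i j < ε := by
  classical
  obtain ⟨κ, _, c, hc⟩ := hp ε hε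
  have hfin : (Set.range c).Finite := Set.toFinite _
  have := hfin.fintype
  choose r hr using fun k : Set.range c => k.2
  refine ⟨Finset.univ.image r, fun i => ⟨r ⟨c i, i, rfl⟩, by simp, hc _ _ ?_⟩⟩
  rw [hr]
end TB

namespace Sys
variable {G X : Type} [AddCommGroup G] [mX : MeasurableSpace X] [StandardBorelSpace X] {s : Sys G X}
  {f g : X → ℝ} {S : Submodule ℤ G}

variable (s) in
def D4 (S : Submodule ℤ G) (f : X → ℝ) : Prop :=
  BM f ∧ ∀ᵐ y ∂s.μ, TB (fun a b : S => s.E |s.tr (a : G) f - s.tr (b : G) f| y)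

lemma D4.lip {h : X → ℝ} (hf : s.D4 S f) (hg : s.D4 S g) (hh : BM h) {L : ℝ} (hL : 0 < L)
    (hl : ∀ x x', |h x - h x'| ≤ L * (|f x - f x'| + |g x - g x'|)) : s.D4 S h := by
  refine ⟨hh, ?_⟩
  filter_upwards [hf.2, hg.2] with y h1 h2
  refine TB.of_le fun ε hε => ⟨_, h1.add h2, L, hL, fun a b => ?_⟩
  have bf := ((tr_bm (s := s) (a : G) hf.1).sub (tr_bm (s := s) (b : G) hf.1)).abs
  have bg := ((tr_bm (s := s) (a : G) hg.1).sub (tr_bm (s := s) (b : G) hg.1)).abs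
  have := E_mono (s := s) ((tr_bm (s := s) (a : G) hh).sub (tr_bm (s := s) (b : G) hh)).abs ((bf.add bg).smul L)
    (fun x => hl _ _) y
  rw [E_smul, E_add bf bg] at this
  simp only [Pi.smul_apply, Pi.add_apply, smul_eq_mul] at this
  linarith

lemma D4.add (hf : s.D4 S f) (hg : s.D4 S g) : s.D4 S (f + g) :=
  hf.lip hg (hf.1.add hg.1) one_pos fun x x' => by
    simp only [Pi.add_apply]
    rw [one_mul, add_sub_add_comm]; exact abs_add_le _ _
lemma D4.mul (hf : s.D4 S f) (hg : s.D4 S g) : s.D4 S (f * g) := by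
  obtain ⟨C, hC0, hC⟩ := hf.1.bd
  obtain ⟨D, hD0, hD⟩ := hg.1.bd
  refine hf.lip hg (hf.1.mul hg.1) (add_pos hC0 hD0) fun x x' => ?_
  simp only [Pi.mul_apply]
  have : f x * g x - f x' * g x' = (f x - f x') * g x + f x' * (g x - g x') := by ring
  rw [this]
  refine (abs_add_le _ _).trans ?_
  rw [abs_mul, abs_mul]
  nlinarith [hC x', hD x, abs_nonneg (f x - f x'), abs_nonneg (g x - g x'), mul_le_mul_of_nonneg_left (hD x) (abs_nonneg (f x - f x')),
    mul_le_mul_of_nonneg_right (hC x') (abs_nonneg (g x - g x'))]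
lemma D4.lip1 {h : ℝ → ℝ} (hf : s.D4 S f) (hm : Measurable h) (hb : ∃ C, ∀ t, |h t| ≤ C) {L : ℝ} (hL : 0 < L)
    (hl : ∀ t t', |h t - h t'| ≤ L * |t - t'|) : s.D4 S (h ∘ f) :=
  hf.lip hf ⟨hm.comp hf.1.1, hb.imp fun _ h x => h _⟩ hL fun x x' => (hl _ _).trans (by
    gcongr; linarith [abs_nonneg (f x - f x')])

lemma D4.tr [Countable G] (hf : s.D4 S f) (c : G) : s.D4 S (s.tr c f) := by
  refine ⟨tr_bm c hf.1, ?_⟩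
  have h1 : ∀ᵐ y ∂s.μ, ∀ a b : S, s.E |s.tr (a : G) (s.tr c f) - s.tr (b : G) (s.tr c f)| y =
      s.E |s.tr (a : G) f - s.tr (b : G) f| (s.T c y) := by
    refine ae_all_iff.2 fun a => ae_all_iff.2 fun b => ?_
    have := E_tr (s := s) c ((tr_bm (s := s) (a : G) hf.1).sub (tr_bm (s := s) (b : G) hf.1)).abs
    filter_upwards [this] with y hy
    rw [tr_abs, tr_sub, tr_tr, tr_tr, add_comm c, add_comm c, ← tr_tr, ← tr_tr] at hy
    rw [hy, tr_apply]
  filter_upwards [h1, (s.mp c).quasiMeasurePreserving.ae hf.2] with y h2 h3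
  simp only [h2]; exact h3

lemma E_const_sub {c d φ : X → ℝ} {y : X} (hc : ∀ᵐ x ∂(s.κ y), c x = c y) (hd : ∀ᵐ x ∂(s.κ y), d x = d y) :
    s.E |φ * (c - d)| y = s.E |φ| y * |c y - d y| := by
  rw [E, E, ← integral_mul_const]
  refine integral_congr_ae ?_
  filter_upwards [hc, hd] with x h1 h2
  simp [h1, h2, abs_mul, mul_comm]

lemma D4_of_by [Countable G] (hf : s.BY f) : s.D4 S f := by
  refine ⟨hf.bm, ?_⟩
  have h1 : ∀ᵐ y ∂s.μ, ∀ a : S, ∀ᵐ x ∂(s.κ y), s.tr (a : G) f x = s.tr (a : G) f y :=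
    ae_all_iff.2 fun a => by_const (tr_by _ hf)
  obtain ⟨C, hC⟩ := hf.bm.2
  filter_upwards [h1] with y hy
  refine TB.of_le fun ε hε => ⟨_, TB.bdd (a := fun a : S => s.tr (a : G) f y) (C := C) (fun a => hC _), 1, one_pos, fun a b => ?_⟩
  have := E_const_sub (s := s) (φ := 1) (hy a) (hy b)
  have h2 : s.E |1| y = 1 := by
    rw [show |(1 : X → ℝ)| = fun _ => 1 by ext; simp]; exact congrFun (E_const 1) y
  rw [one_mul, h2] at this
  rw [this]; linarith

lemma D4.sum [Countable G] {ι : Type} {t : Finset ι} {F : ι → X → ℝ} (h : ∀ i ∈ t, s.D4 S (F i)) : s.D4 S (∑ i ∈ t, F i) :=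
  Finset.sum_induction _ (s.D4 S) (fun _ _ => D4.add) (D4_of_by BM.zero) h

/-- almost everywhere, finite nets -/
lemma D4.net [Countable G] (hf : s.D4 S f) {ε δ : ℝ} (hε : 0 < ε) (hδ : 0 < δ) :
    ∃ (n : ℕ) (e : Fin n → S) (B : Set X), MeasurableSet[s.Y] B ∧ s.μ.real Bᶜ ≤ δ ∧
      ∀ y ∈ B, ∀ a : S, ∃ k, s.E |s.tr (a : G) f - s.tr (e k : G) f| y < ε := by
  obtain ⟨e, he⟩ := exists_surjective_nat S
  let B : ℕ → Set X := fun n => {y | ∀ a : S, ∃ k : Fin n, s.E |s.tr (a : G) f - s.tr (e k : G) f| y < ε}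
  have hB : ∀ n, MeasurableSet[s.Y] (B n) := by
    intro n
    have : B n = ⋂ a : S, ⋃ k : Fin n, {y | s.E |s.tr (a : G) f - s.tr (e k : G) f| y < ε} := by
      ext y; simp [B]
    rw [this]
    refine MeasurableSet.iInter fun a => MeasurableSet.iUnion fun k => ?_
    have := (E_by (s := s) ((tr_bm (s := s) (a : G) hf.1).sub (tr_bm (s := s) (e k : G) hf.1)).abs).1
    exact this measurableSet_Iio
  have hmono : Monotone B := by
    intro n m hnm y hy a
    obtain ⟨k, hk⟩ := hy a
    exact ⟨⟨k, lt_of_lt_of_le k.2 hnm⟩, hk⟩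
  have hanti : Antitone fun n => (B n)ᶜ := fun n m h => Set.compl_subset_compl.2 (hmono h)
  have hz : s.μ (⋂ n, (B n)ᶜ) = 0 := by
    rw [← Set.compl_iUnion]
    change ∀ᵐ y ∂s.μ, y ∈ ⋃ n, B n
    filter_upwards [hf.2] with y hy
    obtain ⟨F, hF⟩ := hy.net hε
    choose r hr using he
    obtain ⟨m, hm⟩ := (F.image r).bddAbove
    refine Set.mem_iUnion.2 ⟨m + 1, fun a => ?_⟩
    obtain ⟨j, hj, hlt⟩ := hF a
    refine ⟨⟨r j, Nat.lt_succ_of_le (hm (Finset.mem_coe.2 (Finset.mem_image_of_mem r hj)))⟩, ?_⟩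
    simpa [hr] using hlt
  have ht := tendsto_measure_iInter_atTop (μ := s.μ) (fun n => (s.le _ (hB n)).compl.nullMeasurableSet) hanti ⟨0, measure_ne_top _ _⟩
  rw [hz] at ht
  have := (ENNReal.tendsto_toReal ENNReal.zero_ne_top).comp ht
  obtain ⟨n, hn⟩ := (this.eventually (gt_mem_nhds (show (0 : ENNReal).toReal < δ by simpa using hδ))).exists
  exact ⟨n, fun k => e k, B n, hB n, hn.le, fun y hy => hy⟩

variable (s) in
/-- Uniformly approximable by finitely many functions with `Y`-measurable coefficients. -/
def Pc (P : (X → ℝ) → Prop) {J : Type} (F : J → X → ℝ) : Prop :=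
  (∀ j, BM (F j)) ∧ (∃ C, ∀ j x, |F j x| ≤ C) ∧ ∀ ε > 0, ∃ (ι : Type) (_ : Fintype ι) (h : ι → X → ℝ),
    (∀ k, P (h k)) ∧ ∀ j, ∃ c : ι → X → ℝ, (∀ k, s.BY (c k) ∧ ∀ x, |c k x| ≤ 1) ∧ s.N (F j - ∑ k, c k * h k) ≤ ε

variable {P : (X → ℝ) → Prop} {J : Type} {F F' : J → X → ℝ}

lemma Pc.bd (h : s.Pc P F) : ∃ C > 0, ∀ j x, |F j x| ≤ C := by
  obtain ⟨C, hC⟩ := h.2.1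
  exact ⟨max C 1, by positivity, fun j x => (hC j x).trans (le_max_left _ _)⟩

lemma Pc.mono {P' : (X → ℝ) → Prop} (h : s.Pc P F) (hP : ∀ f, P f → P' f) : s.Pc P' F :=
  ⟨h.1, h.2.1, fun ε hε => by
    obtain ⟨ι, i, k, hk, h'⟩ := h.2.2 ε hε
    exact ⟨ι, i, k, fun j => hP _ (hk j), h'⟩⟩

lemma Pc.reindex {J' : Type} (h : s.Pc P F) (r : J' → J) : s.Pc P (fun j => F (r j)) :=
  ⟨fun j => h.1 _, h.2.1.imp fun _ h j x => h _ _, fun ε hε => by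
    obtain ⟨ι, i, k, hk, h'⟩ := h.2.2 ε hε
    exact ⟨ι, i, k, hk, fun j => h' _⟩⟩

lemma comb_bm {ι : Type} [Fintype ι] {c h : ι → X → ℝ} (hc : ∀ k, s.BY (c k) ∧ ∀ x, |c k x| ≤ 1) (hh : ∀ k, BM (h k)) :
    BM (∑ k, c k * h k) := BM.sum fun k _ => (hc k).1.bm.mul (hh k)

lemma Pc.of_approx (hb : ∀ j, BM (F j)) (hC : ∃ C, ∀ j x, |F j x| ≤ C) (hP : ∀ f, P f → BM f)
    (h : ∀ ε > 0, ∃ F' : J → X → ℝ, s.Pc P F' ∧ ∀ j, s.N (F j - F' j) ≤ ε) : s.Pc P F := by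
  refine ⟨hb, hC, fun ε hε => ?_⟩
  obtain ⟨F', h1, h2⟩ := h (ε / 2) (by positivity)
  obtain ⟨ι, i, k, hk, h'⟩ := h1.2.2 (ε / 2) (by positivity)
  refine ⟨ι, i, k, hk, fun j => ?_⟩
  obtain ⟨c, hc, h3⟩ := h' j
  refine ⟨c, hc, (N_tri (hb j) (h1.1 j) (comb_bm hc fun k => hP _ (hk k))).trans ?_⟩
  linarith [h2 j]

lemma Pc.add (h : s.Pc P F) (h' : s.Pc P F') (hP : ∀ f, P f → BM f) : s.Pc P (fun j => F j + F' j) := by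
  obtain ⟨C, _, hC⟩ := h.bd
  obtain ⟨C', _, hC'⟩ := h'.bd
  refine ⟨fun j => (h.1 j).add (h'.1 j), ⟨C + C', fun j x => (abs_add_le _ _).trans (add_le_add (hC j x) (hC' j x))⟩, fun ε hε => ?_⟩
  obtain ⟨ι, _, k, hk, h1⟩ := h.2.2 (ε / 2) (by positivity)
  obtain ⟨ι', _, k', hk', h1'⟩ := h'.2.2 (ε / 2) (by positivity)
  refine ⟨ι ⊕ ι', inferInstance, Sum.elim k k', by rintro (i | i) <;> simp [hk, hk'], fun j => ?_⟩
  obtain ⟨c, hc, h3⟩ := h1 j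
  obtain ⟨c', hc', h3'⟩ := h1' j
  refine ⟨Sum.elim c c', by rintro (i | i) <;> simp [hc, hc'], ?_⟩
  simp only [Fintype.sum_sum_type, Sum.elim_inl, Sum.elim_inr]
  rw [add_sub_add_comm]
  refine (N_add ((h.1 j).sub (comb_bm hc fun k => hP _ (hk k))) ((h'.1 j).sub (comb_bm hc' fun k => hP _ (hk' k)))).trans ?_
  linarith

lemma Pc.mul (h : s.Pc P F) (h' : s.Pc P F') (hP : ∀ f, P f → BM f) (hPm : ∀ f g, P f → P g → P (f * g)) :
    s.Pc P (fun j => F j * F' j) := by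
  obtain ⟨C, hC0, hC⟩ := h.bd
  obtain ⟨C', hC0', hC'⟩ := h'.bd
  refine ⟨fun j => (h.1 j).mul (h'.1 j), ⟨C * C', fun j x => ?_⟩, fun ε hε => ?_⟩
  · simp only [Pi.mul_apply, abs_mul]; exact mul_le_mul (hC j x) (hC' j x) (abs_nonneg _) hC0.le
  obtain ⟨ι, _, k, hk, h1⟩ := h.2.2 (ε / (2 * C')) (by positivity)
  choose D hD0 hD using fun i => (hP _ (hk i)).bd
  have hDs : 0 ≤ ∑ i, D i := Finset.sum_nonneg fun i _ => (hD0 i).le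
  obtain ⟨ι', _, k', hk', h1'⟩ := h'.2.2 (ε / (2 * (∑ i, D i + 1))) (by positivity)
  refine ⟨ι × ι', inferInstance, fun p => k p.1 * k' p.2, fun p => hPm _ _ (hk _) (hk' _), fun j => ?_⟩
  obtain ⟨c, hc, h3⟩ := h1 j
  obtain ⟨c', hc', h3'⟩ := h1' j
  refine ⟨fun p => c p.1 * c' p.2, fun p => ⟨BM.mul (hc _).1 (hc' _).1, fun x => ?_⟩, ?_⟩
  · simp only [Pi.mul_apply, abs_mul]; exact mul_le_one₀ ((hc _).2 x) (abs_nonneg _) ((hc' _).2 x)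
  have b1 := comb_bm hc fun i => hP _ (hk i)
  have b2 := comb_bm hc' fun i => hP _ (hk' i)
  have e1 : F j * F' j - ∑ p : ι × ι', (c p.1 * c' p.2) * (k p.1 * k' p.2) =
      F' j * (F j - ∑ i, c i * k i) + (∑ i, c i * k i) * (F' j - ∑ i, c' i * k' i) := by
    have : ∑ p : ι × ι', (c p.1 * c' p.2) * (k p.1 * k' p.2) = (∑ i, c i * k i) * (∑ i, c' i * k' i) := by
      rw [Fintype.sum_mul_sum, Fintype.sum_prod_type]
      refine Finset.sum_congr rfl fun i _ => Finset.sum_congr rfl fun i' _ => by ring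
    rw [this]; ring
  rw [e1]
  have hbound : ∀ x, |(∑ i, c i * k i) x| ≤ ∑ i, D i + 1 := by
    intro x
    rw [Finset.sum_apply]
    refine (Finset.abs_sum_le_sum_abs _ _).trans ((Finset.sum_le_sum fun i _ => ?_).trans (le_add_of_nonneg_right zero_le_one))
    rw [Pi.mul_apply, abs_mul]
    have := mul_le_mul ((hc i).2 x) (hD i x) (abs_nonneg _) zero_le_one
    rwa [one_mul] at this
  refine (N_add ((h'.1 j).mul ((h.1 j).sub b1)) (b1.mul ((h'.1 j).sub b2))).trans ?_
  have t1 := N_mul (s := s) (h'.1 j) ((h.1 j).sub b1) (hC' j)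
  have t2 := N_mul (s := s) b1 ((h'.1 j).sub b2) hbound
  have t3 := mul_le_mul_of_nonneg_left h3 hC0'.le
  have t4 := mul_le_mul_of_nonneg_left h3' (show 0 ≤ ∑ i, D i + 1 by positivity)
  have t5 : C' * (ε / (2 * C')) = ε / 2 := by field_simp
  have t6 : (∑ i, D i + 1) * (ε / (2 * (∑ i, D i + 1))) = ε / 2 := by field_simp
  linarith

lemma Pc.tr (h : s.Pc P F) (a : G) (hP : ∀ f, P f → BM f) (hPt : ∀ f, P f → P (s.tr a f)) :
    s.Pc P (fun j => s.tr a (F j)) := by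
  refine ⟨fun j => tr_bm a (h.1 j), h.2.1.imp fun _ h j x => h _ _, fun ε hε => ?_⟩
  obtain ⟨ι, _, k, hk, h1⟩ := h.2.2 ε hε
  refine ⟨ι, ‹_›, fun i => s.tr a (k i), fun i => hPt _ (hk i), fun j => ?_⟩
  obtain ⟨c, hc, h3⟩ := h1 j
  refine ⟨fun i => s.tr a (c i), fun i => ⟨tr_by a (hc i).1, fun x => (hc i).2 _⟩, ?_⟩
  have : s.tr a (F j) - ∑ i, s.tr a (c i) * s.tr a (k i) = s.tr a (F j - ∑ i, c i * k i) := by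
    rw [tr_sub, tr_sum]; rfl
  rw [this, N_tr a ((h.1 j).sub (comb_bm hc fun i => hP _ (hk i)))]
  exact h3

lemma Pc.const (hf : P f) (hP : ∀ f, P f → BM f) : s.Pc P (fun _ : J => f) :=
  ⟨fun _ => hP _ hf, (hP _ hf).2.imp fun _ h _ => h, fun ε hε => ⟨Unit, inferInstance, fun _ => f, fun _ => hf, fun j =>
    ⟨fun _ _ => 1, fun _ => ⟨BM.const 1, by simp⟩, by
      have : f - ∑ k : Unit, (fun _ : X => (1 : ℝ)) * f = 0 := by ext x; simp
      rw [this]; simpa [N, I] using hε.le⟩⟩⟩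

/-- uniformly bounded sequences of `Y`-measurable functions -/
lemma Pc.by (hF : ∀ j, s.BY (F j)) (hC : ∃ C, ∀ j x, |F j x| ≤ C) (hP1 : ∀ c : ℝ, P (fun _ => c)) : s.Pc P F := by
  refine ⟨fun j => (hF j).bm, hC, fun ε hε => ?_⟩
  obtain ⟨C, hC⟩ := hC
  have hC1 : 0 < max C 1 := by positivity
  refine ⟨Unit, inferInstance, fun _ _ => max C 1, fun _ => hP1 _, fun j => ⟨fun _ => (max C 1)⁻¹ • F j, fun _ => ⟨BM.smul (hF j) _, fun x => ?_⟩, ?_⟩⟩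
  · simp only [Pi.smul_apply, smul_eq_mul, abs_mul, abs_inv, abs_of_pos hC1]
    rw [inv_mul_le_iff₀ hC1, mul_one]; exact (hC j x).trans (le_max_left _ _)
  · have : F j - ∑ k : Unit, ((max C 1)⁻¹ • F j) * (fun _ => max C 1) = 0 := by
      ext x; simp; field_simp; simp
    rw [this]; simpa [N, I] using hε.le

lemma D4.pc [Countable G] (hf : s.D4 S f) : s.Pc (s.D4 S) (fun a : S => s.tr (a : G) f) := by
  obtain ⟨C, hC0, hC⟩ := hf.1.bd
  refine ⟨fun a => tr_bm _ hf.1, ⟨C, fun a x => hC _⟩, fun ε hε => ?_⟩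
  obtain ⟨n, e, B, hB, hBm, hBe⟩ := hf.net (ε := ε / 2) (δ := ε / (2 * C)) (by positivity) (by positivity)
  refine ⟨Fin n, inferInstance, fun k => s.tr (e k : G) f, fun k => hf.tr _, fun a => ?_⟩
  classical
  let d : Fin n → X → ℝ := fun k => s.E |s.tr (a : G) f - s.tr (e k : G) f|
  have hab : ∀ k, BM |s.tr (a : G) f - s.tr (e k : G) f| := fun k => ((tr_bm _ hf.1).sub (tr_bm _ hf.1)).abs
  let A : Fin n → Set X := fun k => {y | d k y < ε / 2} ∩ ⋂ j : Fin n, ⋂ _ : j < k, {y | d j y < ε / 2}ᶜ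
  have hm0 : ∀ k, MeasurableSet[s.Y] {y | d k y < ε / 2} := fun k =>
    (E_by (s := s) (hab k)).1 measurableSet_Iio
  have hA : ∀ k, MeasurableSet[s.Y] (A k) := fun k =>
    (hm0 k).inter (MeasurableSet.iInter fun j => MeasurableSet.iInter fun _ => (hm0 j).compl)
  have hc : ∀ k, s.BY ((A k).indicator (1 : X → ℝ)) ∧ ∀ x, |(A k).indicator (1 : X → ℝ) x| ≤ 1 := fun k =>
    ⟨BM.ind (hA k), fun x => by by_cases h : x ∈ A k <;> simp [h]⟩
  have hdisj : ∀ x k k', x ∈ A k → x ∈ A k' → k = k' := by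
    intro x k k' h h'
    simp only [A, Set.mem_inter_iff, Set.mem_iInter] at h h'
    rcases lt_trichotomy k k' with hlt | heq | hgt
    · exact absurd h.1 (h'.2 k hlt)
    · exact heq
    · exact absurd h'.1 (h.2 k' hgt)
  have hcov : ∀ x ∈ B, ∃ k, x ∈ A k := by
    intro x hx
    have hex : (Finset.univ.filter fun k => d k x < ε / 2).Nonempty := by
      obtain ⟨k, hk⟩ := hBe x hx a
      exact ⟨k, by simpa using hk⟩
    refine ⟨Finset.min' _ hex, (Finset.mem_filter.1 (Finset.min'_mem _ hex)).2, ?_⟩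
    simp only [Set.mem_iInter]
    intro j hj hcon
    exact absurd (Finset.min'_le _ j (by simpa using hcon)) (not_le.2 hj)
  refine ⟨fun k => (A k).indicator (1 : X → ℝ), hc, ?_⟩
  have bB : BM (Bᶜ.indicator (1 : X → ℝ)) := BM.ind (s.le _ hB).compl
  have hpt : ∀ x, |s.tr (a : G) f - ∑ k, (A k).indicator (1 : X → ℝ) * s.tr (e k : G) f| x ≤
      ((∑ k, (A k).indicator (1 : X → ℝ) * |s.tr (a : G) f - s.tr (e k : G) f|) + C • Bᶜ.indicator (1 : X → ℝ)) x := by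
    intro x
    by_cases hx : ∃ k, x ∈ A k
    · obtain ⟨k, hk⟩ := hx
      have hz : ∀ k' (F : X → ℝ), ((A k').indicator (1 : X → ℝ) * F) x = if k' = k then F x else 0 := by
        intro k' F
        by_cases hkk : k' = k
        · subst hkk; simp [hk]
        · simp [hkk, show x ∉ A k' from fun h => hkk (hdisj x _ _ h hk)]
      simp only [Pi.abs_apply, Pi.sub_apply, Finset.sum_apply, Pi.add_apply, hz, Finset.sum_ite_eq', Finset.mem_univ, if_true]
      refine le_add_of_nonneg_right ?_
      simp only [Pi.smul_apply, smul_eq_mul]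
      exact mul_nonneg hC0.le (Set.indicator_nonneg (fun _ _ => zero_le_one) _)
    · have hxB : x ∈ Bᶜ := fun h => hx (hcov x h)
      push Not at hx
      simp only [Pi.abs_apply, Pi.sub_apply, Finset.sum_apply, Pi.add_apply, Pi.mul_apply, Set.indicator_of_notMem (hx _), zero_mul,
        Finset.sum_const_zero, Pi.smul_apply, Set.indicator_of_mem hxB, Pi.one_apply, smul_eq_mul, mul_one, sub_zero, zero_add]
      exact hC _
  have bs : ∀ k, BM ((A k).indicator (1 : X → ℝ) * |s.tr (a : G) f - s.tr (e k : G) f|) := fun k => (hc k).1.bm.mul (hab k)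
  refine (I_mono ((tr_bm _ hf.1).sub (comb_bm hc fun k => tr_bm _ hf.1)).abs ((BM.sum fun k _ => bs k).add (bB.smul C)) hpt).trans ?_
  rw [I_add (BM.sum fun k _ => bs k) (bB.smul C), I_sum fun k _ => bs k, I_smul]
  have hI1 : ∀ k, s.I ((A k).indicator (1 : X → ℝ) * |s.tr (a : G) f - s.tr (e k : G) f|) ≤ s.I ((ε / 2) • (A k).indicator (1 : X → ℝ)) := by
    intro k
    rw [← I_mul_E (hc k).1 (hab k)]
    refine I_mono ((hc k).1.bm.mul (E_bm (hab k))) ((hc k).1.bm.smul _) fun x => ?_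
    by_cases h : x ∈ A k
    · simpa [h] using (show d k x < ε / 2 from h.1).le
    · simp [h]
  have hI2 : ∑ k, s.I ((ε / 2) • (A k).indicator (1 : X → ℝ)) ≤ ε / 2 := by
    rw [← I_sum fun k _ => (hc k).1.bm.smul _]
    have := I_mono (s := s) (BM.sum fun k (_ : k ∈ Finset.univ) => (hc k).1.bm.smul (ε / 2)) (BM.const (ε / 2)) fun x => by
      by_cases hx : ∃ k, x ∈ A k
      · obtain ⟨k, hk⟩ := hx
        rw [Finset.sum_apply, Finset.sum_eq_single k]
        · simp [hk]
        · intro k' _ hkk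
          simp [show x ∉ A k' from fun h => hkk (hdisj x _ _ h hk)]
        · simp
      · push Not at hx
        simp [hx]; positivity
    rwa [I_const] at this
  have hI3 : s.I (Bᶜ.indicator (1 : X → ℝ)) = s.μ.real Bᶜ := integral_indicator_one (s.le _ hB).compl
  have := Finset.sum_le_sum fun k (_ : k ∈ Finset.univ) => hI1 k
  have h5 : C * (ε / (2 * C)) = ε / 2 := by field_simp
  have h6 := mul_le_mul_of_nonneg_left hBm hC0.le
  rw [hI3]; linarith
end Sys
namespace Sys
variable {G X : Type} [AddCommGroup G] [mX : MeasurableSpace X] [StandardBorelSpace X] {s : Sys G X}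
  {f g : X → ℝ} {S Γ : Submodule ℤ G}

lemma ae_small {D : ℕ → X → ℝ} (hD : ∀ n, BM (D n)) (h0 : ∀ n x, 0 ≤ D n x) (hI : ∀ n : ℕ, s.I (D n) ≤ 1 / (n + 1)) :
    ∀ᵐ y ∂s.μ, ∀ δ > 0, ∃ n, D n y < δ := by
  have h1 : ∀ᵐ y ∂s.μ, ∀ k : ℕ, ∃ n, D n y < 1 / (k + 1) := by
    refine ae_all_iff.2 fun k => ?_
    set B := {y | ¬ ∃ n, D n y < 1 / ((k : ℝ) + 1)} with hB
    have hk : (0 : ℝ) < 1 / (k + 1) := by positivity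
    have hBm : MeasurableSet B := by
      have : B = ⋂ n, {y | 1 / ((k : ℝ) + 1) ≤ D n y} := by ext y; simp [hB]
      rw [this]; exact MeasurableSet.iInter fun n => (hD n).1 measurableSet_Ici
    have hb : ∀ n : ℕ, 1 / ((k : ℝ) + 1) * s.μ.real B ≤ 1 / ((n : ℝ) + 1) := by
      intro n
      refine le_trans ?_ (hI n)
      have := I_mono (s := s) ((BM.ind hBm).smul (1 / ((k : ℝ) + 1))) (hD n) fun x => by
        by_cases hx : x ∈ B
        · have : ∀ n, 1 / ((k : ℝ) + 1) ≤ D n x := by simpa [hB] using hx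
          simpa [hx] using this n
        · simp [hx, h0]
      rw [I_smul, show s.I (B.indicator 1) = s.μ.real B from integral_indicator_one hBm] at this
      exact this
    have h2 := ge_of_tendsto' tendsto_one_div_add_atTop_nhds_zero_nat hb
    have h3 : s.μ.real B = 0 := le_antisymm (by by_contra hcon; push Not at hcon; nlinarith [mul_pos hk hcon]) measureReal_nonneg
    change s.μ B = 0
    exact (measureReal_eq_zero_iff (measure_ne_top _ _)).1 h3
  filter_upwards [h1] with y hy δ hδ
  obtain ⟨k, hk⟩ := exists_nat_one_div_lt hδ
  obtain ⟨n, hn⟩ := hy k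
  exact ⟨n, hn.trans hk⟩

variable (s) in
def Tr (S : Submodule ℤ G) : Prop := ∃ u, s.D4 S u ∧ ¬ (u =ᵐ[s.μ] s.E u)

lemma wm_of_not_tr [Countable G] (hS : ¬ s.Tr S) (hf : BM f) (h0 : s.E f =ᵐ[s.μ] 0) : s.WM S f := by
  by_contra hn
  obtain ⟨u, hu, hu0, hun, happ⟩ := compact_of_not_wm S hf h0 hn
  refine hS ⟨u, ⟨hu, ?_⟩, fun h => hun (h.trans hu0)⟩
  choose ι iF w a D ha hw hD hID hD0 hDb using fun n : ℕ => happ (1 / (n + 1)) (by positivity)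
  obtain ⟨C, hC0, hC⟩ := hf.bd
  have h1 : ∀ᵐ y ∂s.μ, ∀ n, ∀ b : S, s.E |s.tr (b : G) u - s.appr (w n) (a n) f b| y ≤ D n y :=
    ae_all_iff.2 fun n => ae_all_iff.2 fun b => hDb n b b.2
  have bc : ∀ n i b, BM (s.tr (a n i) f * s.tr b f) := fun n i b => (tr_bm _ hf).mul (tr_bm _ hf)
  have h2 : ∀ᵐ y ∂s.μ, ∀ n, ∀ i : ι n, ∀ b : S, ∀ᵐ x ∂(s.κ y),
      s.E (s.tr (a n i) f * s.tr (b : G) f) x = s.E (s.tr (a n i) f * s.tr (b : G) f) y :=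
    ae_all_iff.2 fun n => by
      exact ae_all_iff.2 fun i => ae_all_iff.2 fun b => by_const (E_by (bc n i b))
  filter_upwards [h1, h2, ae_small hD hD0 hID] with y h1 h2 h3
  refine TB.of_le fun ε hε => ?_
  obtain ⟨n, hn⟩ := h3 (ε / 2) (by positivity)
  have hq : TB fun p q : S => ∑ i, |s.E (s.tr (a n i) f * s.tr (p : G) f) y - s.E (s.tr (a n i) f * s.tr (q : G) f) y| :=
    TB.sum fun i _ => TB.bdd (C := C * C) fun p => E_bd (bc n i p) (fun x => by
      simp only [Pi.mul_apply, abs_mul]; exact mul_le_mul (hC _) (hC _) (abs_nonneg _) hC0.le) y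
  refine ⟨_, hq, C, hC0, fun p q => ?_⟩
  have bu := fun p : G => tr_bm (s := s) p hu
  have bp := fun p : G => appr_bm (s := s) (w n) (a n) hf p
  have e0 := E_mono (s := s) ((bu p).sub (bu q)).abs
    ((((bu p).sub (bp p)).abs.add ((bu q).sub (bp q)).abs).add ((bp p).sub (bp q)).abs) (fun x => by
      simp only [Pi.add_apply, Pi.sub_apply, Pi.abs_apply]
      have := abs_add_three (s.tr (p : G) u x - s.appr (w n) (a n) f p x) (s.appr (w n) (a n) f q x - s.tr (q : G) u x)
        (s.appr (w n) (a n) f p x - s.appr (w n) (a n) f q x)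
      rw [abs_sub_comm (s.appr (w n) (a n) f q x)] at this
      refine le_of_eq_of_le (congrArg _ ?_) this
      ring) y
  rw [E_add (((bu p).sub (bp p)).abs.add ((bu q).sub (bp q)).abs) ((bp p).sub (bp q)).abs,
    E_add ((bu p).sub (bp p)).abs ((bu q).sub (bp q)).abs] at e0
  simp only [Pi.add_apply] at e0
  have bt : ∀ i, BM |s.tr (a n i) f * (s.E (s.tr (a n i) f * s.tr (p : G) f) - s.E (s.tr (a n i) f * s.tr (q : G) f))| :=
    fun i => ((tr_bm _ hf).mul ((E_bm (bc n i p)).sub (E_bm (bc n i q)))).abs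
  have e1 := E_mono (s := s) ((bp p).sub (bp q)).abs (BM.sum fun i (_ : i ∈ Finset.univ) => bt i) (fun x => by
    simp only [appr, Pi.abs_apply, Pi.sub_apply, Finset.sum_apply, ← Finset.sum_sub_distrib]
    refine (Finset.abs_sum_le_sum_abs _ _).trans (Finset.sum_le_sum fun i _ => ?_)
    simp only [Pi.smul_apply, Pi.mul_apply, smul_eq_mul, Pi.sub_apply]
    rw [← mul_sub, ← mul_sub, abs_mul]
    exact mul_le_of_le_one_left (abs_nonneg _) (hw n i)) y
  rw [E_sum fun i _ => bt i, Finset.sum_apply] at e1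
  have e2 : ∀ i, s.E |s.tr (a n i) f * (s.E (s.tr (a n i) f * s.tr (p : G) f) - s.E (s.tr (a n i) f * s.tr (q : G) f))| y ≤
      C * |s.E (s.tr (a n i) f * s.tr (p : G) f) y - s.E (s.tr (a n i) f * s.tr (q : G) f) y| := by
    intro i
    rw [E_const_sub (h2 n i p) (h2 n i q)]
    refine mul_le_mul_of_nonneg_right ((le_abs_self _).trans (E_bd (tr_bm _ hf).abs (fun x => ?_) y)) (abs_nonneg _)
    rw [Pi.abs_apply, abs_abs]; exact hC _
  have e3 := Finset.sum_le_sum fun i (_ : i ∈ Finset.univ) => e2 i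
  rw [← Finset.mul_sum] at e3
  linarith [h1 n p, h1 n q]

lemma zero_of_pc [Countable G] (hS : ¬ s.Tr S) (hf : BM f) (h0 : s.E f =ᵐ[s.μ] 0) (hp : s.Pc BM (fun a : S => s.tr (a : G) f)) :
    f =ᵐ[s.μ] 0 := by
  have hw := wm_of_not_tr hS hf h0
  obtain ⟨C, hC0, hC⟩ := hf.bd
  refine ae_zero_of_sq hf (le_antisymm (le_of_forall_pos_le_add fun ε hε => ?_) (I_nonneg fun x => mul_self_nonneg _))
  obtain ⟨ι, _, k, hk, h1⟩ := hp.2.2 (ε / (2 * C)) (by positivity)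
  obtain ⟨a, ha, h2⟩ := hw ι k hk (ε / (2 * (Fintype.card ι + 1))) (by positivity)
  obtain ⟨c, hc, h3⟩ := h1 ⟨a, ha⟩
  simp only at h3
  have bt := tr_bm (s := s) a hf
  have bc := comb_bm hc hk
  have e0 : s.I (f * f) = s.I (s.tr a f * (s.tr a f - ∑ j, c j * k j)) + ∑ j, s.I (c j * s.E (k j * s.tr a f)) := by
    rw [← I_tr (s := s) a (hf.mul hf), tr_mul]
    have : ∀ j, s.I (c j * s.E (k j * s.tr a f)) = s.I (c j * (k j * s.tr a f)) := fun j => I_mul_E (hc j).1 ((hk j).mul bt)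
    simp only [this]
    rw [← I_sum fun j _ => (hc j).1.bm.mul ((hk j).mul bt), ← I_add (bt.mul (bt.sub bc)) (BM.sum fun j _ => (hc j).1.bm.mul ((hk j).mul bt))]
    congr 1
    rw [mul_sub, Finset.mul_sum]
    simp only [mul_left_comm, mul_comm]
    rw [sub_add_cancel]
  have e1 : s.I (s.tr a f * (s.tr a f - ∑ j, c j * k j)) ≤ ε / 2 := by
    refine (le_abs_self _).trans (abs_I_le.trans ((N_mul bt (bt.sub bc) (fun x => hC _)).trans ?_))
    have := mul_le_mul_of_nonneg_left h3 hC0.le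
    have h5 : C * (ε / (2 * C)) = ε / 2 := by field_simp
    linarith
  have e2 : ∀ j, s.I (c j * s.E (k j * s.tr a f)) ≤ ε / (2 * (Fintype.card ι + 1)) := by
    intro j
    refine (le_abs_self _).trans (abs_I_le.trans ((N_mul (hc j).1.bm (E_bm ((hk j).mul bt)) (hc j).2).trans ?_))
    rw [one_mul]; exact (h2 j).le
  have e3 := Finset.sum_le_sum fun j (_ : j ∈ Finset.univ) => e2 j
  rw [Finset.sum_const, Finset.card_univ, nsmul_eq_mul] at e3
  have e4 : (Fintype.card ι : ℝ) * (ε / (2 * (Fintype.card ι + 1))) ≤ ε / 2 := by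
    rw [mul_div_assoc', div_le_div_iff₀ (by positivity) (by positivity)]; nlinarith
  linarith

variable (s) in
def CC (Γ : Submodule ℤ G) (f : X → ℝ) : Prop := BM f ∧ ∀ ε > 0, ∃ g, s.D4 Γ g ∧ s.N (f - g) ≤ ε

lemma D4.cc (hf : s.D4 Γ f) : s.CC Γ f := ⟨hf.1, fun ε hε => ⟨f, hf, by
  rw [sub_self]; simpa [N, I] using hε.le⟩⟩

lemma CC.pc [Countable G] (hf : s.CC Γ f) : s.Pc (s.D4 Γ) (fun a : Γ => s.tr (a : G) f) := by
  obtain ⟨C, hC0, hC⟩ := hf.1.bd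
  refine Pc.of_approx (fun a => tr_bm _ hf.1) ⟨C, fun a x => hC _⟩ (fun _ h => h.1) fun ε hε => ?_
  obtain ⟨g, hg, h1⟩ := hf.2 ε hε
  refine ⟨_, hg.pc, fun a => ?_⟩
  rw [← tr_sub, N_tr _ (hf.1.sub hg.1)]; exact h1

lemma Pc.sum {P : (X → ℝ) → Prop} {J ι : Type} {t : Finset ι} {F : ι → J → X → ℝ} (h : ∀ i ∈ t, s.Pc P (F i)) (hP : ∀ f, P f → BM f)
    (h0 : P 0) : s.Pc P (fun j => ∑ i ∈ t, F i j) := by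
  classical
  induction t using Finset.induction_on with
  | empty => simpa using Pc.const h0 hP
  | insert a t ha ih =>
    simp only [Finset.sum_insert ha]
    exact (h a (by simp)).add (ih fun i hi => h i (by simp [hi])) hP

lemma Pc.prod {P : (X → ℝ) → Prop} {J ι : Type} {t : Finset ι} {F : ι → J → X → ℝ} (h : ∀ i ∈ t, s.Pc P (F i)) (hP : ∀ f, P f → BM f)
    (hPm : ∀ f g, P f → P g → P (f * g)) (h0 : P 1) : s.Pc P (fun j => ∏ i ∈ t, F i j) := by
  classical
  induction t using Finset.induction_on with
  | empty => simpa using Pc.const h0 hP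
  | insert a t ha ih =>
    simp only [Finset.prod_insert ha]
    exact (h a (by simp)).mul (ih fun i hi => h i (by simp [hi])) hP hPm

lemma wm_of_maximal [Countable G] {g : G} (hm : ¬ s.Tr (Γ ⊔ Submodule.span ℤ {g})) (hf : s.D4 Γ f) (h0 : s.E f =ᵐ[s.μ] 0) :
    s.WM (Submodule.span ℤ {g}) f := by
  by_contra hn
  obtain ⟨u, hu, hu0, hun, happ⟩ := compact_of_not_wm _ hf.1 h0 hn
  refine hun (zero_of_pc hm hu hu0 ?_)
  obtain ⟨C, hC0, hC⟩ := hf.1.bd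
  obtain ⟨C', hC'⟩ := hu.2
  have hsp : ∀ a : (Γ ⊔ Submodule.span ℤ {g} : Submodule ℤ G), ∃ (γ : Γ) (b : G), b ∈ Submodule.span ℤ {g} ∧ (γ : G) + b = a := by
    intro a
    obtain ⟨x, hx, b, hb, h⟩ := Submodule.mem_sup.1 a.2
    exact ⟨⟨x, hx⟩, b, hb, h⟩
  choose γ b hb hγ using hsp
  refine Pc.of_approx (fun a => tr_bm _ hu) ⟨C', fun a x => hC' _⟩ (fun _ h => h) fun ε hε => ?_
  obtain ⟨ι, _, w, a, D, ha, hw, hD, hID, hD0, hDb⟩ := happ ε hε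
  refine ⟨fun j => s.tr (γ j : G) (s.appr w a f (b j)), ?_, fun j => ?_⟩
  · have e : ∀ j, s.tr (γ j : G) (s.appr w a f (b j)) = ∑ i, (w i • s.tr (γ j : G) (s.tr (a i) f)) *
        s.tr (γ j : G) (s.E (s.tr (a i) f * s.tr (b j) f)) := by
      intro j; rw [appr, tr_sum]; refine Finset.sum_congr rfl fun i _ => ?_
      rw [tr_smul, tr_mul, smul_mul_assoc]
    simp only [e]
    refine Pc.sum (fun i _ => Pc.mul ?_ ?_ (fun _ h => h) fun _ _ => BM.mul) (fun _ h => h) BM.zero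
    · have := (((hf.tr (a i)).cc.pc.reindex γ).mono (P' := BM) fun _ h => h.1).mul (Pc.const (s := s) (BM.const (w i)) fun _ h => h)
        (fun _ h => h) (fun _ _ => BM.mul)
      convert this using 2 with j
      ext x; simp [mul_comm]
    · refine Pc.by (fun j => tr_by _ (E_by ((tr_bm _ hf.1).mul (tr_bm _ hf.1)))) ⟨C * C, fun j x => ?_⟩ BM.const
      refine E_bd ((tr_bm _ hf.1).mul (tr_bm _ hf.1)) (fun x => ?_) _
      simp only [Pi.mul_apply, abs_mul]; exact mul_le_mul (hC _) (hC _) (abs_nonneg _) hC0.le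
  · rw [← hγ j, ← tr_tr, ← tr_sub, N_tr _ ((tr_bm _ hu).sub (appr_bm w a hf.1 _)), N,
      ← I_E ((tr_bm _ hu).sub (appr_bm w a hf.1 _)).abs]
    refine le_trans (integral_mono_ae ?_ ?_ (hDb _ (hb j))) hID
    · exact (E_bm ((tr_bm _ hu).sub (appr_bm w a hf.1 _)).abs).int _
    · exact hD.int _
end Sys
def LS (a : ℤ → ℝ) (ε : ℝ) : Prop := ∀ᶠ N : ℕ in atTop, |∑ n ∈ Finset.range N, a n| ≤ ε * N

namespace LS
variable {a b : ℤ → ℝ} {ε δ : ℝ}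
lemma add (ha : LS a ε) (hb : LS b δ) : LS (fun n => a n + b n) (ε + δ) := by
  filter_upwards [ha, hb] with N h1 h2
  rw [Finset.sum_add_distrib, add_mul]
  exact (abs_add_le _ _).trans (add_le_add h1 h2)
lemma mono (ha : LS a ε) (h : ε ≤ δ) : LS a δ := by
  filter_upwards [ha] with N h1
  exact h1.trans (by gcongr)
lemma congr (ha : LS a ε) (h : ∀ n, a n = b n) : LS b ε := (funext h : a = b) ▸ ha
lemma of_le (h : ∀ n, |a n| ≤ ε) : LS a ε := Eventually.of_forall fun N => by
  refine (Finset.abs_sum_le_sum_abs _ _).trans ((Finset.sum_le_sum fun (n : ℕ) _ => h (n : ℤ)).trans ?_)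
  simp [mul_comm]
lemma neg (ha : LS a ε) : LS (fun n => - a n) ε := by
  filter_upwards [ha] with N h1
  rwa [Finset.sum_neg_distrib, abs_neg]
lemma smul (ha : LS a ε) (c : ℝ) : LS (fun n => c * a n) (|c| * ε) := by
  filter_upwards [ha] with N h1
  rw [← Finset.mul_sum, abs_mul, mul_assoc]
  exact mul_le_mul_of_nonneg_left h1 (abs_nonneg _)
lemma sum {ι : Type} {t : Finset ι} {A : ι → ℤ → ℝ} {e : ι → ℝ} (h : ∀ i ∈ t, LS (A i) (e i)) :
    LS (fun n => ∑ i ∈ t, A i n) (∑ i ∈ t, e i) := by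
  classical
  induction t using Finset.induction_on with
  | empty => exact of_le fun n => by simp
  | insert i t hi ih =>
    simp only [Finset.sum_insert hi]
    exact (h i (by simp)).add (ih fun j hj => h j (by simp [hj]))
lemma of_abs_le (h : ∀ n, |a n| ≤ b n) (hb : LS b ε) : LS a ε := by
  filter_upwards [hb] with N h1
  exact (Finset.abs_sum_le_sum_abs _ _).trans ((Finset.sum_le_sum fun (n : ℕ) _ => h (n : ℤ)).trans ((le_abs_self _).trans h1))
lemma shift_bd {C : ℝ} (hC : ∀ n, |a n| ≤ C) (h : ℤ) (N : ℕ) :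
    |∑ n ∈ Finset.range N, a (n + h) - ∑ n ∈ Finset.range N, a n| ≤ 2 * C * |(h : ℝ)| := by
  have h0 : 0 ≤ C := (abs_nonneg _).trans (hC 0)
  have step : ∀ h : ℤ, |∑ n ∈ Finset.range N, a (n + (h + 1)) - ∑ n ∈ Finset.range N, a (n + h)| ≤ 2 * C := by
    intro h
    have : ∑ n ∈ Finset.range N, a (n + (h + 1)) - ∑ n ∈ Finset.range N, a (n + h) = a (N + h) - a h := by
      rw [← Finset.sum_sub_distrib]
      have := Finset.sum_range_sub (fun n : ℕ => a (n + h)) N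
      simp only [Nat.cast_add, Nat.cast_one, Nat.cast_zero, zero_add] at this
      rw [← this]
      exact Finset.sum_congr rfl fun n _ => by rw [add_assoc, add_comm h 1]
    rw [this]
    have h1 := abs_sub (a (N + h)) (a h)
    linarith [hC (N + h), hC h]
  induction h using Int.induction_on with
  | zero => simp
  | succ i ih =>
    have h1 := abs_sub_le (∑ n ∈ Finset.range N, a (n + ((i : ℤ) + 1))) (∑ n ∈ Finset.range N, a (n + (i : ℤ))) (∑ n ∈ Finset.range N, a n)
    have h2 := step i
    push_cast at ih ⊢
    rw [abs_of_nonneg (show (0 : ℝ) ≤ i by positivity)] at ih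
    rw [abs_of_nonneg (show (0 : ℝ) ≤ i + 1 by positivity)]
    linarith
  | pred i ih =>
    have h1 := abs_sub_le (∑ n ∈ Finset.range N, a (n + (-(i : ℤ) - 1))) (∑ n ∈ Finset.range N, a (n + -(i : ℤ))) (∑ n ∈ Finset.range N, a n)
    have h2 := step (-(i : ℤ) - 1)
    rw [sub_add_cancel, abs_sub_comm] at h2
    push_cast at ih ⊢
    have h4 := Nat.cast_nonneg (α := ℝ) i
    rw [abs_of_nonpos (show -(i : ℝ) ≤ 0 by linarith)] at ih
    rw [abs_of_nonpos (show -(i : ℝ) - 1 ≤ 0 by linarith)]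
    linarith
lemma shift {C : ℝ} (hC : ∀ n, |a n| ≤ C) (ha : LS a ε) (h : ℤ) (hδ : ε < δ) : LS (fun n => a (n + h)) δ := by
  have h1 : Tendsto (fun N : ℕ => (δ - ε) * (N : ℝ)) atTop atTop :=
    tendsto_natCast_atTop_atTop.const_mul_atTop (by linarith)
  filter_upwards [ha, h1.eventually_ge_atTop (2 * C * |(h : ℝ)|)] with N h2 h3
  have h4 := shift_bd hC h N
  have h5 := abs_sub_abs_le_abs_sub (∑ n ∈ Finset.range N, a (n + h)) (∑ n ∈ Finset.range N, a n)
  linarith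
end LS

namespace Sys
variable {G X : Type} [AddCommGroup G] [mX : MeasurableSpace X] [StandardBorelSpace X] {s : Sys G X}

lemma abs_I_bd {f : X → ℝ} {C : ℝ} (hf : BM f) (hC : ∀ x, |f x| ≤ C) : |s.I f| ≤ C := abs_I_le.trans (N_le hf hC)

/-- van der Corput -/
lemma vdC {V : ℤ → X → ℝ} {g : X → ℝ} (hV : ∀ n, BM (V n)) {C : ℝ} (hC : ∀ n x, |V n x| ≤ C) (hg : BM g)
    (H : ∀ ε > 0, ∃ h : ℕ → ℤ, ∀ i j, i < j → LS (fun n => s.I (V n * V (n + (h j - h i)))) ε) {ε : ℝ} (hε : 0 < ε) :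
    LS (fun n => s.I (g * V n)) ε := by
  obtain ⟨D, hD0, hD⟩ := hg.bd
  have hC0 : 0 ≤ C := by
    obtain ⟨x⟩ : Nonempty X := by
      by_contra hcon
      rw [not_nonempty_iff] at hcon
      exact absurd s.prob.measure_univ (by simp [Set.eq_empty_of_isEmpty])
    exact (abs_nonneg _).trans (hC 0 x)
  set δ := ε / (4 * D) with hδ
  have hδ0 : 0 < δ := by positivity
  obtain ⟨R, hR⟩ := exists_nat_gt (2 * C ^ 2 / δ ^ 2)
  have hR0 : 0 < (R : ℝ) := lt_of_le_of_lt (by positivity) hR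
  obtain ⟨h, hh⟩ := H (δ ^ 2 / 4) (by positivity)
  have hCC : ∀ n m x, |(V n * V m) x| ≤ C ^ 2 := fun n m x => by
    rw [Pi.mul_apply, abs_mul, sq]; exact mul_le_mul (hC _ _) (hC _ _) (abs_nonneg _) hC0
  have hlt : ∀ i j, i < j → LS (fun n => s.I (V (n + h i) * V (n + h j))) (δ ^ 2 / 2) := fun i j hij => by
    refine (LS.shift (C := C ^ 2) (fun n => abs_I_bd ((hV _).mul (hV _)) (hCC _ _)) (hh i j hij) (h i)
      (by linarith [sq_pos_of_pos hδ0] : δ ^ 2 / 4 < δ ^ 2 / 2)).congr fun n => ?_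
    rw [add_assoc, add_sub_cancel]
  have hij : ∀ i j, LS (fun n => s.I (V (n + h i) * V (n + h j))) (if i = j then C ^ 2 else δ ^ 2 / 2) := by
    intro i j
    rcases lt_trichotomy i j with hl | he | hg
    · rw [if_neg hl.ne]; exact hlt i j hl
    · rw [if_pos he]; exact LS.of_le fun n => abs_I_bd ((hV _).mul (hV _)) (hCC _ _)
    · rw [if_neg hg.ne']; exact (hlt j i hg).congr fun n => by rw [mul_comm]
  let A : ℤ → X → ℝ := fun n => (R : ℝ)⁻¹ • ∑ i ∈ Finset.range R, V (n + h i)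
  have hA : ∀ n, BM (A n) := fun n => (BM.sum fun i _ => hV _).smul _
  have hAA : ∀ n, s.I (A n * A n) = (R : ℝ)⁻¹ ^ 2 * ∑ i ∈ Finset.range R, ∑ j ∈ Finset.range R, s.I (V (n + h i) * V (n + h j)) := by
    intro n
    have e : A n * A n = ((R : ℝ)⁻¹ ^ 2) • ∑ i ∈ Finset.range R, ∑ j ∈ Finset.range R, V (n + h i) * V (n + h j) := by
      simp only [A]; rw [smul_mul_smul_comm, Finset.sum_mul_sum, sq]
    rw [e, I_smul, I_sum fun i _ => BM.sum fun j _ => (hV _).mul (hV _)]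
    congr 1
    exact Finset.sum_congr rfl fun i _ => I_sum fun j _ => (hV _).mul (hV _)
  have hLS : LS (fun n => s.I (A n * A n)) (δ ^ 2) := by
    refine (((LS.sum fun i (_ : i ∈ Finset.range R) => LS.sum fun j (_ : j ∈ Finset.range R) => hij i j).smul
      ((R : ℝ)⁻¹ ^ 2)).congr fun n => (hAA n).symm).mono ?_
    have e1 : ∑ i ∈ Finset.range R, ∑ j ∈ Finset.range R, (if i = j then C ^ 2 else δ ^ 2 / 2) ≤ R * C ^ 2 + R * (R * (δ ^ 2 / 2)) := by
      have : ∀ i j : ℕ, (if i = j then C ^ 2 else δ ^ 2 / 2) ≤ (if i = j then C ^ 2 else 0) + δ ^ 2 / 2 := by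
        intro i j; split_ifs <;> nlinarith [sq_nonneg δ]
      refine (Finset.sum_le_sum fun i _ => Finset.sum_le_sum fun j _ => this i j).trans ?_
      simp only [Finset.sum_add_distrib, Finset.sum_ite_eq, Finset.sum_const, Finset.card_range, nsmul_eq_mul]
      gcongr
      rw [← Finset.sum_filter]
      simp only [Finset.sum_const, nsmul_eq_mul]
      gcongr
      exact (Finset.card_filter_le _ _).trans (by simp)
    rw [abs_of_nonneg (by positivity)]
    refine (mul_le_mul_of_nonneg_left e1 (by positivity)).trans ?_
    have h3 : 2 * C ^ 2 < R * δ ^ 2 := by rwa [div_lt_iff₀ (by positivity)] at hR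
    have h4 : (R : ℝ)⁻¹ ^ 2 * (R * C ^ 2 + R * (R * (δ ^ 2 / 2))) = C ^ 2 / R + δ ^ 2 / 2 := by field_simp
    have h5 : C ^ 2 / R ≤ δ ^ 2 / 2 := by rw [div_le_iff₀ hR0]; linarith
    linarith
  have hgA : LS (fun n => s.I (g * A n)) (ε / 2) := by
    have h1 : ∀ n, |s.I (g * A n)| ≤ D / (2 * δ) * s.I (A n * A n) + D * δ / 2 := by
      intro n
      refine abs_I_le.trans ((I_mono (hg.mul (hA n)).abs ((((hA n).mul (hA n)).smul (D / (2 * δ))).add (BM.const (D * δ / 2)))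
        fun x => ?_).trans_eq ?_)
      · simp only [Pi.abs_apply, Pi.mul_apply, Pi.add_apply, Pi.smul_apply, smul_eq_mul, abs_mul]
        refine (mul_le_mul_of_nonneg_right (hD x) (abs_nonneg _)).trans ?_
        rw [← abs_mul_abs_self (A n x)]
        have e : D / (2 * δ) * (|A n x| * |A n x|) + D * δ / 2 - D * |A n x| = D / (2 * δ) * (|A n x| - δ) ^ 2 := by
          field_simp; ring
        have : 0 ≤ D / (2 * δ) * (|A n x| - δ) ^ 2 := by positivity
        linarith
      · rw [I_add (((hA n).mul (hA n)).smul _) (BM.const _), I_smul, I_const]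
    refine (LS.of_abs_le h1 ((hLS.smul (D / (2 * δ))).add (LS.of_le (a := fun _ => D * δ / 2) fun n => le_rfl))).mono ?_
    rw [abs_of_pos (by positivity), abs_of_pos (by positivity)]
    have : D / (2 * δ) * δ ^ 2 + D * δ / 2 = ε / 4 := by rw [hδ]; field_simp; ring
    linarith
  have hb : ∀ n, |s.I (g * V n)| ≤ D * C := fun n => abs_I_bd (hg.mul (hV n)) fun x => by
    rw [Pi.mul_apply, abs_mul]; exact mul_le_mul (hD x) (hC _ _) (abs_nonneg _) hD0.le
  have h1 : Tendsto (fun N : ℕ => (ε / 2) * (N : ℝ)) atTop atTop :=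
    tendsto_natCast_atTop_atTop.const_mul_atTop (by linarith)
  filter_upwards [hgA, h1.eventually_ge_atTop ((R : ℝ)⁻¹ * ∑ i ∈ Finset.range R, 2 * (D * C) * |(h i : ℝ)|)] with N h2 h3
  have e1 : ∀ n : ℤ, s.I (g * A n) = (R : ℝ)⁻¹ * ∑ i ∈ Finset.range R, s.I (g * V (n + h i)) := by
    intro n
    rw [← I_sum fun i _ => hg.mul (hV _), ← I_smul]
    congr 1
    simp only [A]; rw [mul_smul_comm, Finset.mul_sum]
  have e2 : ∑ n ∈ Finset.range N, s.I (g * V n) = ∑ n ∈ Finset.range N, s.I (g * A n) - (R : ℝ)⁻¹ * ∑ i ∈ Finset.range R,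
      (∑ n ∈ Finset.range N, s.I (g * V (n + h i)) - ∑ n ∈ Finset.range N, s.I (g * V n)) := by
    simp only [e1]
    rw [← Finset.mul_sum, Finset.sum_comm, Finset.sum_sub_distrib, Finset.sum_const, Finset.card_range, nsmul_eq_mul, mul_sub,
      inv_mul_cancel_left₀ hR0.ne']
    ring
  rw [e2]
  refine (abs_sub _ _).trans ?_
  rw [abs_mul, abs_of_pos (inv_pos.2 hR0)]
  have e3 : |∑ i ∈ Finset.range R, (∑ n ∈ Finset.range N, s.I (g * V (n + h i)) - ∑ n ∈ Finset.range N, s.I (g * V n))| ≤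
      ∑ i ∈ Finset.range R, 2 * (D * C) * |(h i : ℝ)| :=
    (Finset.abs_sum_le_sum_abs _ _).trans (Finset.sum_le_sum fun i _ => LS.shift_bd (a := fun n => s.I (g * V n)) hb (h i) N)
  have e4 := mul_le_mul_of_nonneg_left e3 (inv_pos.2 hR0).le
  linarith
end Sys
namespace Sys
variable {G X Q : Type} [AddCommGroup G] [AddCommGroup Q] [mX : MeasurableSpace X] [StandardBorelSpace X] {s : Sys G X}
  {Γ : Submodule ℤ G} {σ : Q →+ G} {W : Finset (ℤ → Q)} {f g : (ℤ → Q) → ℤ → X → ℝ} {w : ℤ → Q} {n : ℤ} {C : ℝ}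

noncomputable def pr (s : Sys G X) (σ : Q →+ G) (W : Finset (ℤ → Q)) (f : (ℤ → Q) → ℤ → X → ℝ) (n : ℤ) : X → ℝ :=
  ∏ w ∈ W, s.tr (σ (w n)) (f w n)

lemma prod_le_pw {ι : Type} (t : Finset ι) (a : ι → ℝ) (C : ℝ) (h0 : ∀ i ∈ t, 0 ≤ a i) (h1 : ∀ i ∈ t, a i ≤ C) : ∏ i ∈ t, a i ≤ C ^ t.card :=
  (Finset.prod_le_prod h0 h1).trans_eq (by simp)
lemma pr_bm (hf : ∀ w ∈ W, BM (f w n)) : BM (s.pr σ W f n) := BM.prod fun w hw => tr_bm _ (hf w hw)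
lemma pr_bd (h : ∀ w ∈ W, ∀ x, |f w n x| ≤ C) (x : X) : |s.pr σ W f n x| ≤ C ^ W.card := by
  rw [pr, Finset.prod_apply, Finset.abs_prod]
  exact prod_le_pw _ _ _ (fun _ _ => abs_nonneg _) fun w hw => h w hw _
lemma pr_congr (h : ∀ w ∈ W, f w n = g w n) : s.pr σ W f n = s.pr σ W g n :=
  Finset.prod_congr rfl fun w hw => by rw [h w hw]
open Classical in
lemma pr_erase (hw : w ∈ W) : s.pr σ W f n = s.tr (σ (w n)) (f w n) * s.pr σ (W.erase w) f n :=
  (Finset.mul_prod_erase W _ hw).symm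
open Classical in
lemma pr_update (hw : w ∈ W) (K : ℤ → X → ℝ) : s.pr σ W (Function.update f w K) n = s.tr (σ (w n)) (K n) * s.pr σ (W.erase w) f n := by
  rw [pr_erase hw, Function.update_self]
  congr 1
  exact pr_congr fun u hu => by rw [Function.update_of_ne (Finset.ne_of_mem_erase hu)]
open Classical in
lemma N_pr (hw : w ∈ W) (hC : 1 ≤ C) (hf : ∀ w ∈ W, BM (f w n)) (h : ∀ w ∈ W, ∀ x, |f w n x| ≤ C) {k : X → ℝ} (hk : BM k) :
    s.N (s.tr (σ (w n)) k * s.pr σ (W.erase w) f n) ≤ C ^ W.card * s.N k := by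
  rw [mul_comm]
  have hf' : BM (s.pr σ (W.erase w) f n) := pr_bm fun u hu => hf u (Finset.mem_of_mem_erase hu)
  refine (N_mul hf' (tr_bm _ hk) (pr_bd fun u hu => h u (Finset.mem_of_mem_erase hu))).trans ?_
  rw [N_tr _ hk]
  exact mul_le_mul_of_nonneg_right (pow_le_pow_right₀ hC (Finset.card_erase_le)) N_nonneg

open Classical in
lemma lin_approx (hw : w ∈ W) (hC : 1 ≤ C) (hf : ∀ w ∈ W, ∀ n, BM (f w n)) (hfC : ∀ w ∈ W, ∀ n x, |f w n x| ≤ C)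
    (H : ∀ δ > 0, ∃ (ι : Type) (_ : Fintype ι) (K : ι → ℤ → X → ℝ), (∀ i n, BM (K i n)) ∧ (∀ n, s.N (f w n - ∑ i, K i n) ≤ δ) ∧
      ∀ i, ∀ ε > 0, LS (fun n => s.I (s.pr σ W (Function.update f w (K i)) n)) ε) {ε : ℝ} (hε : 0 < ε) :
    LS (fun n => s.I (s.pr σ W f n)) ε := by
  have hCp : 0 < C ^ W.card := by positivity
  obtain ⟨ι, _, K, hK, h1, h2⟩ := H (ε / (2 * C ^ W.card)) (by positivity)
  have hR : ∀ n, BM (s.pr σ (W.erase w) f n) := fun n => pr_bm fun u hu => hf u (Finset.mem_of_mem_erase hu) n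
  have hs : ∀ n, BM (∑ i, K i n) := fun n => BM.sum fun i _ => hK i n
  have e : ∀ n, s.I (s.tr (σ (w n)) (f w n - ∑ i, K i n) * s.pr σ (W.erase w) f n) +
      ∑ i, s.I (s.pr σ W (Function.update f w (K i)) n) = s.I (s.pr σ W f n) := by
    intro n
    simp only [pr_update hw]
    rw [← I_sum fun i _ => (tr_bm _ (hK i n)).mul (hR n), ← I_add ((tr_bm _ ((hf w hw n).sub (hs n))).mul (hR n))
      (BM.sum fun i _ => (tr_bm _ (hK i n)).mul (hR n)), pr_erase hw, ← Finset.sum_mul, ← add_mul, tr_sub, tr_sum, sub_add_cancel]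
  refine (((LS.of_le (ε := ε / 2) fun n => abs_I_le.trans ((N_pr hw hC (fun u hu => hf u hu n) (fun u hu => hfC u hu n)
    ((hf w hw n).sub (hs n))).trans ?_)).add (LS.sum fun i (_ : i ∈ Finset.univ) =>
      h2 i (ε / (2 * (Fintype.card ι + 1))) (by positivity))).mono ?_).congr e
  · refine (mul_le_mul_of_nonneg_left (h1 n) hCp.le).trans_eq ?_
    field_simp
  · rw [Finset.sum_const, Finset.card_univ, nsmul_eq_mul]
    have e4 : (Fintype.card ι : ℝ) * (ε / (2 * (Fintype.card ι + 1))) ≤ ε / 2 := by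
      rw [mul_div_assoc', div_le_div_iff₀ (by positivity) (by positivity)]; nlinarith
    linarith

variable (s Γ σ) in
def Mx (W : Finset (ℤ → Q)) : Prop := ∀ f : (ℤ → Q) → ℤ → X → ℝ, (∀ w, s.Pc (s.D4 Γ) (f w)) →
  (∃ C, ∀ w n x, |f w n x| ≤ C) → ∀ ε > 0,
  LS (fun n => s.I (s.pr σ W f n) - s.I (s.pr σ W (fun w n => s.E (f w n)) n)) ε

section pair
open Classical
variable (h : ℤ) (ws : ℤ → Q)
def UU (p : (ℤ → Q) × Bool) : ℤ → Q := (if p.2 then sh h p.1 else p.1) - ws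
noncomputable def FF (s : Sys G X) (σ : Q →+ G) (f : (ℤ → Q) → ℤ → X → ℝ) (p : (ℤ → Q) × Bool) (n : ℤ) : X → ℝ :=
  if p.2 then s.tr (σ (p.1 h)) (f p.1 (n + h)) else f p.1 n
noncomputable def W' (W : Finset (ℤ → Q)) : Finset (ℤ → Q) := (W ×ˢ (Finset.univ : Finset Bool)).image (UU h ws)
noncomputable def f' (s : Sys G X) (σ : Q →+ G) (W : Finset (ℤ → Q)) (f : (ℤ → Q) → ℤ → X → ℝ) (u : ℤ → Q) (n : ℤ) : X → ℝ :=
  ∏ p ∈ (W ×ˢ (Finset.univ : Finset Bool)).filter (fun p => UU h ws p = u), s.FF h σ f p n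

lemma FF_pc [Countable G] (hf : ∀ w, s.Pc (s.D4 Γ) (f w)) (p : (ℤ → Q) × Bool) : s.Pc (s.D4 Γ) (s.FF h σ f p) := by
  rcases p with ⟨w, b⟩
  cases b
  · exact hf w
  · exact ((hf w).reindex (fun n => n + h)).tr (σ (w h)) (fun _ h => h.1) fun _ h => h.tr _

lemma f'_pc [Countable G] (hf : ∀ w, s.Pc (s.D4 Γ) (f w)) (u : ℤ → Q) : s.Pc (s.D4 Γ) (s.f' h ws σ W f u) :=
  Pc.prod (fun p _ => FF_pc h hf p) (fun _ h => h.1) (fun _ _ => D4.mul) (D4_of_by BM.one)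

lemma pair_eq (hf : ∀ w n, BM (f w n)) (n : ℤ) :
    s.I (s.pr σ W f n * s.pr σ W f (n + h)) = s.I (s.pr σ (W' h ws W) (s.f' h ws σ W f) n) := by
  have e1 : s.pr σ (W' h ws W) (s.f' h ws σ W f) n =
      ∏ p ∈ W ×ˢ (Finset.univ : Finset Bool), s.tr (σ (UU h ws p n)) (s.FF h σ f p n) := by
    rw [← Finset.prod_fiberwise_of_maps_to (t := W' h ws W) (g := UU h ws) (fun p hp => Finset.mem_image_of_mem _ hp)]
    refine Finset.prod_congr rfl fun u _ => ?_
    rw [f', tr_prod]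
    refine Finset.prod_congr rfl fun p hp => ?_
    rw [(Finset.mem_filter.1 hp).2]
  have e2 : s.tr (σ (ws n)) (s.pr σ (W' h ws W) (s.f' h ws σ W f) n) = s.pr σ W f n * s.pr σ W f (n + h) := by
    rw [e1, tr_prod, Finset.prod_product, pr, pr, ← Finset.prod_mul_distrib]
    refine Finset.prod_congr rfl fun w _ => ?_
    rw [Fintype.prod_bool, mul_comm]
    simp only [UU, FF, if_true, Bool.false_eq_true, if_false, tr_tr, ← map_add, Pi.sub_apply, sh]
    congr 3 <;> abel_nf
  rw [← e2, I_tr]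
  refine pr_bm fun u _ => BM.prod fun p _ => ?_
  rcases p with ⟨w, b⟩
  cases b
  · simpa [FF] using hf w n
  · simpa [FF] using tr_bm _ (hf w _)

lemma f'_bd (hC : 1 ≤ C) (hf : ∀ w n x, |f w n x| ≤ C) (u : ℤ → Q) (n : ℤ) (x : X) :
    |s.f' h ws σ W f u n x| ≤ C ^ (W.card * 2) := by
  rw [f', Finset.prod_apply, Finset.abs_prod]
  refine (prod_le_pw _ _ C (fun _ _ => abs_nonneg _) fun p _ => ?_).trans (pow_le_pow_right₀ hC ?_)
  · rcases p with ⟨w, b⟩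
    cases b
    · simpa [FF] using hf w n x
    · exact hf w _ _
  · refine (Finset.card_filter_le _ _).trans ?_
    rw [Finset.card_product]; simp

lemma pair_LS [Countable G] (hf : ∀ w, s.Pc (s.D4 Γ) (f w)) (hC : 1 ≤ C) (hfC : ∀ w n x, |f w n x| ≤ C) (hM : s.Mx Γ σ (W' h ws W))
    {u : ℤ → Q} (hu : u ∈ W' h ws W) {δ ε : ℝ} (hδ : ∀ n, s.N (s.E (s.f' h ws σ W f u n)) ≤ δ) (hε : 0 < ε) :
    LS (fun n => s.I (s.pr σ W f n * s.pr σ W f (n + h))) (ε + (C ^ (W.card * 2)) ^ (W.card * 2) * δ) := by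
  have h1 := hM _ (f'_pc (W := W) (σ := σ) h ws hf) ⟨_, fun u n x => f'_bd h ws hC hfC u n x⟩ ε hε
  have hb : ∀ v n, BM (s.f' h ws σ W f v n) := fun v n => (f'_pc h ws hf v).1 n
  refine (h1.add (LS.of_le (a := fun n => s.I (s.pr σ (W' h ws W) (fun w n => s.E (s.f' h ws σ W f w n)) n)) fun n => abs_I_le.trans ?_)).congr
    fun n => by rw [pair_eq h ws fun w n => (hf w).1 n, sub_add_cancel]
  have hC2 : 1 ≤ C ^ (W.card * 2) := one_le_pow₀ hC
  rw [pr_erase hu]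
  refine (N_pr (f := fun w n => s.E (s.f' h ws σ W f w n)) hu hC2 (fun v _ => E_bm (hb v n))
    (fun v _ => E_bd (hb v n) (f'_bd h ws hC hfC v n)) (E_bm (hb u n))).trans ?_
  refine mul_le_mul (pow_le_pow_right₀ hC2 ?_) (hδ n) N_nonneg (by positivity)
  refine Finset.card_image_le.trans ?_
  rw [Finset.card_product]; simp
end pair
end Sys
namespace Sys
variable {G X Q : Type} [AddCommGroup G] [AddCommGroup Q] [mX : MeasurableSpace X] [StandardBorelSpace X] {s : Sys G X}
  {Γ : Submodule ℤ G} {σ : Q →+ G} {W : Finset (ℤ → Q)} {f g : (ℤ → Q) → ℤ → X → ℝ} {w : ℤ → Q} {n : ℤ} {C : ℝ}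

open Classical in
/-- choice of shifts -/
lemma shifts [Countable G] {e : ℕ} (htf : ∀ (k : ℤ) (x : Q), k ≠ 0 → k • x = 0 → x = 0)
    (hwm : ∀ q : Q, q ≠ 0 → ∀ k, s.D4 Γ k → s.E k =ᵐ[s.μ] 0 → s.WM (Submodule.span ℤ {σ q}) k)
    (hW : ∀ w ∈ W, w ∈ PolyD Q e) {w₁ : ℤ → Q} (hw₁ : w₁ ∈ W) (hne : w₁ ≠ 0) (ws : ℤ → Q)
    {k : X → ℝ} {c : ℤ → X → ℝ} (hk : s.D4 Γ k) (hk0 : s.E k =ᵐ[s.μ] 0)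
    (hc : ∀ n, s.BY (c n) ∧ ∀ x, |c n x| ≤ 1) (hf1 : f w₁ = fun n => c n * k) {δ : ℝ} (hδ : 0 < δ) (S : Finset ℤ) :
    ∃ y : ℤ, ∀ x ∈ S, ∀ n, s.N (s.E (s.f' (y - x) ws σ W f (w₁ - ws) n)) ≤ δ := by
  by_cases hl : w₁ ∈ PolyD Q 1
  · have hlin := PolyD_one_mul hl
    have hq : w₁ 1 ≠ 0 := fun h => hne (funext fun n => by rw [hlin, h, smul_zero]; rfl)
    have hshl : ∀ (h : ℤ) (w : ℤ → Q), w ∈ PolyD Q 1 → sh h w = w := fun h w hw => sub_eq_zero.1 (mem_PolyD_succ.1 hw h)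
    obtain ⟨a, ha, h1⟩ := hwm _ hq k hk hk0 S (fun x => s.tr ((x : ℤ) • σ (w₁ 1)) k) (fun x => tr_bm _ hk.1) δ hδ
    obtain ⟨y, rfl⟩ := Submodule.mem_span_singleton.1 ha
    refine ⟨y, fun x hx n => ?_⟩
    have hfil : (W ×ˢ (Finset.univ : Finset Bool)).filter (fun p => UU (y - x) ws p = w₁ - ws) = {(w₁, false), (w₁, true)} := by
      ext ⟨w, b⟩
      simp only [Finset.mem_filter, Finset.mem_product, Finset.mem_univ, and_true, Finset.mem_insert, Finset.mem_singleton, Prod.mk.injEq,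
        UU, sub_left_inj]
      constructor
      · rintro ⟨hw, h⟩
        cases b
        · simp at h; simp [h]
        · simp only [if_true] at h
          have hw1 : w ∈ PolyD Q 1 := (sh_mem_iff (y - x) (PolyD_zero_val (hW w hw))).1 (h ▸ hl)
          rw [hshl _ _ hw1] at h
          simp [h]
      · rintro (⟨rfl, rfl⟩ | ⟨rfl, rfl⟩)
        · simp [hw₁]
        · simp [hw₁, hshl _ _ hl]
    have e1 : s.f' (y - x) ws σ W f (w₁ - ws) n = (c n * s.tr (σ (w₁ (y - x))) (c (n + (y - x)))) * (k * s.tr (σ (w₁ (y - x))) k) := by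
      rw [f', hfil, Finset.prod_pair (by simp)]
      simp only [FF, if_true, Bool.false_eq_true, if_false, hf1, tr_mul]
      ring
    have bkk : BM (k * s.tr (σ (w₁ (y - x))) k) := hk.1.mul (tr_bm _ hk.1)
    have bcc : s.BY (c n * s.tr (σ (w₁ (y - x))) (c (n + (y - x)))) := BM.mul (hc _).1 (tr_by _ (hc _).1)
    rw [e1, N_congr (E_pull bcc bkk)]
    refine (N_mul bcc.bm (E_bm bkk) (C := 1) fun z => ?_).trans ?_
    · rw [Pi.mul_apply, abs_mul]; exact mul_le_one₀ ((hc _).2 _) (abs_nonneg _) ((hc _).2 _)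
    rw [one_mul, ← N_tr (s := s) (x • σ (w₁ 1)) (E_bm bkk), ← N_congr (E_tr _ bkk)]
    refine le_of_eq_of_le ?_ (h1 ⟨x, hx⟩).le
    rw [tr_mul, tr_tr, hlin (y - x), map_zsmul, sub_smul, add_sub_cancel]
  · have hfin : (⋃ w ∈ W, {h : ℤ | sh h w = w₁}).Finite := by
      refine W.finite_toSet.biUnion fun w hw => Set.Subsingleton.finite fun h hh h' hh' => ?_
      by_contra hcon
      refine hl (sh_fix htf (sub_ne_zero.2 (Ne.symm hcon)) (hW _ hw₁) ?_)
      rw [Set.mem_setOf_eq] at hh hh'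
      rw [← hh, sh_sh, sub_add_cancel, hh, hh']
    obtain ⟨y, hy⟩ := (S.finite_toSet.biUnion fun x _ => hfin.image fun h => x + h).exists_notMem
    refine ⟨y, fun x hx n => ?_⟩
    have hfil : (W ×ˢ (Finset.univ : Finset Bool)).filter (fun p => UU (y - x) ws p = w₁ - ws) = {(w₁, false)} := by
      ext ⟨w, b⟩
      simp only [Finset.mem_filter, Finset.mem_product, Finset.mem_univ, and_true, Finset.mem_singleton, Prod.mk.injEq,
        UU, sub_left_inj]
      constructor
      · rintro ⟨hw, h⟩
        cases b
        · simp at h; simp [h]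
        · simp only [if_true] at h
          simp at hy
          exact absurd (by rw [← h]; congr 1; abel) (hy x hx w hw)
      · rintro ⟨rfl, rfl⟩
        simp [hw₁]
    have e1 : s.f' (y - x) ws σ W f (w₁ - ws) n = c n * k := by
      rw [f', hfil, Finset.prod_singleton]
      simp [FF, hf1]
    rw [e1, (N_eq_zero (E_bm ((hc n).1.bm.mul hk.1))).2]
    · exact hδ.le
    filter_upwards [E_pull (hc n).1 hk.1, hk0] with z h2 h3
    rw [h2, Pi.mul_apply, h3]; simp

section
variable [Countable G] {e : ℕ} (htf : ∀ (k : ℤ) (x : Q), k ≠ 0 → k • x = 0 → x = 0)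
    (hwm : ∀ q : Q, q ≠ 0 → ∀ k, s.D4 Γ k → s.E k =ᵐ[s.μ] 0 → s.WM (Submodule.span ℤ {σ q}) k)
    (h0W : 0 ∈ W) (hW : ∀ w ∈ W, w ∈ PolyD Q e) {w₁ : ℤ → Q} (hw₁ : w₁ ∈ W) (hne : w₁ ≠ 0)
    (IH : ∀ V : Finset (ℤ → Q), (∀ w ∈ V, w ∈ PolyD Q e) → 0 ∈ V → cntLT e V W → s.Mx Γ σ V)
include htf hwm h0W hW hw₁ hne IH

open Classical in
lemma core (hf : ∀ w, s.Pc (s.D4 Γ) (f w)) (hC : 1 ≤ C) (hfC : ∀ w n x, |f w n x| ≤ C)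
    {g k : X → ℝ} {c : ℤ → X → ℝ} (hg : BM g) (hf0 : f 0 = fun _ => g) (hk : s.D4 Γ k) (hk0 : s.E k =ᵐ[s.μ] 0)
    (hc : ∀ n, s.BY (c n) ∧ ∀ x, |c n x| ≤ 1) (hf1 : f w₁ = fun n => c n * k) {ε : ℝ} (hε : 0 < ε) :
    LS (fun n => s.I (s.pr σ W f n)) ε := by
  obtain ⟨ws, hws, hws0, hpet⟩ := pet_descent W hW ⟨w₁, hw₁, hne⟩
  have hW0 : ∀ w ∈ W.erase 0, w ∈ W ∧ w ≠ 0 := fun w hw => ⟨Finset.mem_of_mem_erase hw, Finset.ne_of_mem_erase hw⟩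
  have hMx : ∀ h, s.Mx Γ σ (W' h ws (W.erase 0)) := by
    intro h
    have := hpet (W' h ws (W.erase 0)) (by
      intro w' hw'
      obtain ⟨⟨w, b⟩, hp, rfl⟩ := Finset.mem_image.1 hw'
      have hw := hW0 w (Finset.mem_product.1 hp).1
      refine ⟨w, hw.1, hw.2, if b then h else 0, ?_⟩
      cases b
      · simp [UU, sh_zero (PolyD_zero_val (hW w hw.1))]
      · simp [UU])
    refine IH _ this.1 (Finset.mem_image.2 ⟨(ws, false), ?_, ?_⟩) this.2
    · simp [hws, hws0]
    · simp [UU]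
  refine (vdC (s := s) (V := s.pr σ (W.erase 0) f) (g := g) (C := C ^ (W.erase 0).card) (fun n => pr_bm fun w _ => (hf w).1 n)
    (fun n x => pr_bd (fun w _ => hfC w n) x) hg (fun ε hε => ?_) hε).congr fun n => ?_
  · set K := (C ^ ((W.erase 0).card * 2)) ^ ((W.erase 0).card * 2) with hKdef
    have hK : 0 < K := by positivity
    obtain ⟨h, -, hh⟩ := exists_seq_of_forall_finset_exists (α := ℤ) (fun _ => True)
      (fun x y => LS (fun n => s.I (s.pr σ (W.erase 0) f n * s.pr σ (W.erase 0) f (n + (y - x)))) ε) fun S _ => by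
        obtain ⟨y, hy⟩ := shifts (W := W.erase 0) htf hwm (fun w hw => hW w (hW0 w hw).1) (Finset.mem_erase.2 ⟨hne, hw₁⟩) hne ws hk hk0 hc hf1
          (δ := ε / (2 * K)) (by positivity) S
        refine ⟨y, trivial, fun x hx => ?_⟩
        refine (pair_LS (y - x) ws hf hC hfC (hMx _) (Finset.mem_image.2 ⟨(w₁, false), ?_, ?_⟩) (hy x hx) (half_pos hε)).mono ?_
        · simp [hw₁, hne]
        · simp [UU]
        · rw [← hKdef]
          have : K * (ε / (2 * K)) = ε / 2 := by field_simp
          linarith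
    exact ⟨h, hh⟩
  · rw [pr_erase h0W, hf0, Pi.zero_apply, map_zero, tr_zero]
end
end Sys
namespace Sys
variable {G X Q : Type} [AddCommGroup G] [AddCommGroup Q] [mX : MeasurableSpace X] [StandardBorelSpace X] {s : Sys G X}
  {Γ : Submodule ℤ G} {σ : Q →+ G} {W : Finset (ℤ → Q)} {f g : (ℤ → Q) → ℤ → X → ℝ} {w : ℤ → Q} {n : ℤ} {C : ℝ}

lemma pc_ck [Countable G] {k : X → ℝ} {c : ℤ → X → ℝ} (hk : s.D4 Γ k) (hc : ∀ n, s.BY (c n) ∧ ∀ x, |c n x| ≤ 1) :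
    s.Pc (s.D4 Γ) (fun n => c n * k) :=
  (Pc.by (fun n => (hc n).1) ⟨1, fun n => (hc n).2⟩ fun r => D4_of_by (BM.const r)).mul (Pc.const hk fun _ h => h.1) (fun _ h => h.1)
    fun _ _ => D4.mul
lemma ck_bd {k c : X → ℝ} (hc : ∀ x, |c x| ≤ 1) (hk : ∀ x, |k x| ≤ C) (x : X) : |(c * k) x| ≤ C := by
  rw [Pi.mul_apply, abs_mul]
  exact (mul_le_mul (hc x) (hk x) (abs_nonneg _) zero_le_one).trans_eq (one_mul C)

section
variable [Countable G] {e : ℕ} (htf : ∀ (k : ℤ) (x : Q), k ≠ 0 → k • x = 0 → x = 0)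
    (hwm : ∀ q : Q, q ≠ 0 → ∀ k, s.D4 Γ k → s.E k =ᵐ[s.μ] 0 → s.WM (Submodule.span ℤ {σ q}) k)
    (h0W : 0 ∈ W) (hW : ∀ w ∈ W, w ∈ PolyD Q e) {w₁ : ℤ → Q} (hw₁ : w₁ ∈ W) (hne : w₁ ≠ 0)
    (IH : ∀ V : Finset (ℤ → Q), (∀ w ∈ V, w ∈ PolyD Q e) → 0 ∈ V → cntLT e V W → s.Mx Γ σ V)
include htf hwm h0W hW hw₁ hne IH

open Classical in
lemma zero1 (hf : ∀ w, s.Pc (s.D4 Γ) (f w)) (hC : 1 ≤ C) (hfC : ∀ w n x, |f w n x| ≤ C)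
    {k : X → ℝ} {c : ℤ → X → ℝ} (hk : s.D4 Γ k) (hk0 : s.E k =ᵐ[s.μ] 0)
    (hc : ∀ n, s.BY (c n) ∧ ∀ x, |c n x| ≤ 1) (hf1 : f w₁ = fun n => c n * k) {ε : ℝ} (hε : 0 < ε) :
    LS (fun n => s.I (s.pr σ W f n)) ε := by
  refine lin_approx h0W hC (fun w _ => (hf w).1) (fun w _ => hfC w) (fun δ hδ => ?_) hε
  obtain ⟨ι, _, g, hg, h1⟩ := (hf 0).2.2 δ hδ
  choose d hd h2 using h1
  refine ⟨ι, ‹_›, fun l n => d n l * g l, fun l n => (hd n l).1.bm.mul (hg l).1, h2, fun l ε hε => ?_⟩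
  obtain ⟨C1, hC10, hC1⟩ := (hg l).1.bd
  obtain ⟨C2, hC20, hC2⟩ := hk.1.bd
  have hc' : ∀ n, s.BY (s.tr (-σ (w₁ n)) (d n l) * c n) ∧ ∀ x, |(s.tr (-σ (w₁ n)) (d n l) * c n) x| ≤ 1 := fun n =>
    ⟨BM.mul (tr_by _ (hd n l).1) (hc n).1, ck_bd (fun x => (hd n l).2 _) (hc n).2⟩
  refine (core (f := Function.update (Function.update f 0 fun _ => g l) w₁ fun n => (s.tr (-σ (w₁ n)) (d n l) * c n) * k)
    (C := C + C1 + C2) (g := g l) htf hwm h0W hW hw₁ hne IH ?_ (by linarith) ?_ (hg l).1 ?_ hk hk0 hc' (Function.update_self ..) hε).congr fun n => ?_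
  · intro w
    rcases eq_or_ne w w₁ with rfl | h
    · rw [Function.update_self]; exact pc_ck hk hc'
    rw [Function.update_of_ne h]
    rcases eq_or_ne w 0 with rfl | h
    · rw [Function.update_self]; exact Pc.const (hg l) fun _ h => h.1
    rw [Function.update_of_ne h]; exact hf w
  · intro w n x
    rcases eq_or_ne w w₁ with rfl | h
    · rw [Function.update_self]; exact (ck_bd (hc' n).2 hC2 x).trans (by linarith)
    rw [Function.update_of_ne h]
    rcases eq_or_ne w 0 with rfl | h
    · rw [Function.update_self]; exact (hC1 x).trans (by linarith)
    rw [Function.update_of_ne h]; exact (hfC w n x).trans (by linarith)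
  · rw [Function.update_of_ne hne.symm, Function.update_self]
  · rw [pr_update hw₁, pr_update h0W, pr_erase (W := W.erase w₁) (Finset.mem_erase.2 ⟨hne.symm, h0W⟩), Function.update_self,
      pr_erase (W := W.erase 0) (Finset.mem_erase.2 ⟨hne, hw₁⟩), hf1, Finset.erase_right_comm]
    rw [pr_congr (f := Function.update f 0 _) (g := f) fun u hu => by rw [Function.update_of_ne (by simp at hu; exact hu.2.1)]]
    simp only [tr_mul, tr_tr, add_neg_cancel, tr_zero, Pi.zero_apply, map_zero]
    congr 1
    ring

open Classical in
lemma zeroA (hf : ∀ w, s.Pc (s.D4 Γ) (f w)) (hC : 1 ≤ C) (hfC : ∀ w n x, |f w n x| ≤ C)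
    (hE : ∀ n, s.E (f w₁ n) =ᵐ[s.μ] 0) {ε : ℝ} (hε : 0 < ε) :
    LS (fun n => s.I (s.pr σ W f n)) ε := by
  refine lin_approx hw₁ hC (fun w _ => (hf w).1) (fun w _ => hfC w) (fun δ hδ => ?_) hε
  obtain ⟨ι, _, g, hg, h1⟩ := (hf w₁).2.2 (δ / 2) (half_pos hδ)
  choose d hd h2 using h1
  have hg' : ∀ l, s.D4 Γ (g l - s.E (g l)) := fun l => by
    have := (hg l).add ((D4_of_by (S := Γ) (E_by (hg l).1)).mul (D4_of_by (s := s) (BM.const (-1))))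
    convert this using 1
    ext x; simp [sub_eq_add_neg]
  have hg0 : ∀ l, s.E (g l - s.E (g l)) =ᵐ[s.μ] 0 := fun l => by
    rw [E_sub (hg l).1 (E_bm (hg l).1)]
    filter_upwards [E_of_by (E_by (s := s) (hg l).1)] with x hx
    simp [hx]
  refine ⟨ι, ‹_›, fun l n => d n l * (g l - s.E (g l)), fun l n => (hd n l).1.bm.mul (hg' l).1, fun n => ?_, fun l ε hε => ?_⟩
  · have b1 : BM (f w₁ n) := (hf w₁).1 n
    have b2 : BM (∑ k, d n k * g k) := comb_bm (hd n) fun k => (hg k).1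
    have e1 : s.E (f w₁ n - ∑ k, d n k * g k) =ᵐ[s.μ] - ∑ k, d n k * s.E (g k) := by
      rw [E_sub b1 b2, E_sum fun k _ => (hd n k).1.bm.mul (hg k).1]
      have : ∀ᵐ x ∂s.μ, ∀ k, s.E (d n k * g k) x = d n k x * s.E (g k) x := ae_all_iff.2 fun k => E_pull (hd n k).1 (hg k).1
      filter_upwards [hE n, this] with x h1 h2
      simp [h1, h2]
    have e2 : f w₁ n - ∑ k, d n k * (g k - s.E (g k)) = (f w₁ n - ∑ k, d n k * g k) - (- ∑ k, d n k * s.E (g k)) := by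
      simp only [mul_sub, Finset.sum_sub_distrib]; ring
    rw [e2]
    refine (N_sub (b1.sub b2) (comb_bm (hd n) fun k => E_bm (hg k).1).neg).trans ?_
    rw [← N_congr e1]
    have := N_E (s := s) (b1.sub b2)
    linarith [h2 n]
  · obtain ⟨C2, hC20, hC2⟩ := (hg' l).1.bd
    refine zero1 (C := C + C2) htf hwm h0W hW hw₁ hne IH ?_ (by linarith) ?_ (hg' l) (hg0 l) (fun n => hd n l) (Function.update_self ..) hε
    · intro w
      rcases eq_or_ne w w₁ with rfl | h
      · rw [Function.update_self]; exact pc_ck (hg' l) (fun n => hd n l)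
      rw [Function.update_of_ne h]; exact hf w
    · intro w n x
      rcases eq_or_ne w w₁ with rfl | h
      · rw [Function.update_self]; exact (ck_bd (hd n l).2 hC2 x).trans (by linarith)
      rw [Function.update_of_ne h]; exact (hfC w n x).trans (by linarith)
end

open Classical in
theorem mix [Countable G] {e : ℕ} (htf : ∀ (k : ℤ) (x : Q), k ≠ 0 → k • x = 0 → x = 0)
    (hwm : ∀ q : Q, q ≠ 0 → ∀ k, s.D4 Γ k → s.E k =ᵐ[s.μ] 0 → s.WM (Submodule.span ℤ {σ q}) k)
    (W : Finset (ℤ → Q)) (h0W : 0 ∈ W) (hW : ∀ w ∈ W, w ∈ PolyD Q e) : s.Mx Γ σ W := by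
  revert h0W hW
  refine (cntLT_wf e).induction (C := fun W => 0 ∈ W → (∀ w ∈ W, w ∈ PolyD Q e) → s.Mx Γ σ W) W fun W IH h0W hW => ?_
  intro f hf ⟨C, hC⟩ ε hε
  set C' := max C 1
  have hC' : 1 ≤ C' := le_max_right _ _
  have hfC : ∀ w n x, |f w n x| ≤ C' := fun w n x => (hC w n x).trans (le_max_left _ _)
  let fT : Finset (ℤ → Q) → (ℤ → Q) → ℤ → X → ℝ := fun T w n => if w ∈ T then s.E (f w n) else f w n
  have hEpc : ∀ w, s.Pc (s.D4 Γ) (fun n => s.E (f w n)) := fun w =>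
    Pc.by (fun n => E_by ((hf w).1 n)) ⟨C', fun n => E_bd ((hf w).1 n) (hfC w n)⟩ fun r => D4_of_by (BM.const r)
  have step : ∀ T ⊆ W.erase 0, ∀ ε > 0, LS (fun n => s.I (s.pr σ W f n) - s.I (s.pr σ W (fT T) n)) ε := by
    intro T
    induction T using Finset.induction_on with
    | empty => exact fun _ ε hε => LS.of_le fun n => by simp [fT, hε.le]
    | insert w T hw ih =>
      intro hT ε hε
      have hwW := Finset.mem_erase.1 (hT (Finset.mem_insert_self w T))
      have hpT : ∀ u, s.Pc (s.D4 Γ) (fT T u) := fun u => by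
        by_cases h : u ∈ T
        · simpa [fT, h] using hEpc u
        · simpa [fT, h] using hf u
      have hbT : ∀ u n x, |fT T u n x| ≤ C' := fun u n x => by
        by_cases h : u ∈ T
        · simpa [fT, h] using E_bd ((hf u).1 n) (hfC u n) x
        · simpa [fT, h] using hfC u n x
      have hz := zeroA (f := Function.update (fT T) w fun n => f w n - s.E (f w n)) (C := C' + C') htf hwm h0W hW hwW.2 hwW.1
        (fun V h1 h2 h3 => IH V h3 h2 h1) (fun u => ?_) (by linarith) (fun u n x => ?_) (fun n => ?_) (half_pos hε)
      · refine (((ih ((Finset.subset_insert _ _).trans hT)) (ε / 2) (half_pos hε)).add hz).mono (by linarith) |>.congr fun n => ?_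
        rw [pr_update hwW.2, pr_erase (f := fT T) hwW.2, pr_erase (f := fT (insert w T)) hwW.2,
          pr_congr (f := fT (insert w T)) (g := fT T) fun u hu => by simp [fT, Finset.ne_of_mem_erase hu]]
        have b0 : BM (s.pr σ (W.erase w) (fT T) n) := pr_bm fun u _ => (hpT u).1 n
        have e1 : fT T w n = f w n := by simp [fT, hw]
        have e2 : fT (insert w T) w n = s.E (f w n) := by simp [fT]
        rw [e1, e2, tr_sub, sub_mul, I_sub ((tr_bm _ ((hf w).1 n)).mul b0) ((tr_bm _ (E_bm ((hf w).1 n))).mul b0)]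
        ring
      · rcases eq_or_ne u w with rfl | h
        · rw [Function.update_self]
          have := (hf u).add ((hEpc u).mul (Pc.const (D4_of_by (s := s) (BM.const (-1))) fun _ h => h.1) (fun _ h => h.1) fun _ _ => D4.mul) (fun _ h => h.1)
          convert this using 1
          ext n x; simp [sub_eq_add_neg]
        · rw [Function.update_of_ne h]; exact hpT u
      · rcases eq_or_ne u w with rfl | h
        · rw [Function.update_self]
          exact (abs_sub _ _).trans (add_le_add (hfC u n x) (E_bd ((hf u).1 n) (hfC u n) x))
        · rw [Function.update_of_ne h]; exact (hbT u n x).trans (by linarith)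
      · rw [Function.update_self, E_sub ((hf w).1 n) (E_bm ((hf w).1 n))]
        filter_upwards [E_of_by (E_by (s := s) ((hf w).1 n))] with x hx
        simp [hx]
  refine (step _ le_rfl ε hε).congr fun n => ?_
  congr 1
  rw [pr_erase h0W, pr_erase (f := fun w n => s.E (f w n)) h0W, pr_congr (f := fT _) (g := fun w n => s.E (f w n)) fun u hu => by simp only [fT, if_pos hu]]
  have e1 : fT (W.erase 0) 0 n = f 0 n := by simp [fT]
  rw [e1, Pi.zero_apply, map_zero, tr_zero, tr_zero, mul_comm, mul_comm (s.E _), I_mul_E _ ((hf 0).1 n)]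
  exact Finset.prod_induction _ s.BY (fun _ _ => BM.mul) BM.one fun w _ => tr_by _ (E_by ((hf w).1 n))
end Sys
namespace Sys
variable {G X : Type} [AddCommGroup G] [mX : MeasurableSpace X] [StandardBorelSpace X] {s : Sys G X}
  {Γ : Submodule ℤ G} {f g : X → ℝ} [Countable G]

lemma D4.tors {g : G} {m : ℕ} (hm : 0 < m) (hg : m • g ∈ Γ) (hf : s.D4 Γ f) : s.D4 (Γ ⊔ Submodule.span ℤ {g}) f := by
  refine ⟨hf.1, ?_⟩
  have h1 : ∀ᵐ y ∂s.μ, ∀ j : Fin m, TB (fun a b : Γ => s.E |s.tr (a : G) (s.tr ((j : ℕ) • g) f) - s.tr (b : G) (s.tr ((j : ℕ) • g) f)| y) :=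
    ae_all_iff.2 fun j => (hf.tr _).2
  have h2 : ∀ a : (Γ ⊔ Submodule.span ℤ {g} : Submodule ℤ G), ∃ (c : Γ) (j : Fin m), (a : G) = c + (j : ℕ) • g := by
    rintro ⟨a, ha⟩
    obtain ⟨c, hc, d, hd, rfl⟩ := Submodule.mem_sup.1 ha
    obtain ⟨z, rfl⟩ := Submodule.mem_span_singleton.1 hd
    have hm' : (0 : ℤ) < m := by exact_mod_cast hm
    have h3 := Int.emod_nonneg z hm'.ne'
    have h4 := Int.emod_lt_of_pos z hm'
    refine ⟨⟨c + (z / m) • (m • g), Γ.add_mem hc (Γ.smul_mem _ hg)⟩, ⟨(z % m).toNat, by omega⟩, ?_⟩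
    simp only
    rw [add_assoc, ← natCast_zsmul, ← natCast_zsmul, Int.toNat_of_nonneg h3, smul_smul, ← add_smul, mul_comm, Int.mul_ediv_add_emod]
  choose c j hcj using h2
  filter_upwards [h1] with y hy ε hε
  choose κ hκ e he using fun j => hy j ε hε
  have := hκ
  refine ⟨Fin m × (∀ j, κ j), inferInstance, fun a => (j a, fun i => e i (c a)), fun a b hab => ?_⟩
  obtain ⟨h3, h4⟩ := Prod.mk.inj hab
  have := he (j a) (c a) (c b) (congrFun h4 _)
  simp only [tr_tr, ← hcj a] at this
  rwa [h3, ← hcj b] at this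

lemma exists_max [Module.Finite ℤ G] (hf : BM f) (hn : ¬ f =ᵐ[s.μ] s.E f) : ∃ Γ : Submodule ℤ G, s.Tr Γ ∧
    (∀ (k : ℤ) (x : G ⧸ Γ), k ≠ 0 → k • x = 0 → x = 0) ∧ ∃ σ : (G ⧸ Γ) →+ G, (∀ q, Submodule.Quotient.mk (σ q) = q) ∧
    ∀ q : G ⧸ Γ, q ≠ 0 → ∀ k, s.D4 Γ k → s.E k =ᵐ[s.μ] 0 → s.WM (Submodule.span ℤ {σ q}) k := by
  obtain ⟨Γ, hΓ, hmax⟩ := (wellFounded_gt (α := Submodule ℤ G)).has_min {Γ | s.Tr Γ} ⟨⊥, f, ⟨hf, ae_of_all _ fun y ε hε =>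
    ⟨Unit, inferInstance, fun _ => (), fun i j _ => by
      rw [Subsingleton.elim i j]; simpa [E] using hε⟩⟩, hn⟩
  have hlt : ∀ g ∉ Γ, ¬ s.Tr (Γ ⊔ Submodule.span ℤ {g}) := fun g hg h => hmax _ h (lt_of_le_of_ne le_sup_left fun h =>
    hg (h ▸ Submodule.mem_sup_right (Submodule.mem_span_singleton_self g)))
  have htf : ∀ (k : ℤ) (x : G ⧸ Γ), k ≠ 0 → k • x = 0 → x = 0 := by
    intro k x hk hx
    obtain ⟨g, rfl⟩ := Submodule.Quotient.mk_surjective Γ x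
    rw [← Submodule.Quotient.mk_smul, Submodule.Quotient.mk_eq_zero] at hx
    rw [Submodule.Quotient.mk_eq_zero]
    by_contra hg
    obtain ⟨u, hu, hun⟩ := hΓ
    refine hlt g hg ⟨u, hu.tors (m := k.natAbs) (Int.natAbs_pos.2 hk) ?_, hun⟩
    rw [← natCast_zsmul]
    rcases Int.natAbs_eq k with h | h
    · rwa [h] at hx
    · rw [h, neg_smul] at hx; exact (Submodule.neg_mem_iff _).1 hx
  refine ⟨Γ, hΓ, htf, ?_⟩
  have : Module.IsTorsionFree ℤ (G ⧸ Γ) := by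
    refine Module.isTorsionFree_iff_smul_eq_zero.2 fun k x h => ?_
    by_cases hk : k = 0
    · exact Or.inl hk
    · exact Or.inr (htf k x hk h)
  have : Module.Free ℤ (G ⧸ Γ) := Module.free_of_finite_type_torsion_free'
  obtain ⟨σ, hσ⟩ := Module.projective_lifting_property Γ.mkQ LinearMap.id (Submodule.mkQ_surjective Γ)
  have hσ' : ∀ q, Submodule.Quotient.mk (σ q) = q := fun q => LinearMap.congr_fun hσ q
  refine ⟨σ.toAddMonoidHom, hσ', fun q hq k hk h0 => wm_of_maximal (hlt _ fun h => hq ?_) hk h0⟩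
  rw [← hσ' q]; exact (Submodule.Quotient.mk_eq_zero Γ).2 h

lemma CC.of_approx (hf : BM f) (h : ∀ ε > 0, ∃ g, s.CC Γ g ∧ s.N (f - g) ≤ ε) : s.CC Γ f := by
  refine ⟨hf, fun ε hε => ?_⟩
  obtain ⟨g, hg, h1⟩ := h (ε / 2) (half_pos hε)
  obtain ⟨g', hg', h2⟩ := hg.2 (ε / 2) (half_pos hε)
  exact ⟨g', hg', (N_tri hf hg.1 hg'.1).trans (by linarith)⟩

lemma CC.lip {h : ℝ → ℝ → ℝ} (hf : s.CC Γ f) (hg : s.CC Γ g) (hb : ∀ f g : X → ℝ, BM f → BM g → BM (fun x => h (f x) (g x)))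
    (hl : ∀ a b c d, |h a b - h c d| ≤ |a - c| + |b - d|) : s.CC Γ (fun x => h (f x) (g x)) := by
  refine ⟨hb _ _ hf.1 hg.1, fun ε hε => ?_⟩
  obtain ⟨f', hf', h1⟩ := hf.2 (ε / 2) (half_pos hε)
  obtain ⟨g', hg', h2⟩ := hg.2 (ε / 2) (half_pos hε)
  refine ⟨fun x => h (f' x) (g' x), hf'.lip hg' (hb _ _ hf'.1 hg'.1) one_pos fun x x' => by rw [one_mul]; exact hl _ _ _ _, ?_⟩
  refine (I_mono ((hb _ _ hf.1 hg.1).sub (hb _ _ hf'.1 hg'.1)).abs ((hf.1.sub hf'.1).abs.add (hg.1.sub hg'.1).abs) fun x => hl _ _ _ _).trans ?_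
  rw [I_add (hf.1.sub hf'.1).abs (hg.1.sub hg'.1).abs]
  exact (add_le_add h1 h2).trans_eq (add_halves ε)

lemma CC.max (hf : s.CC Γ f) (hg : s.CC Γ g) : s.CC Γ (fun x => Max.max (f x) (g x)) := by
  refine hf.lip hg (h := fun a b => Max.max a b) (fun f g hf hg => ⟨hf.1.max hg.1, ?_⟩) fun a b c d => (abs_max_sub_max_le_max _ _ _ _).trans
    (max_le (by linarith [abs_nonneg (b - d)]) (by linarith [abs_nonneg (a - c)]))
  obtain ⟨C, hC0, hC⟩ := hf.bd
  obtain ⟨D, hD0, hD⟩ := hg.bd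
  refine ⟨C + D, fun x => abs_max_le_max_abs_abs.trans (max_le ?_ ?_)⟩
  · linarith [hC x]
  · linarith [hD x]

lemma N_tendsto {F : ℕ → X → ℝ} {C : ℝ} (hF : ∀ n, BM (F n)) (hC : ∀ n x, |F n x| ≤ C) (hf : BM f)
    (h : ∀ x, Tendsto (fun n => F n x) atTop (nhds (f x))) : ∀ ε > 0, ∃ n, s.N (f - F n) ≤ ε := by
  intro ε hε
  obtain ⟨D, _, hD⟩ := hf.bd
  have : Tendsto (fun n => s.N (f - F n)) atTop (nhds (∫ _, (0 : ℝ) ∂s.μ)) := by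
    refine tendsto_integral_of_dominated_convergence (fun _ => D + C) (fun n => (hf.sub (hF n)).abs.1.aestronglyMeasurable) (integrable_const _)
      (fun n => ae_of_all _ fun x => ?_) (ae_of_all _ fun x => ?_)
    · simp only [Pi.abs_apply, Pi.sub_apply, Real.norm_eq_abs, abs_abs]
      exact (abs_sub _ _).trans (add_le_add (hD x) (hC n x))
    · have := ((h x).const_sub (f x)).abs
      simpa using this
  rw [integral_zero] at this
  exact ((this.eventually (gt_mem_nhds hε)).exists).imp fun n h => h.le

lemma CC.iUnion {A : ℕ → Set X} (hm : ∀ i, MeasurableSet (A i)) (h : ∀ i, s.CC Γ ((A i).indicator 1)) : s.CC Γ ((⋃ i, A i).indicator 1) := by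
  have h1 : ∀ n, s.CC Γ ((⋃ i < n, A i).indicator 1) := by
    intro n
    induction n with
    | zero =>
      simp only [not_lt_zero, Set.iUnion_of_empty, Set.iUnion_empty, Set.indicator_empty]
      exact (D4_of_by (s := s) (S := Γ) BM.zero).cc
    | succ n ih =>
      convert ih.max (h n) using 1
      ext x
      rw [Set.biUnion_lt_succ]
      by_cases h1 : x ∈ ⋃ i < n, A i <;> by_cases h2 : x ∈ A n <;> simp [Set.indicator, h1, h2]
  refine CC.of_approx (BM.ind (MeasurableSet.iUnion hm)) fun ε hε => ?_
  have hlim := N_tendsto (s := s) (C := 1) (fun n => (h1 n).1) (fun n x => by simp only [Set.indicator]; split_ifs <;> simp)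
    (BM.ind (MeasurableSet.iUnion hm)) (fun x => ?_)
  · obtain ⟨n, hn⟩ := hlim ε hε
    exact ⟨_, h1 n, hn⟩
  · refine tendsto_atTop_of_eventually_const (i₀ := sInf {i | x ∈ A i} + 1) fun n hn => ?_
    by_cases hx : x ∈ ⋃ i, A i
    · have h2 : x ∈ A (sInf {i | x ∈ A i}) := Nat.sInf_mem (s := {i | x ∈ A i}) (Set.mem_iUnion.1 hx)
      have h3 : x ∈ ⋃ i < n, A i := Set.mem_biUnion (Set.mem_setOf.2 (show _ < n by omega)) h2
      simp only [Set.indicator, hx, h3]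
    · have h3 : x ∉ ⋃ i < n, A i := fun h => hx (Set.iUnion₂_subset (fun i _ => Set.subset_iUnion A i) h)
      simp only [Set.indicator, hx, h3]

/-- the next factor -/
def nx (s : Sys G X) (Γ : Submodule ℤ G) : Sys G X where
  T := s.T
  zero := s.zero
  add := s.add
  μ := s.μ
  prob := s.prob
  mp := s.mp
  Y := { MeasurableSet' := fun A => MeasurableSet A ∧ s.CC Γ (A.indicator 1)
         measurableSet_empty := ⟨MeasurableSet.empty, by simp only [Set.indicator_empty]; exact (D4_of_by (s := s) (S := Γ) BM.zero).cc⟩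
         measurableSet_compl := fun A hA => ⟨hA.1.compl, by
          have := hA.2.lip (h := fun a _ => 1 - a) hA.2 (fun f g hf hg => (BM.const 1).sub hf) fun a b c d => by
            rw [sub_sub_sub_cancel_left, abs_sub_comm]; linarith [abs_nonneg (b - d)]
          convert this using 1
          ext x; by_cases h : x ∈ A <;> simp [h]⟩
         measurableSet_iUnion := fun A hA => ⟨MeasurableSet.iUnion fun i => (hA i).1, CC.iUnion (fun i => (hA i).1) fun i => (hA i).2⟩ }
  le := fun A hA => hA.1
  inv := fun g A hA => ⟨(s.mp g).measurable hA.1, by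
    refine CC.of_approx (BM.ind ((s.mp g).measurable hA.1)) fun ε hε => ?_
    obtain ⟨f, hf, h1⟩ := hA.2.2 ε hε
    exact ⟨s.tr g f, (hf.tr g).cc, (N_tr (s := s) g (hA.2.1.sub hf.1)).trans_le h1⟩⟩

lemma nx_le : s.Y ≤ (s.nx Γ).Y := fun A hA => ⟨s.le A hA, (D4_of_by (BM.ind (m := s.Y) hA)).cc⟩

lemma D4.nx (hf : s.D4 Γ f) : Measurable[(s.nx Γ).Y] f := by
  refine measurable_of_Ioi fun t => ?_
  have hA : MeasurableSet (f ⁻¹' Set.Ioi t) := hf.1.1 measurableSet_Ioi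
  refine ⟨hA, CC.of_approx (BM.ind hA) fun ε hε => ?_⟩
  let h : ℕ → ℝ → ℝ := fun n r => Max.max 0 (Min.min 1 (n * (r - t)))
  have hb : ∀ n r, |h n r| ≤ 1 := fun n r => abs_le.2 ⟨by linarith [le_max_left 0 (Min.min 1 (n * (r - t)))], max_le zero_le_one (min_le_left _ _)⟩
  have hD : ∀ n, s.D4 Γ (h n ∘ f) := fun n => hf.lip1 (by fun_prop) ⟨1, hb n⟩ (L := n + 1) (by positivity) fun r r' => by
    refine (abs_max_sub_max_le_max _ _ _ _).trans (max_le (by simp; positivity) ((abs_min_sub_min_le_max _ _ _ _).trans (max_le (by simp; positivity) ?_)))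
    rw [← mul_sub, sub_sub_sub_cancel_right, abs_mul, Nat.abs_cast]
    gcongr; linarith
  have hlim := N_tendsto (s := s) (C := 1) (fun n => (hD n).1) (fun n x => hb n _) (BM.ind hA) (fun x => ?_)
  · obtain ⟨n, hn⟩ := hlim ε hε
    exact ⟨_, (hD n).cc, hn⟩
  · by_cases hx : t < f x
    · obtain ⟨n0, hn0⟩ := exists_nat_gt (1 / (f x - t))
      refine tendsto_atTop_of_eventually_const (i₀ := n0) fun n hn => ?_
      have h0 : 0 < f x - t := sub_pos.2 hx
      have : 1 ≤ n * (f x - t) := by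
        rw [div_lt_iff₀ h0] at hn0
        have : (n0 : ℝ) ≤ n := by exact_mod_cast hn
        nlinarith
      simp [h, min_eq_left this, hx]
    · refine tendsto_atTop_of_eventually_const (i₀ := 0) fun n hn => ?_
      have : (n : ℝ) * (f x - t) ≤ 0 := mul_nonpos_of_nonneg_of_nonpos (by positivity) (by linarith)
      simp [h, min_eq_right (this.trans zero_le_one), this, hx]
end Sys
def ev {G : Type} [AddCommGroup G] {D : ℕ} (v : Fin D → G) (n : ℤ) : G := ∑ k : Fin D, n ^ ((k : ℕ) + 1) • v k
def dl {G : Type} [AddCommGroup G] {D : ℕ} (d : ℤ) (v : Fin D → G) : Fin D → G := fun k => d ^ ((k : ℕ) + 1) • v k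

section
variable {G Q : Type} [AddCommGroup G] [AddCommGroup Q] {D : ℕ}
lemma ev_add (v v' : Fin D → G) (n : ℤ) : ev (v + v') n = ev v n + ev v' n := by
  simp [ev, Finset.sum_add_distrib]
lemma ev_map (φ : G →+ Q) (v : Fin D → G) (n : ℤ) : ev (fun k => φ (v k)) n = φ (ev v n) := by
  simp [ev, map_sum, map_zsmul]
lemma ev_dl (d : ℤ) (v : Fin D → G) (n : ℤ) : ev (dl d v) n = ev v (d * n) := by
  simp [ev, dl, smul_smul, mul_pow, mul_comm]
lemma ev_mem (v : Fin D → G) : ev v ∈ PolyD G D := by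
  have : ev v = ∑ k : Fin D, fun n : ℤ => n ^ ((k : ℕ) + 1) • v k := by ext n; simp [ev]
  rw [this]
  exact AddSubgroup.sum_mem _ fun k _ => PolyD_mono (by omega) (PolyD_pow (v k) k)
lemma dl_mem (v : Fin D → G) : (fun d => dl d v) ∈ PolyD (Fin D → G) D := by
  classical
  have : (fun d => dl d v) = ∑ k : Fin D, fun n : ℤ => n ^ ((k : ℕ) + 1) • (Pi.single k (v k) : Fin D → G) := by
    ext n j
    simp only [dl, Finset.sum_apply, Pi.smul_apply, Pi.single_apply]
    simp
  rw [this]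
  exact AddSubgroup.sum_mem _ fun k _ => PolyD_mono (by omega) (PolyD_pow _ k)
lemma map_mem (φ : G →+ Q) : ∀ {d : ℕ} {w : ℤ → G}, w ∈ PolyD G d → (fun n => φ (w n)) ∈ PolyD Q d
  | 0, w, h => by
    have : w = 0 := h
    subst this; exact funext fun n => by simp
  | d + 1, w, h => fun k => by
    have := map_mem φ (h k)
    simpa using this
end

namespace Sys
variable {G X Q : Type} [AddCommGroup G] [AddCommGroup Q] [mX : MeasurableSpace X] [StandardBorelSpace X] {s : Sys G X}
  {Γ : Submodule ℤ G} {f g h : X → ℝ} {D : ℕ} [Countable G]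

def SZ (s : Sys G X) (D : ℕ) : Prop := ∀ (V : Finset (Fin D → G)) (A : Set X), MeasurableSet[s.Y] A → 0 < s.μ.real A →
  ∃ c > 0, ∀ᶠ N : ℕ in atTop, c * N ≤ ∑ n ∈ Finset.range N, s.μ.real (⋂ v ∈ V, s.T (ev v n) ⁻¹' A)

lemma ae_E_tr (hf : BM f) : ∀ᵐ y ∂s.μ, ∀ g g' : G, s.E (s.tr g' f) (s.T g y) = s.E f (s.T (g' + g) y) := by
  refine ae_all_iff.2 fun g => ae_all_iff.2 fun g' => ?_
  filter_upwards [tr_ae (s := s) g (E_tr g' hf)] with y hy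
  rw [tr_apply, tr_apply, tr_apply] at hy
  rw [hy, s.add]

lemma E_tri (hf : BM f) (hg : BM g) (hh : BM h) (y : X) : s.E |f - h| y ≤ s.E |f - g| y + s.E |g - h| y := by
  rw [← Pi.add_apply (s.E _), ← E_add (hf.sub hg).abs (hg.sub hh).abs]
  exact E_mono (hf.sub hh).abs ((hf.sub hg).abs.add (hg.sub hh).abs) (fun x => abs_sub_le _ _ _) y

lemma E_prod_ge {ι : Type} (S : Finset ι) {A : Set X} (hA : MeasurableSet A) (γ : ι → G) {q : X} {a b : ℝ} (ha : a ≤ s.E (A.indicator 1) q)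
    (hb : ∀ i ∈ S, s.E |s.tr (γ i) (A.indicator 1) - A.indicator 1| q ≤ b) :
    a - S.card * b ≤ s.E (∏ i ∈ S, s.tr (γ i) (A.indicator 1)) q := by
  have h1 : BM (A.indicator (1 : X → ℝ)) := BM.ind hA
  have h2 : ∀ i, BM |s.tr (γ i) (A.indicator 1) - A.indicator 1| := fun i => ((tr_bm _ h1).sub h1).abs
  have h3 := E_mono (s := s) (f := A.indicator 1 - ∑ i ∈ S, |s.tr (γ i) (A.indicator 1) - A.indicator 1|)
    (h1.sub (BM.sum fun i _ => h2 i)) (BM.prod (t := S) fun i _ => tr_bm (s := s) (γ i) h1) (fun x => ?_) q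
  · rw [E_sub h1 (BM.sum fun i _ => h2 i), E_sum fun i _ => h2 i, Pi.sub_apply, Finset.sum_apply] at h3
    have h4 := Finset.sum_le_sum hb
    rw [Finset.sum_const, nsmul_eq_mul] at h4
    linarith
  · have hn : ∀ z, 0 ≤ A.indicator (1 : X → ℝ) z := fun z => Set.indicator_nonneg (fun _ _ => zero_le_one) z
    simp only [Pi.sub_apply, Finset.sum_apply, Finset.prod_apply, Pi.abs_apply, tr_apply]
    have hp : 0 ≤ ∏ i ∈ S, A.indicator (1 : X → ℝ) (s.T (γ i) x) := Finset.prod_nonneg fun i _ => hn _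
    have hs : 0 ≤ ∑ i ∈ S, |A.indicator (1 : X → ℝ) (s.T (γ i) x) - A.indicator 1 x| := Finset.sum_nonneg fun i _ => abs_nonneg _
    by_cases hx : x ∈ A
    · rw [Set.indicator_of_mem hx] at hs ⊢
      by_cases hall : ∀ i ∈ S, s.T (γ i) x ∈ A
      · rw [Finset.prod_eq_one fun i hi => Set.indicator_of_mem (hall i hi) _]
        simpa using hs
      · push Not at hall
        obtain ⟨i, hi, hiA⟩ := hall
        have := Finset.single_le_sum (f := fun i => |A.indicator (1 : X → ℝ) (s.T (γ i) x) - (1 : X → ℝ) x|) (fun i _ => abs_nonneg _) hi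
        simp only [Set.indicator_of_notMem hiA] at this
        simp at this hp ⊢
        linarith
    · rw [Set.indicator_of_notMem hx] at hs ⊢
      linarith

section lift
variable {π : G →+ Q} {σ : Q →+ G} (hπ : ∀ q, π (σ q) = q) (hΓ : ∀ g, π g = 0 → g ∈ Γ) {A : Set X} (hA : MeasurableSet A)
  (V : Finset (Fin D → G))
open Classical

noncomputable def fw (s : Sys G X) (π : G →+ Q) (σ : Q →+ G) (A : Set X) (V : Finset (Fin D → G)) (w : ℤ → Q) (n : ℤ) : X → ℝ :=
  ∏ v ∈ V.filter (fun v => (fun n => π (ev v n)) = w), s.tr (ev v n - σ (π (ev v n))) (A.indicator 1)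

lemma pt_mem (hπ : ∀ q, π (σ q) = q) (hΓ : ∀ g, π g = 0 → g ∈ Γ) (g : G) : g - σ (π g) ∈ Γ := hΓ _ (by rw [map_sub, hπ, sub_self])

include hA in
lemma fw_bm (w : ℤ → Q) (n : ℤ) : BM (s.fw π σ A V w n) := BM.prod fun v _ => tr_bm _ (BM.ind hA)

include hπ hΓ hA in
lemma pw (hf : BM f) {F : Finset (Fin D → G)} {D0 m : ℕ} {e : Fin m → Γ}
    (hvdw : ∀ c : (Fin D → G) → Option (Fin m), ∃ a ∈ F, ∃ d : ℕ, 1 ≤ d ∧ d ≤ D0 ∧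
      ∀ w ∈ V.image (fun v d => dl d v) ∪ V.image (fun v d => dl d (fun k => σ (π (v k)))), a + w d ∈ F ∧ c (a + w d) = c a)
    {C : Set X} {ε η a₀ : ℝ} (hC1 : ∀ y ∈ C, a₀ ≤ s.E (A.indicator 1) y) (hC2 : ∀ y ∈ C, s.E |f - A.indicator 1| y ≤ η)
    (hC3 : ∀ y ∈ C, ∀ a : Γ, ∃ k, s.E |s.tr (a : G) f - s.tr (e k : G) f| y < ε) (ha0 : V.card * (2 * ε + 2 * η) ≤ a₀ / 2) (hε : 0 < ε) (hη : 0 < η) (ha₀ : 0 < a₀)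
    {y : X} {n : ℤ} (H1 : ∀ h g g' : G, s.E (s.tr g' |s.tr h f - f|) (s.T g y) = s.E |s.tr h f - f| (s.T (g' + g) y))
    (H2 : ∀ g g' : G, s.E (s.tr g' |f - A.indicator 1|) (s.T g y) = s.E |f - A.indicator 1| (s.T (g' + g) y))
    (hyC : ∀ z ∈ F, s.T (ev z n) y ∈ C ∧ s.T (σ (π (ev z n))) y ∈ C) :
    ∃ a ∈ F, ∃ d : ℕ, 1 ≤ d ∧ d ≤ D0 ∧ (a₀ / 2) ^ (V.image (fun v n => π (ev v n))).card ≤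
      s.pr σ (V.image (fun v n => π (ev v n))) (fun w n => s.E (s.fw π σ A V w n)) (d * n) (s.T (ev a n) y) := by
  let P : (Fin D → G) → Fin m → Prop := fun z k =>
    s.E |s.tr (ev z n - σ (π (ev z n))) f - s.tr (e k : G) f| (s.T (σ (π (ev z n))) y) < ε
  obtain ⟨a, haF, d, hd1, hd2, hvd⟩ := hvdw fun z => if h : ∃ k, P z k then some h.choose else none
  refine ⟨a, haF, d, hd1, hd2, ?_⟩
  have hex : ∀ z ∈ F, ∃ k, P z k := fun z hz => hC3 _ (hyC z hz).2 ⟨_, pt_mem hπ hΓ _⟩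
  set k := (hex a haF).choose
  have hk : ∀ z ∈ F, (if h : ∃ k, P z k then some h.choose else none) = (if h : ∃ k, P a k then some h.choose else none) → P z k := by
    intro z hz h
    rw [dif_pos (hex z hz), dif_pos (hex a haF)] at h
    have := (hex z hz).choose_spec
    rwa [Option.some.inj h] at this
  set ga := ev a n
  have b1 : BM (A.indicator (1 : X → ℝ)) := BM.ind hA
  have key : ∀ v ∈ V, s.T (σ (π (ev v (d * n))) + ga) y ∈ C ∧
      s.E |s.tr (ev v (d * n) - σ (π (ev v (d * n)))) (A.indicator 1) - A.indicator 1| (s.T (σ (π (ev v (d * n))) + ga) y) ≤ 2 * ε + 2 * η := by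
    intro v hv
    obtain ⟨hz1, hc1⟩ := hvd (fun d => dl d v) (Finset.mem_union_left _ (Finset.mem_image_of_mem _ hv))
    obtain ⟨hz2, hc2⟩ := hvd (fun d => dl d (fun k => σ (π (v k)))) (Finset.mem_union_right _ (Finset.mem_image_of_mem _ hv))
    have e1 : ev (a + dl (d : ℤ) v) n = ga + ev v (d * n) := by rw [ev_add, ev_dl]
    have e2 : ev (a + dl (d : ℤ) (fun k => σ (π (v k)))) n = ga + σ (π (ev v (d * n))) := by
      rw [ev_add, ev_dl, ← ev_map, ← ev_map]
    have i1 := hk _ hz1 hc1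
    have i2 := hk _ hz2 hc2
    have m1 := (hyC _ hz1).1
    have m2 := (hyC _ hz2).1
    simp only [P] at i1 i2
    rw [e1] at i1 m1
    rw [e2] at i2 m2
    set h := ev v (d * n)
    rw [map_add, map_add] at i1 i2
    rw [hπ] at i2
    set γ := h - σ (π h) with hγ
    set γa := ga - σ (π ga) with hγa
    rw [show ga + h - (σ (π ga) + σ (π h)) = γa + γ by rw [hγ, hγa]; abel] at i1
    rw [show ga + σ (π h) - (σ (π ga) + σ (π h)) = γa by rw [hγa]; abel] at i2
    rw [add_comm ga] at m2
    refine ⟨m2, ?_⟩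
    have t1 := E_tri (s := s) (tr_bm (s := s) (γa + γ) hf) (tr_bm (s := s) (e k : G) hf) (tr_bm (s := s) γa hf) (s.T (σ (π ga) + σ (π h)) y)
    rw [abs_sub_comm (s.tr (e k : G) f)] at t1
    have t2 : |s.tr (γa + γ) f - s.tr γa f| = s.tr γa |s.tr γ f - f| := by rw [tr_abs, tr_sub, tr_tr]
    rw [t2, H1, show γa + (σ (π ga) + σ (π h)) = σ (π h) + ga by rw [hγa]; abel] at t1
    have t3 := hC2 _ m2
    have t4 := H2 (σ (π h) + ga) γ
    rw [show γ + (σ (π h) + ga) = ga + h by rw [hγ]; abel, tr_abs, tr_sub, abs_sub_comm (s.tr γ f)] at t4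
    have t5 := hC2 _ m1
    set q := s.T (σ (π h) + ga) y
    have t6 := E_tri (s := s) (tr_bm (s := s) γ b1) (tr_bm (s := s) γ hf) b1 q
    have t7 := E_tri (s := s) (tr_bm (s := s) γ hf) hf b1 q
    linarith
  rw [pr, Finset.prod_apply, ← Finset.prod_const]
  refine Finset.prod_le_prod (fun _ _ => (half_pos ha₀).le) fun w hw => ?_
  obtain ⟨v0, hv0, rfl⟩ := Finset.mem_image.1 hw
  rw [tr_apply, ← s.add]
  have := E_prod_ge (s := s) (V.filter (fun v => (fun n => π (ev v n)) = fun n => π (ev v0 n))) hA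
    (fun v => ev v (d * n) - σ (π (ev v (d * n)))) (hC1 _ (key v0 hv0).1) (b := 2 * ε + 2 * η) (fun v hv => by
      have hv := Finset.mem_filter.1 hv
      have h1 := (key v hv.1).2
      rwa [show π (ev v (d * n)) = π (ev v0 (d * n)) from congrFun hv.2 (d * n)] at h1 ⊢)
  refine le_trans ?_ this
  have h2 : ((V.filter (fun v => (fun n => π (ev v n)) = fun n => π (ev v0 n))).card : ℝ) ≤ V.card := by
    exact_mod_cast Finset.card_filter_le _ _
  nlinarith
end lift
end Sys
lemma count {Φ u : ℕ → ℝ} (hΦ : ∀ n, 0 ≤ Φ n) {K c : ℝ} (hK : 0 < K) (hc : 0 < c) {D0 : ℕ} (hD : 1 ≤ D0)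
    (hu : ∀ᶠ N : ℕ in atTop, c * N ≤ ∑ n ∈ Finset.range N, u n) (h : ∀ n, u n ≤ K * ∑ d ∈ Finset.Icc 1 D0, Φ (d * n)) :
    ∀ᶠ N : ℕ in atTop, c / (2 * K * D0 * D0) * N ≤ ∑ n ∈ Finset.range N, Φ n := by
  obtain ⟨N0, hN0⟩ := eventually_atTop.1 hu
  have hD' : (1 : ℝ) ≤ D0 := by exact_mod_cast hD
  refine eventually_atTop.2 ⟨(N0 + 2) * D0, fun N hN => ?_⟩
  set M := N / D0 with hM
  have h1 : N0 + 2 ≤ M := (Nat.le_div_iff_mul_le (by omega)).2 hN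
  have h2 : M * D0 ≤ N := Nat.div_mul_le_self _ _
  have h3 : N < D0 * (M + 1) := Nat.lt_mul_div_succ N hD
  have h4 : ∀ d ∈ Finset.Icc 1 D0, ∑ n ∈ Finset.range M, Φ (d * n) ≤ ∑ n ∈ Finset.range N, Φ n := by
    intro d hd
    rw [Finset.mem_Icc] at hd
    rw [← Finset.sum_image (f := Φ) (g := fun n => d * n) (fun a _ b _ hab => Nat.eq_of_mul_eq_mul_left (by omega) hab)]
    refine Finset.sum_le_sum_of_subset_of_nonneg (fun x hx => ?_) fun _ _ _ => hΦ _
    obtain ⟨n, hn, rfl⟩ := Finset.mem_image.1 hx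
    rw [Finset.mem_range] at hn ⊢
    calc d * n ≤ D0 * n := Nat.mul_le_mul_right _ hd.2
      _ < D0 * M := Nat.mul_lt_mul_of_pos_left hn (by omega)
      _ ≤ N := by rw [mul_comm]; exact h2
  have h5 := (hN0 M (by omega)).trans (Finset.sum_le_sum fun n _ => h n)
  rw [← Finset.mul_sum, Finset.sum_comm] at h5
  have h6 := Finset.sum_le_sum h4
  rw [Finset.sum_const, Nat.card_Icc, nsmul_eq_mul, Nat.add_sub_cancel] at h6
  have h7 := h5.trans (mul_le_mul_of_nonneg_left h6 hK.le)
  have h8 : (N : ℝ) ≤ D0 * (M + 1) := by exact_mod_cast h3.le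
  have h9 : (2 : ℝ) ≤ M := by exact_mod_cast (by omega : 2 ≤ M)
  rw [div_mul_eq_mul_div, div_le_iff₀ (by positivity)]
  have h10 : c * N ≤ c * (D0 * (2 * M)) := by gcongr; nlinarith
  nlinarith

namespace Sys
variable {G X Q : Type} [AddCommGroup G] [AddCommGroup Q] [mX : MeasurableSpace X] [StandardBorelSpace X] {s : Sys G X}
  {Γ : Submodule ℤ G} {f g h : X → ℝ} {D : ℕ} {A : Set X}

lemma I_ind (hA : MeasurableSet A) : s.I (A.indicator 1) = s.μ.real A := integral_indicator_one hA

lemma good [Countable G] (hA : MeasurableSet A) (hc : s.CC Γ (A.indicator 1)) (h0 : 0 < s.μ.real A) {M : ℝ} (hM : 0 ≤ M) :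
    ∃ a₀ > 0, ∃ ε > 0, ∃ η > 0, ∃ f, BM f ∧ ∃ (m : ℕ) (e : Fin m → Γ) (C : Set X), MeasurableSet[s.Y] C ∧ 0 < s.μ.real C ∧
      (∀ y ∈ C, a₀ ≤ s.E (A.indicator 1) y) ∧ (∀ y ∈ C, s.E |f - A.indicator 1| y ≤ η) ∧
      (∀ y ∈ C, ∀ a : Γ, ∃ k, s.E |s.tr (a : G) f - s.tr (e k : G) f| y < ε) ∧ M * (2 * ε + 2 * η) ≤ a₀ / 2 := by
  haveI := s.prob
  set p := s.μ.real A
  set η := p / (16 * (M + 1)) with hη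
  have hη0 : 0 < η := by positivity
  obtain ⟨f, hf, hfN⟩ := hc.2 (η * (p / 8)) (by positivity)
  rw [N_sub_comm] at hfN
  obtain ⟨m, e, B, hB, hBm, hBe⟩ := hf.net hη0 (δ := p / 8) (by positivity)
  have b1 : BM (A.indicator (1 : X → ℝ)) := BM.ind hA
  have b2 := (hf.1.sub b1).abs
  let B1 : Set X := {y | p / 2 ≤ s.E (A.indicator 1) y}
  let B2 : Set X := {y | s.E |f - A.indicator 1| y ≤ η}
  have hB1 : MeasurableSet[s.Y] B1 := (E_by b1).1 (measurableSet_Ici (a := p / 2))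
  have hB2 : MeasurableSet[s.Y] B2 := (E_by b2).1 (measurableSet_Iic (a := η))
  have m1 : p / 2 ≤ s.μ.real B1 := by
    have h1 : s.I (s.E (A.indicator 1)) = p := by rw [I_E b1, I_ind hA]
    have h2 := I_mono (s := s) (E_bm (s := s) b1) ((BM.ind (s.le _ hB1)).add (BM.const (p / 2))) (fun x => by
      by_cases hx : x ∈ B1
      · rw [Pi.add_apply, Set.indicator_of_mem hx]
        have := (abs_le.1 (E_bd (s := s) b1 (C := 1) (fun z => by by_cases hz : z ∈ A <;> simp [hz]) x)).2
        have : (0 : ℝ) < p / 2 := by positivity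
        simp only [Pi.one_apply]; linarith
      · rw [Pi.add_apply, Set.indicator_of_notMem hx, zero_add]
        exact (not_le.1 hx).le)
    rw [h1, I_add (BM.ind (s.le _ hB1)) (BM.const _), I_ind (s.le _ hB1), I_const] at h2
    linarith
  have m2 : s.μ.real B2ᶜ ≤ p / 8 := by
    have h2 := I_mono (s := s) ((BM.ind (s.le _ hB2.compl)).smul η) (E_bm (s := s) b2) (fun x => by
      by_cases hx : x ∈ B2
      · rw [Pi.smul_apply, Set.indicator_of_notMem (by simpa using hx), smul_zero]
        exact E_nonneg (fun _ => abs_nonneg _) x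
      · rw [Pi.smul_apply, Set.indicator_of_mem (by simpa using hx)]
        simpa using (not_le.1 hx).le)
    rw [I_smul, I_ind (s.le _ hB2.compl), I_E b2] at h2
    exact le_of_mul_le_mul_left (h2.trans hfN) hη0
  refine ⟨p / 2, by positivity, η, hη0, η, hη0, f, hf.1, m, e, B1 ∩ (B2 ∩ B), ?_, ?_, fun y hy => hy.1, fun y hy => hy.2.1, fun y hy => hBe y hy.2.2, ?_⟩
  · exact @MeasurableSet.inter _ s.Y _ _ hB1 (@MeasurableSet.inter _ s.Y _ _ hB2 hB)
  · have h1 : B1 ⊆ (B1 ∩ (B2 ∩ B)) ∪ (B2ᶜ ∪ Bᶜ) := fun x hx => by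
      by_cases h : x ∈ B2 <;> by_cases h' : x ∈ B <;> simp [h, h', hx]
    have h2 := measureReal_mono (μ := s.μ) h1
    have h3 := measureReal_union_le (μ := s.μ) (B1 ∩ (B2 ∩ B)) (B2ᶜ ∪ Bᶜ)
    have h4 := measureReal_union_le (μ := s.μ) B2ᶜ Bᶜ
    linarith
  · rw [show M * (2 * η + 2 * η) = 4 * M * η by ring, hη, ← mul_div_assoc, div_le_div_iff₀ (by positivity) (by norm_num)]
    nlinarith

section
variable {π : G →+ Q} {σ : Q →+ G} (V : Finset (Fin D → G))
open Classical

lemma fw_bd (w : ℤ → Q) (n : ℤ) (x : X) : 0 ≤ s.fw π σ A V w n x ∧ s.fw π σ A V w n x ≤ 1 := by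
  rw [fw, Finset.prod_apply]
  have h0 : ∀ z, 0 ≤ A.indicator (1 : X → ℝ) z := fun z => Set.indicator_nonneg (fun _ _ => zero_le_one) z
  exact ⟨Finset.prod_nonneg fun v _ => h0 _, Finset.prod_le_one (fun v _ => h0 _) fun v _ =>
    Set.indicator_le_self' (fun _ _ => zero_le_one) _⟩

lemma fw_pc [Countable G] (hπ : ∀ q, π (σ q) = q) (hΓ : ∀ g, π g = 0 → g ∈ Γ) (hc : s.CC Γ (A.indicator 1)) (w : ℤ → Q) :
    s.Pc (s.D4 Γ) (s.fw π σ A V w) :=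
  Pc.prod (fun v _ => hc.pc.reindex fun n => ⟨_, pt_mem hπ hΓ (ev v n)⟩) (fun _ h => h.1) (fun _ _ h h' => h.mul h')
    (D4_of_by BM.one)

lemma pr_fw (hA : MeasurableSet A) (n : ℤ) :
    s.I (s.pr σ (V.image (fun v n => π (ev v n))) (s.fw π σ A V) n) = s.μ.real (⋂ v ∈ V, s.T (ev v n) ⁻¹' A) := by
  have hm : MeasurableSet (⋂ v ∈ V, s.T (ev v n) ⁻¹' A) := Finset.measurableSet_biInter _ fun v _ => (s.mp _).measurable hA
  rw [← I_ind hm]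
  congr 1
  have h1 : s.pr σ (V.image (fun v n => π (ev v n))) (s.fw π σ A V) n = ∏ v ∈ V, s.tr (ev v n) (A.indicator 1) := by
    rw [← Finset.prod_fiberwise_of_maps_to (g := fun v n => π (ev v n)) (fun v hv => Finset.mem_image_of_mem _ hv)]
    refine Finset.prod_congr rfl fun w hw => ?_
    rw [fw, tr_prod]
    refine Finset.prod_congr rfl fun v hv => ?_
    rw [tr_tr, ← congrFun (Finset.mem_filter.1 hv).2 n]
    congr 1; abel
  rw [h1]
  ext x
  rw [Finset.prod_apply]
  by_cases hx : ∀ v ∈ V, s.T (ev v n) x ∈ A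
  · rw [Set.indicator_of_mem (by simpa using hx)]
    exact Finset.prod_eq_one fun v hv => Set.indicator_of_mem (hx v hv) _
  · rw [Set.indicator_of_notMem (by simpa using hx)]
    push Not at hx
    obtain ⟨v, hv, h⟩ := hx
    exact Finset.prod_eq_zero hv (Set.indicator_of_notMem h _)

theorem lift [Countable G] (hπ : ∀ q, π (σ q) = q) (hΓ : ∀ g, π g = 0 → g ∈ Γ)
    (hMx : ∀ W : Finset (ℤ → Q), 0 ∈ W → (∀ w ∈ W, w ∈ PolyD Q D) → s.Mx Γ σ W) (hSZ : s.SZ D) : (s.nx Γ).SZ D := by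
  intro V0 A hA h0
  haveI := s.prob
  obtain ⟨hA, hc⟩ : MeasurableSet A ∧ s.CC Γ (A.indicator 1) := hA
  change 0 < s.μ.real A at h0
  set V := insert 0 V0 with hV
  set W := V.image (fun v n => π (ev v n)) with hW
  obtain ⟨a₀, ha₀, ε, hε, η, hη, f, hf, m, e, C, hCm, hC0, hC1, hC2, hC3, hle⟩ := good hA hc h0 (M := V.card) (by positivity)
  have hWt : ∀ w ∈ V.image (fun v (d : ℤ) => dl d v) ∪ V.image (fun v d => dl d (fun k => σ (π (v k)))), w ∈ PolyD (Fin D → G) D := by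
    intro w hw
    rcases Finset.mem_union.1 hw with h | h <;> obtain ⟨v, -, rfl⟩ := Finset.mem_image.1 h <;> exact dl_mem _
  obtain ⟨F, D0, hvdw⟩ := poly_vdw _ hWt (Option (Fin m))
  obtain ⟨c, hc0, hSZ⟩ := hSZ (F ∪ F.image (fun z k => σ (π (z k)))) C hCm hC0
  have hD0 : 1 ≤ D0 := by
    obtain ⟨_, _, d, h1, h2, _⟩ := hvdw fun _ => none
    omega
  have hFp : 0 < F.card := by
    obtain ⟨a, h1, _⟩ := hvdw fun _ => none
    exact Finset.card_pos.2 ⟨a, h1⟩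
  let ψ : ℤ → X → ℝ := s.pr σ W (fun w n => s.E (s.fw π σ A V w n))
  have hψ : ∀ n, BM (ψ n) := fun n => pr_bm fun w _ => E_bm (fw_bm hA V w n)
  have hψ0 : ∀ n x, 0 ≤ ψ n x := fun n x => by
    simp only [ψ, pr, Finset.prod_apply]
    exact Finset.prod_nonneg fun w _ => E_nonneg (fun z => (fw_bd V w n z).1) _
  set c1 := (a₀ / 2) ^ W.card with hc1
  have hc1p : 0 < c1 := by positivity
  let Bn : ℕ → Set X := fun n => ⋂ v ∈ F ∪ F.image (fun z k => σ (π (z k))), s.T (ev v n) ⁻¹' C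
  have hBn : ∀ n, MeasurableSet (Bn n) := fun n => Finset.measurableSet_biInter _ fun v _ => (s.mp _).measurable (s.le _ hCm)
  have key : ∀ n : ℕ, s.μ.real (Bn n) ≤ F.card / c1 * ∑ d ∈ Finset.Icc 1 D0, s.I (ψ ((d * n : ℕ) : ℤ)) := by
    intro n
    have b1 : BM (A.indicator (1 : X → ℝ)) := BM.ind hA
    let R : X → ℝ := ∑ a ∈ F, ∑ d ∈ Finset.Icc 1 D0, s.tr (ev a n) (ψ ((d * n : ℕ) : ℤ))
    have hR : BM R := BM.sum fun a _ => BM.sum fun d _ => tr_bm _ (hψ _)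
    have h1 : s.I (c1 • (Bn n).indicator 1) ≤ s.I R := by
      refine integral_mono_ae (((BM.ind (hBn n)).smul c1).int _) (hR.int _) ?_
      filter_upwards [ae_all_iff.2 fun h : G => ae_E_tr (s := s) (f := |s.tr h f - f|) ((tr_bm h hf).sub hf).abs,
        ae_E_tr (s := s) (hf.sub b1).abs] with y H1 H2
      have hRn : ∀ a ∈ F, 0 ≤ ∑ d ∈ Finset.Icc 1 D0, s.tr (ev a n) (ψ ((d * n : ℕ) : ℤ)) y := fun a _ => Finset.sum_nonneg fun d _ => hψ0 _ _
      simp only [R, Finset.sum_apply]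
      by_cases hy : y ∈ Bn n
      · have hy' : ∀ v ∈ F ∪ F.image (fun z k => σ (π (z k))), s.T (ev v n) y ∈ C := by simpa only [Bn, Set.mem_iInter, Set.mem_preimage] using hy
        obtain ⟨a, haF, d, hd1, hd2, hp⟩ := pw (s := s) hπ hΓ hA V hf hvdw hC1 hC2 hC3 hle hε hη ha₀ (y := y) (n := n) H1 H2 (fun z hz => ⟨hy' z (Finset.mem_union_left _ hz), by
          have := hy' _ (Finset.mem_union_right _ (Finset.mem_image_of_mem _ hz))
          rwa [ev_map σ (fun k => π (z k)), ev_map π] at this⟩)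
        rw [Pi.smul_apply, Set.indicator_of_mem hy, Pi.one_apply, smul_eq_mul, mul_one]
        refine le_trans ?_ (Finset.single_le_sum hRn haF)
        refine le_trans ?_ (Finset.single_le_sum (f := fun d : ℕ => s.tr (ev a n) (ψ ((d * n : ℕ) : ℤ)) y) (fun d _ => hψ0 _ _) (Finset.mem_Icc.2 ⟨hd1, hd2⟩))
        simp only [ψ, tr_apply, Nat.cast_mul]
        exact hp
      · rw [Pi.smul_apply, Set.indicator_of_notMem hy, smul_zero]
        exact Finset.sum_nonneg hRn
    rw [I_smul, I_ind (hBn n), I_sum fun a _ => BM.sum fun d _ => tr_bm _ (hψ _)] at h1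
    simp only [I_sum (s := s) fun d (_ : d ∈ Finset.Icc 1 D0) => tr_bm (s := s) _ (hψ _), I_tr _ (hψ _)] at h1
    rw [Finset.sum_const, nsmul_eq_mul] at h1
    rw [div_mul_eq_mul_div, le_div_iff₀ hc1p, mul_comm]
    exact h1
  have h2 := count (Φ := fun n => s.I (ψ n)) (u := fun n => s.μ.real (Bn n)) (fun n => I_nonneg (hψ0 _)) (by positivity) hc0 hD0 hSZ key
  set c2 := c / (2 * (F.card / c1) * D0 * D0)
  have hc2 : 0 < c2 := by positivity
  have h0W : (0 : ℤ → Q) ∈ W := Finset.mem_image.2 ⟨0, Finset.mem_insert_self _ _, funext fun n => by simp [ev]⟩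
  have hWp : ∀ w ∈ W, w ∈ PolyD Q D := fun w hw => by
    obtain ⟨v, -, rfl⟩ := Finset.mem_image.1 hw
    exact map_mem π (ev_mem v)
  have h3 := hMx W h0W hWp (s.fw π σ A V) (fw_pc V hπ hΓ hc) ⟨1, fun w n x => by
    rw [abs_of_nonneg (fw_bd V w n x).1]; exact (fw_bd V w n x).2⟩ (c2 / 2) (by positivity)
  refine ⟨c2 / 2, by positivity, ?_⟩
  filter_upwards [h2, h3] with N h2 h3
  rw [Finset.sum_sub_distrib] at h3
  have h4 := (abs_le.1 h3).1
  have h5 : ∑ n ∈ Finset.range N, s.I (s.pr σ W (s.fw π σ A V) n) ≤ ∑ n ∈ Finset.range N, (s.nx Γ).μ.real (⋂ v ∈ V0, (s.nx Γ).T (ev v n) ⁻¹' A) := by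
    refine Finset.sum_le_sum fun n _ => ?_
    rw [hW, pr_fw V hA]
    change _ ≤ s.μ.real (⋂ v ∈ V0, s.T (ev v n) ⁻¹' A)
    exact measureReal_mono (Set.biInter_mono (fun v hv => Finset.mem_insert_of_mem hv) fun _ _ => le_rfl)
  refine le_trans ?_ h5
  simp only [ψ] at h2
  linarith
end
end Sys
namespace Sys
variable {G X : Type} [AddCommGroup G] [mX : MeasurableSpace X] [StandardBorelSpace X] {s : Sys G X} {D : ℕ} {A B : Set X}

lemma szx [Countable G] (hSZ : s.SZ D) (V : Finset (Fin D → G)) (hA : MeasurableSet A) (h0 : 0 < s.μ.real A) (hB : MeasurableSet[s.Y] B)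
    (h1 : s.μ.real (B \ A) ≤ s.μ.real A / (4 * (V.card + 1))) (h2 : s.μ.real (A \ B) ≤ s.μ.real A / (4 * (V.card + 1))) :
    ∃ c > 0, ∀ᶠ N : ℕ in atTop, c * N ≤ ∑ n ∈ Finset.range N, s.μ.real (⋂ v ∈ V, s.T (ev v n) ⁻¹' A) := by
  haveI := s.prob
  set a := s.μ.real A
  set k : ℝ := (V.card : ℝ)
  have hk : 0 ≤ k := by positivity
  set t : ℝ := 1 / (2 * (k + 1)) with ht
  have ht0 : 0 < t := by positivity
  have b1 : BM (Aᶜ.indicator (1 : X → ℝ)) := BM.ind hA.compl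
  let A' : Set X := {y | s.E (Aᶜ.indicator 1) y ≤ t}
  have hA' : MeasurableSet[s.Y] A' := (E_by b1).1 (measurableSet_Iic (a := t))
  have hBY : s.BY (B.indicator 1) := BM.ind (m := s.Y) hB
  have hBm := s.le _ hB
  have hA'm := s.le _ hA'
  have hmul : ∀ C C' : Set X, (C.indicator 1 * C'.indicator 1 : X → ℝ) = (C ∩ C').indicator 1 := fun C C' => by
    ext x; rw [Pi.mul_apply, Set.inter_indicator_one]; rfl
  have m1 : t * s.μ.real (B \ A') ≤ a / (4 * (k + 1)) := by
    refine le_trans ?_ h1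
    have e1 : s.I (B.indicator 1 * s.E (Aᶜ.indicator 1)) = s.μ.real (B \ A) := by
      rw [I_mul_E hBY b1, hmul, I_ind (hBm.inter hA.compl)]; rfl
    rw [← e1, ← I_ind (hBm.diff hA'm), ← I_smul]
    refine I_mono ((BM.ind (hBm.diff hA'm)).smul t) ((BM.ind hBm).mul (E_bm b1)) fun x => ?_
    have hE : 0 ≤ s.E (Aᶜ.indicator 1) x := E_nonneg (fun z => Set.indicator_nonneg (fun _ _ => zero_le_one) z) x
    rw [Pi.smul_apply, Pi.mul_apply]
    by_cases hx : x ∈ B \ A'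
    · rw [Set.indicator_of_mem hx, Set.indicator_of_mem hx.1]
      simpa using (not_le.1 hx.2).le
    · rw [Set.indicator_of_notMem hx, smul_zero]
      exact mul_nonneg (Set.indicator_nonneg (fun _ _ => zero_le_one) x) hE
  have m2 : 0 < s.μ.real A' := by
    have h3 : A ⊆ A' ∪ (B \ A') ∪ (A \ B) := fun x hx => by
      by_cases h : x ∈ B <;> by_cases h' : x ∈ A' <;> simp [h, h', hx]
    have h4 := measureReal_mono (μ := s.μ) h3
    have h5 := measureReal_union_le (μ := s.μ) (A' ∪ (B \ A')) (A \ B)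
    have h6 := measureReal_union_le (μ := s.μ) A' (B \ A')
    have h7 : s.μ.real (B \ A') ≤ a / 2 := by
      rw [ht, one_div, inv_mul_le_iff₀ (by positivity)] at m1
      refine m1.trans_eq ?_
      field_simp; norm_num
    have h8 : a / (4 * (k + 1)) ≤ a / 4 := div_le_div_of_nonneg_left h0.le (by norm_num) (by linarith)
    linarith
  obtain ⟨c, hc, hN⟩ := hSZ V A' hA' m2
  refine ⟨c / 2, by positivity, ?_⟩
  filter_upwards [hN] with N hN
  have key : ∀ n : ℕ, s.μ.real (⋂ v ∈ V, s.T (ev v n) ⁻¹' A') ≤ 2 * s.μ.real (⋂ v ∈ V, s.T (ev v n) ⁻¹' A) := by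
    intro n
    set Bn := ⋂ v ∈ V, s.T (ev v n) ⁻¹' A'
    have hBn : MeasurableSet[s.Y] Bn := @Finset.measurableSet_biInter _ _ s.Y _ _ fun v _ => s.inv _ hA'
    have e1 : ∀ v ∈ V, s.μ.real (Bn ∩ s.T (ev v n) ⁻¹' Aᶜ) ≤ t * s.μ.real Bn := by
      intro v hv
      have hm : MeasurableSet (s.T (ev v n) ⁻¹' Aᶜ) := (s.mp _).measurable hA.compl
      have hYn : s.BY (Bn.indicator 1) := BM.ind (m := s.Y) hBn
      rw [← I_ind ((s.le _ hBn).inter hm), ← hmul]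
      change s.I (Bn.indicator 1 * s.tr (ev v n) (Aᶜ.indicator 1)) ≤ _
      rw [← I_mul_E hYn (tr_bm _ b1), ← I_ind (s.le _ hBn), ← I_smul]
      refine integral_mono_ae ((hYn.bm.mul (E_bm (tr_bm _ b1))).int _) ((hYn.bm.smul t).int _) ?_
      filter_upwards [E_tr (s := s) (ev v n) b1] with y hy
      rw [Pi.mul_apply, hy, Pi.smul_apply]
      by_cases hyB : y ∈ Bn
      · rw [Set.indicator_of_mem hyB]
        have : s.T (ev v n) y ∈ A' := by
          simp only [Bn, Set.mem_iInter] at hyB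
          exact hyB v hv
        have h' : s.tr (ev v n) (s.E (Aᶜ.indicator 1)) y ≤ t := this
        simpa using h'
      · simp [Set.indicator_of_notMem hyB]
    have e2 : Bn ⊆ (⋂ v ∈ V, s.T (ev v n) ⁻¹' A) ∪ ⋃ v ∈ V, (Bn ∩ s.T (ev v n) ⁻¹' Aᶜ) := fun x hx => by
      by_cases h : x ∈ ⋂ v ∈ V, s.T (ev v n) ⁻¹' A
      · exact Or.inl h
      · right
        simp only [Set.mem_iInter, not_forall] at h
        obtain ⟨v, hv, h⟩ := h
        exact Set.mem_biUnion hv ⟨hx, h⟩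
    have e3 := (measureReal_mono (μ := s.μ) e2).trans (measureReal_union_le _ _)
    have e4 := (measureReal_biUnion_finset_le (μ := s.μ) V fun v => Bn ∩ s.T (ev v n) ⁻¹' Aᶜ).trans (Finset.sum_le_sum e1)
    rw [Finset.sum_const, nsmul_eq_mul] at e4
    have e5 : k * (t * s.μ.real Bn) ≤ 1 / 2 * s.μ.real Bn := by
      rw [← mul_assoc]
      refine mul_le_mul_of_nonneg_right ?_ measureReal_nonneg
      rw [ht, mul_one_div, div_le_div_iff₀ (by positivity) (by norm_num)]; linarith
    linarith
  have := hN.trans (Finset.sum_le_sum fun n _ => key n)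
  rw [← Finset.mul_sum] at this
  linarith

theorem sz [Countable G] [Module.Finite ℤ G] (s : Sys G X) (V : Finset (Fin D → G)) (hA : MeasurableSet A) (h0 : 0 < s.μ.real A) :
    ∃ c > 0, ∀ᶠ N : ℕ in atTop, c * N ≤ ∑ n ∈ Finset.range N, s.μ.real (⋂ v ∈ V, s.T (ev v n) ⁻¹' A) := by
  haveI := s.prob
  letI : Preorder (Sys G X) := Preorder.lift (fun r => r.Y)
  let S : Set (Sys G X) := {r | r.T = s.T ∧ r.μ = s.μ ∧ r.SZ D}
  let b0 : Sys G X := ⟨s.T, s.zero, s.add, s.μ, s.prob, s.mp, ⊥, bot_le, fun g B hB => by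
    rcases MeasurableSpace.measurableSet_bot_iff.1 hB with rfl | rfl
    · exact @MeasurableSet.empty _ ⊥
    · exact @MeasurableSet.univ _ ⊥⟩
  obtain ⟨r, -, hr⟩ := zorn_le_nonempty₀ S (fun c hc hch y hy => by
    let 𝒜 : Set (Set X) := {A | ∃ m ∈ c, MeasurableSet[m.Y] A}
    have hle : sSup (Sys.Y '' c) ≤ mX := sSup_le (by rintro _ ⟨m, hm, rfl⟩; exact m.le)
    have hls : ∀ m ∈ c, m.Y ≤ sSup (Sys.Y '' c) := fun m hm => le_sSup (Set.mem_image_of_mem _ hm)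
    have hgen : sSup (Sys.Y '' c) = MeasurableSpace.generateFrom 𝒜 := by
      ext A; rw [MeasurableSpace.measurableSet_sSup]
      simp only [Set.exists_mem_image]; rfl
    have hinv : ∀ g, Measurable[sSup (Sys.Y '' c), sSup (Sys.Y '' c)] (s.T g) := fun g => by
      have : Measurable[sSup (Sys.Y '' c), MeasurableSpace.generateFrom 𝒜] (s.T g) := by
        refine @measurable_generateFrom _ _ (sSup (Sys.Y '' c)) _ _ ?_
        rintro B ⟨m, hm, hB⟩
        exact hls m hm _ ((hc hm).1 ▸ m.inv g hB)
      rwa [← hgen] at this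
    refine ⟨⟨s.T, s.zero, s.add, s.μ, s.prob, s.mp, sSup (Sys.Y '' c), hle, hinv⟩, ⟨rfl, rfl, ?_⟩, fun z hz => hls z hz⟩
    have halg : IsSetAlgebra 𝒜 := ⟨⟨y, hy, @MeasurableSet.empty _ y.Y⟩, fun B ⟨m, hm, hB⟩ => ⟨m, hm, @MeasurableSet.compl _ _ m.Y hB⟩, by
      rintro B B' ⟨m, hm, hB⟩ ⟨m', hm', hB'⟩
      rcases hch.total hm hm' with h | h
      · exact ⟨m', hm', @MeasurableSet.union _ m'.Y _ _ (h _ hB) hB'⟩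
      · exact ⟨m, hm, @MeasurableSet.union _ m.Y _ _ hB (h _ hB')⟩⟩
    intro V A hA h0
    change 0 < s.μ.real A at h0
    obtain ⟨B, ⟨m, hm, hB⟩, hd⟩ := @Measure.MeasureDense.approx _ (sSup (Sys.Y '' c)) _ _ (@Measure.MeasureDense.of_generateFrom_isSetAlgebra_finite _ (sSup (Sys.Y '' c)) (s.μ.trim hle) 𝒜 (isFiniteMeasure_trim hle) halg hgen) A hA
      (@measure_ne_top _ (sSup (Sys.Y '' c)) _ (isFiniteMeasure_trim hle) _) (s.μ.real A / (4 * (V.card + 1))) (by positivity)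
    have hBs : MeasurableSet[sSup (Sys.Y '' c)] B := hls m hm _ hB
    rw [trim_measurableSet_eq hle (@MeasurableSet.symmDiff _ (sSup (Sys.Y '' c)) _ _ hA hBs)] at hd
    have hd' : s.μ.real (symmDiff A B) ≤ s.μ.real A / (4 * (V.card + 1)) :=
      ENNReal.toReal_le_of_le_ofReal (by positivity) hd.le
    obtain ⟨hT, hμ, hs⟩ := hc hm
    have := szx hs V (hle _ hA) (by rwa [hμ]) hB (by rw [hμ]; exact (measureReal_mono (fun x hx => Or.inr hx)).trans hd')
      (by rw [hμ]; exact (measureReal_mono (fun x hx => Or.inl hx)).trans hd')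
    rwa [hT, hμ] at this) b0 ⟨rfl, rfl, fun V B hB h => by
        rcases MeasurableSpace.measurableSet_bot_iff.1 hB with rfl | rfl
        · simp at h
        · exact ⟨1, one_pos, Eventually.of_forall fun N => by simp⟩⟩
  obtain ⟨hT, hμ, hSZ⟩ := hr.1
  have hall : ∀ f, BM f → f =ᵐ[r.μ] r.E f := by
    by_contra hn
    push Not at hn
    obtain ⟨f, hf, hn⟩ := hn
    obtain ⟨Γ, ⟨u, hu, hun⟩, htf, σ, hσ, hwm⟩ := exists_max hf hn
    have hl : (r.nx Γ).SZ D := lift (π := (Submodule.mkQ Γ).toAddMonoidHom) (σ := σ) hσ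
      (fun g hg => (Submodule.Quotient.mk_eq_zero Γ).1 hg) (fun W h0 hW => mix htf hwm W h0 hW) hSZ
    have hmem : r.nx Γ ∈ S := ⟨hT, hμ, hl⟩
    have := hr.2 hmem nx_le
    exact hun (E_of_by ⟨(D4.nx hu).mono this le_rfl, hu.1.2⟩).symm
  have b1 : BM (A.indicator (1 : X → ℝ)) := BM.ind hA
  have hae := hall _ b1
  let B : Set X := {y | 1 ≤ r.E (A.indicator 1) y}
  have hB : MeasurableSet[r.Y] B := (E_by b1).1 (measurableSet_Ici (a := 1))
  have hBA : B =ᵐ[r.μ] A := by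
    filter_upwards [hae] with y hy
    refine propext ⟨fun h => ?_, fun h => ?_⟩
    · by_contra hn
      have h' : (1 : ℝ) ≤ r.E (A.indicator 1) y := h
      rw [← hy, Set.indicator_of_notMem hn] at h'
      linarith
    · change (1 : ℝ) ≤ r.E (A.indicator 1) y
      rw [← hy, Set.indicator_of_mem h]; rfl
  rw [← hT, ← hμ]
  rw [← hμ] at h0
  refine szx hSZ V hA h0 hB ?_ ?_
  · change r.μ.real (B \ A) ≤ _
    rw [measureReal_def, (ae_le_set.1 hBA.le)]
    positivity
  · change r.μ.real (A \ B) ≤ _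
    rw [measureReal_def, (ae_le_set.1 hBA.symm.le)]
    positivity
end Sys
theorem unif {G : Type} [AddCommGroup G] [Module.Finite ℤ G] [Countable G] {D : ℕ} (V : Finset (Fin D → G)) {α : ℝ} (hα : 0 < α) :
    ∃ M : ℕ, 1 ≤ M ∧ ∃ c > 0, ∀ (X : Type) [MeasurableSpace X] (μ : Measure X) [IsProbabilityMeasure μ] (R : G → X → X),
      (∀ x, R 0 x = x) → (∀ a b x, R (a + b) x = R a (R b x)) → (∀ g, MeasurePreserving (R g) μ μ) → ∀ A : Set X, MeasurableSet A →
      α ≤ μ.real A → c ≤ ∑ n ∈ Finset.Icc 1 M, μ.real (⋂ v ∈ V, R (ev v n) ⁻¹' A) := by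
  let Ω := G → Bool
  let S : G → Ω → Ω := fun g ω h => ω (h + g)
  have hS : ∀ g, Continuous (S g) := fun g => continuous_pi fun h => continuous_apply _
  let A0 : Set Ω := {ω | ω 0 = true}
  have hA0 : IsClopen A0 := (isClopen_discrete {true}).preimage (continuous_apply (0 : G))
  let B : ℕ → Set Ω := fun n => ⋂ v ∈ V, S (ev v n) ⁻¹' A0
  have hB : ∀ n, IsClopen (B n) := fun n => V.finite_toSet.isClopen_biInter fun v _ => hA0.preimage (hS _)
  have hcont : ∀ C : Set Ω, IsClopen C → Continuous fun ν : ProbabilityMeasure Ω => (ν : Measure Ω).real C := fun C hC =>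
    continuous_iff_continuousAt.2 fun ν => (ENNReal.tendsto_toReal (measure_ne_top _ _)).comp
      (ProbabilityMeasure.tendsto_measure_of_null_frontier_of_tendsto' tendsto_id (by rw [hC.frontier_eq]; simp))
  let K : Set (ProbabilityMeasure Ω) := {ν | (∀ g, ν.map (hS g).measurable.aemeasurable = ν) ∧ α ≤ (ν : Measure Ω).real A0}
  have hK : IsCompact K := by
    refine IsClosed.isCompact (IsClosed.inter ?_ (isClosed_le continuous_const (hcont _ hA0)))
    have : {ν : ProbabilityMeasure Ω | ∀ g, ν.map (hS g).measurable.aemeasurable = ν} = ⋂ g, {ν | ν.map (hS g).measurable.aemeasurable = ν} := by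
      ext; simp
    change IsClosed {ν : ProbabilityMeasure Ω | ∀ g, ν.map (hS g).measurable.aemeasurable = ν}
    rw [this]
    exact isClosed_iInter fun g => isClosed_eq (ProbabilityMeasure.continuous_map (hS g)) continuous_id
  let U : ℕ → Set (ProbabilityMeasure Ω) := fun M => {ν | 1 / ((M : ℝ) + 1) < ∑ n ∈ Finset.Icc 1 (M + 1), (ν : Measure Ω).real (B n)}
  obtain ⟨M, hM⟩ := hK.elim_directed_cover U (fun M => isOpen_lt continuous_const (continuous_finset_sum _ fun n _ => hcont _ (hB n)))
    (fun ν hν => by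
      let s : Sys G Ω := ⟨S, fun ω => by ext; simp [S], fun a b ω => by ext; simp [S, add_assoc], ν, inferInstance,
        fun g => ⟨(hS g).measurable, congrArg (fun ν : ProbabilityMeasure Ω => (ν : Measure Ω)) (hν.1 g)⟩, ⊥, bot_le, fun g C hC => by
        rcases MeasurableSpace.measurableSet_bot_iff.1 hC with rfl | rfl
        · exact @MeasurableSet.empty _ ⊥
        · exact @MeasurableSet.univ _ ⊥⟩
      obtain ⟨c, hc, h⟩ := s.sz V hA0.isClosed.measurableSet (hα.trans_le hν.2)
      obtain ⟨N0, hN0⟩ := eventually_atTop.1 h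
      obtain ⟨N1, hN1⟩ := exists_nat_gt (1 / c)
      have h1 := hN0 (N0 + N1 + 1) (by omega)
      rw [Finset.sum_range_succ'] at h1
      have h2 : s.μ.real (⋂ v ∈ V, s.T (ev v 0) ⁻¹' A0) ≤ 1 := measureReal_le_one
      have h3 : 1 < c * N1 := by rwa [div_lt_iff₀' hc] at hN1
      have h4 : 0 < ∑ n ∈ Finset.range (N0 + N1), (ν : Measure Ω).real (B (n + 1)) := by
        change c * _ ≤ ∑ n ∈ Finset.range (N0 + N1), (ν : Measure Ω).real (B (n + 1)) + _ at h1
        push_cast at h1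
        have : 0 ≤ c * (N0 + 1) := by positivity
        linarith
      set x := ∑ n ∈ Finset.range (N0 + N1), (ν : Measure Ω).real (B (n + 1))
      obtain ⟨N2, hN2⟩ := exists_nat_gt (1 / x)
      refine Set.mem_iUnion.2 ⟨N0 + N1 + N2, ?_⟩
      have h5 : x ≤ ∑ n ∈ Finset.Icc 1 (N0 + N1 + N2 + 1), (ν : Measure Ω).real (B n) := by
        simp only [x]
        rw [Finset.range_eq_Ico, Finset.sum_Ico_add' (fun n => (ν : Measure Ω).real (B n))]
        refine Finset.sum_le_sum_of_subset_of_nonneg (fun n hn => ?_) fun _ _ _ => measureReal_nonneg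
        rw [Finset.mem_Ico] at hn; rw [Finset.mem_Icc]; omega
      refine lt_of_lt_of_le ?_ h5
      rw [div_lt_iff₀' h4] at hN2
      rw [div_lt_iff₀' (by positivity)]
      refine hN2.trans_le ?_
      rw [mul_comm]
      gcongr
      push_cast
      linarith [Nat.cast_nonneg (α := ℝ) N0, Nat.cast_nonneg (α := ℝ) N1])
    (directed_of_isDirected_le fun M M' h ν hν => by
      refine lt_of_le_of_lt ?_ (lt_of_lt_of_le hν (Finset.sum_le_sum_of_subset_of_nonneg (Finset.Icc_subset_Icc le_rfl (by omega)) fun _ _ _ => measureReal_nonneg))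
      gcongr)
  refine ⟨M + 1, by omega, 1 / ((M : ℝ) + 1), by positivity, fun X _ μ _ R h0 ha hR A hA hαA => ?_⟩
  classical
  let φ : X → Ω := fun x h => decide (R h x ∈ A)
  have hφ : Measurable φ := measurable_pi_lambda _ fun h => measurable_to_bool (by
    convert (hR h).measurable hA using 1; ext x; simp [φ])
  have hφS : ∀ g, S g ∘ φ = φ ∘ R g := fun g => by ext x h; simp [S, φ, ha]
  have hpre : ∀ g, φ ⁻¹' (S g ⁻¹' A0) = R g ⁻¹' A := fun g => by ext x; simp [S, φ, A0]
  let ν : ProbabilityMeasure Ω := ⟨μ.map φ, Measure.isProbabilityMeasure_map hφ.aemeasurable⟩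
  have hνm : ∀ C : Set Ω, IsClopen C → (ν : Measure Ω).real C = μ.real (φ ⁻¹' C) := fun C hC => by
    simp only [ν, Measure.real, ProbabilityMeasure.coe_mk]
    rw [Measure.map_apply hφ hC.isClosed.measurableSet]
  have hν : ν ∈ K := by
    refine ⟨fun g => Subtype.ext ?_, ?_⟩
    · change (μ.map φ).map (S g) = μ.map φ
      rw [Measure.map_map (hS g).measurable hφ, hφS, ← Measure.map_map hφ (hR g).measurable, (hR g).map_eq]
    · rw [hνm _ hA0]
      have : φ ⁻¹' A0 = A := by ext x; simp [φ, A0, h0]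
      rwa [this]
  refine (hM hν).le.trans_eq (Finset.sum_congr rfl fun n _ => ?_)
  rw [hνm _ (hB n)]
  simp only [B, Set.preimage_iInter, hpre]
section
variable {X : Type} {ℓ : ℕ}
lemma prodPow_succ (T : Fin (ℓ + 1) → Equiv.Perm X) (a : Fin (ℓ + 1) → ℤ) :
    prodPow T a = T 0 ^ a 0 * prodPow (fun i => T i.succ) fun i => a i.succ := by
  rw [prodPow, List.ofFn_succ, List.prod_cons, prodPow]

lemma prodPow_add : ∀ {ℓ : ℕ} (T : Fin ℓ → Equiv.Perm X) (_ : ∀ i i', Commute (T i) (T i')) (a b : Fin ℓ → ℤ),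
    prodPow T (a + b) = prodPow T a * prodPow T b
  | 0, T, _, a, b => by simp [prodPow]
  | ℓ + 1, T, h, a, b => by
    rw [prodPow_succ, prodPow_succ T a, prodPow_succ T b]
    have h1 := prodPow_add (fun i => T i.succ) (fun i j => h _ _) (fun i => a i.succ) (fun i => b i.succ)
    have h2 : Commute (T 0 ^ b 0) (prodPow (fun i => T i.succ) fun i => a i.succ) :=
      Commute.list_prod_right _ _ fun x hx => by
        obtain ⟨i, rfl⟩ := (List.mem_ofFn' _ _).1 hx
        exact (h _ _).zpow_zpow _ _
    change T 0 ^ (a 0 + b 0) * prodPow (fun i => T i.succ) ((fun i => a i.succ) + fun i => b i.succ) = _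
    rw [h1, zpow_add, mul_assoc, mul_assoc, ← mul_assoc (T 0 ^ b 0), h2.eq, mul_assoc]

lemma prodPow_mp [MeasurableSpace X] {μ : Measure X} : ∀ {ℓ : ℕ} (T : Fin ℓ → Equiv.Perm X) (_ : ∀ i, MeasurePreserving (T i) μ μ)
    (_ : ∀ i, MeasurePreserving (T i).symm μ μ) (a : Fin ℓ → ℤ), MeasurePreserving (prodPow T a) μ μ
  | 0, T, _, _, a => by
    have : prodPow T a = 1 := by simp [prodPow]
    rw [this]; exact MeasurePreserving.id μ
  | ℓ + 1, T, h, h', a => by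
    rw [prodPow_succ, Equiv.Perm.coe_mul]
    refine MeasurePreserving.comp ?_ (prodPow_mp _ (fun i => h _) (fun i => h' _) _)
    have hp : ∀ (S : Equiv.Perm X) (k : ℕ), MeasurePreserving S μ μ → MeasurePreserving (S ^ k : Equiv.Perm X) μ μ := fun S k hS => by
      have := hS.iterate k
      rwa [← Equiv.Perm.coe_pow] at this
    rcases Int.eq_nat_or_neg (a 0) with ⟨k, hk | hk⟩
    · rw [hk, zpow_natCast]; exact hp _ k (h 0)
    · rw [hk, zpow_neg, zpow_natCast, ← inv_pow]; exact hp _ k (h' 0)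
end

/-- Uniform polynomial Szemerédi theorem: for polynomials `q_{i,j}` with `q_{i,j}(0) = 0`
and every `α > 0` there is `c > 0`, depending only on `α` and the polynomials (in
particular not on the probability space or the transformations), such that for all
commuting invertible measure preserving `T₁, …, T_ℓ` and every `A` with `μ(A) ≥ α`,
`liminf_N (1/N) ∑_{n=1}^N μ(A ∩ (∏ᵢTᵢ^{q_{i,1}(n)})A ∩ ⋯ ∩ (∏ᵢTᵢ^{q_{i,m}(n)})A) ≥ c`. -/
theorem uniform_polynomial_szemeredi (ℓ m : ℕ)
    (q : Fin ℓ → Fin m → Polynomial ℤ) (hq : ∀ i j, (q i j).eval 0 = 0) :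
    ∀ α : ℝ, 0 < α → ∃ c : ℝ, 0 < c ∧
      ∀ (X : Type) [MeasurableSpace X] (μ : Measure X) [IsProbabilityMeasure μ]
        (T : Fin ℓ → Equiv.Perm X),
        (∀ i, MeasurePreserving (T i) μ μ) →
        (∀ i, MeasurePreserving (T i).symm μ μ) →
        (∀ i i', Commute (T i) (T i')) →
        ∀ A : Set X, MeasurableSet A → α ≤ (μ A).toReal →
          c ≤ Filter.liminf (fun N : ℕ => (N : ℝ)⁻¹ * ∑ n ∈ Finset.Icc 1 N,
                (μ (A ∩ ⋂ j : Fin m,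
                  ⇑(prodPow T fun i => (q i j).eval (n : ℤ)) '' A)).toReal)
              Filter.atTop := by
  classical
  intro α hα
  set D : ℕ := Finset.univ.sup fun p : Fin ℓ × Fin m => (q p.1 p.2).natDegree with hD
  let v : Fin m → Fin D → Fin m → Fin D → ℤ := fun j k => Pi.single j (Pi.single k 1)
  obtain ⟨M, hM, c, hc, hmain⟩ := unif (insert 0 (Finset.univ.image v)) hα
  set c' := c / (2 * 1 * M * M) with hc'
  have hM' : (0 : ℝ) < M := by exact_mod_cast hM
  have hc'0 : 0 < c' := by positivity
  refine ⟨c' / 2, by positivity, fun X _ μ _ T hT hT' hcm A hA hαA => ?_⟩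
  let Φ : ℕ → ℝ := fun n => μ.real (A ∩ ⋂ j : Fin m, ⇑(prodPow T fun i => (q i j).eval (n : ℤ)) '' A)
  have heval : ∀ i j (x : ℤ), (q i j).eval x = ∑ k : Fin D, x ^ ((k : ℕ) + 1) * (q i j).coeff (k + 1) := fun i j x => by
    have hd : (q i j).natDegree < D + 1 := Nat.lt_succ_of_le (Finset.le_sup (f := fun p : Fin ℓ × Fin m => (q p.1 p.2).natDegree) (Finset.mem_univ (i, j)))
    rw [Polynomial.eval_eq_sum_range' hd, Finset.sum_range_succ', Finset.sum_range]
    have : (q i j).coeff 0 = 0 := by rw [Polynomial.coeff_zero_eq_eval_zero, hq]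
    simp [this, mul_comm]
  have hinv : ∀ a : Fin ℓ → ℤ, prodPow T (-a) = (prodPow T a)⁻¹ := fun a => by
    rw [eq_inv_iff_mul_eq_one, ← prodPow_add T hcm, neg_add_cancel]
    simp [prodPow]
  have hdil : ∀ d : ℕ, c ≤ 1 * ∑ n ∈ Finset.Icc 1 M, Φ (n * d) := fun d => by
    let L : (Fin m → Fin D → ℤ) → Fin ℓ → ℤ := fun g i => -∑ j, ∑ k, g j k * ((d : ℤ) ^ ((k : ℕ) + 1) * (q i j).coeff (k + 1))
    have hL : ∀ a b, L (a + b) = L a + L b := fun a b => by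
      ext i; simp only [L, Pi.add_apply, add_mul, Finset.sum_add_distrib, neg_add]
    have hL0 : L 0 = 0 := by ext i; simp [L]
    have h1 := hmain X μ (fun g => prodPow T (L g)) (fun x => by simp [hL0, prodPow]) (fun a b x => by
      rw [hL, prodPow_add T hcm]; rfl) (fun g => prodPow_mp T hT hT' _) A hA hαA
    rw [one_mul]
    refine h1.trans (Finset.sum_le_sum fun n _ => measureReal_mono ?_)
    intro x hx
    simp only [Set.mem_iInter] at hx
    refine ⟨?_, Set.mem_iInter.2 fun j => ?_⟩
    · have := hx 0 (Finset.mem_insert_self _ _)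
      have h0 : ev (0 : Fin D → Fin m → Fin D → ℤ) n = 0 := by simp [ev]
      rw [h0] at this
      simpa [hL0, prodPow] using this
    · have := hx (v j) (Finset.mem_insert_of_mem (Finset.mem_image_of_mem _ (Finset.mem_univ _)))
      have h2 : L (ev (v j) n) = -fun i => (q i j).eval ((n * d : ℕ) : ℤ) := by
        have h3 : ∀ j' k, ev (v j) n j' k = if j' = j then (n : ℤ) ^ ((k : ℕ) + 1) else 0 := fun j' k => by
          simp only [ev, v, Finset.sum_apply, Pi.smul_apply, Pi.single_apply]
          by_cases h : j' = j
          · simp [h, Pi.single_apply]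
          · simp [h]
        ext i
        simp only [L, h3, Pi.neg_apply, heval]
        congr 1
        rw [Finset.sum_eq_single j (fun j' _ h => by simp [h]) (by simp)]
        refine Finset.sum_congr rfl fun k _ => ?_
        simp only [if_true]; push_cast; ring
      rw [h2, hinv] at this
      exact ⟨_, this, Equiv.apply_symm_apply _ _⟩
  have hcount := count (Φ := Φ) (u := fun _ => c) (fun n => measureReal_nonneg) one_pos hc hM (Eventually.of_forall fun N => by
    rw [Finset.sum_const, Finset.card_range, nsmul_eq_mul, mul_comm]) hdil
  have hle1 : ∀ n, Φ n ≤ 1 := fun n => measureReal_le_one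
  change c' / 2 ≤ liminf (fun N : ℕ => (N : ℝ)⁻¹ * ∑ n ∈ Finset.Icc 1 N, Φ n) atTop
  refine le_liminf_of_le (IsBoundedUnder.isCoboundedUnder_ge (isBoundedUnder_of ⟨1, fun N => ?_⟩)) ?_
  · have := Finset.sum_le_sum fun n (_ : n ∈ Finset.Icc 1 N) => hle1 n
    rw [Finset.sum_const, Nat.card_Icc, nsmul_eq_mul, mul_one, Nat.add_sub_cancel] at this
    calc (N : ℝ)⁻¹ * ∑ n ∈ Finset.Icc 1 N, Φ n ≤ (N : ℝ)⁻¹ * N := by gcongr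
      _ ≤ 1 := inv_mul_le_one
  · obtain ⟨N0, hN0⟩ := eventually_atTop.1 hcount
    obtain ⟨N1, hN1⟩ := exists_nat_gt (2 / c')
    refine eventually_atTop.2 ⟨N0 + N1 + 1, fun N hN => ?_⟩
    have h1 := hN0 (N + 1) (by omega)
    have h2 : ∑ n ∈ Finset.range (N + 1), Φ n = ∑ n ∈ Finset.Icc 1 N, Φ n + Φ 0 := by
      rw [Finset.sum_range_succ', Finset.range_eq_Ico, Finset.sum_Ico_add']; rfl
    rw [h2, ← hc'] at h1
    have hNp : (0 : ℝ) < N := by exact_mod_cast (by omega : 0 < N)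
    rw [le_inv_mul_iff₀ hNp]
    have h3 : 2 < c' * N := by
      rw [div_lt_iff₀' hc'0] at hN1
      refine hN1.trans_le ?_
      gcongr; omega
    push_cast at h1
    have := hle1 0
    linarith
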